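/- arXiv:1210.0919 — 2 statements merged into one kernel-verified Lean document; each statement's English description precedes it below -/
import Mathlib

section
/- Let m = 2 or m = 3, and assume that for every compact interval [t_1, t_2] ⊆ ℝ there exist constants 0 < β_1 ≤ β_2 with β_1 ≤ (−1)^m·β(t) ≤ β_2 for almost every t ∈ [t_1, t_2]. Then the family of operators W(t,τ) on X^{∧m} is a u_m-positive linear process with respect to the cone K_m; moreover one may take η_0 = 3 when m = 2 and η_0 = 5 when m = 3. -/
open MeasureTheory

noncomputable section

abbrev I01 : Set ℝ := Set.Icc (-1 : ℝ) 0

abbrev Cube (m : ℕ) := Fin m → I01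

/-- The subspace of antisymmetric continuous functions on the cube `[-1,0]^m`. -/
def Xwedge (m : ℕ) : Submodule ℝ C(Cube m, ℝ) where
  carrier := {φ | ∀ (σ : Equiv.Perm (Fin m)) (θ : Cube m),
      φ (θ ∘ σ) = ((Equiv.Perm.sign σ : ℤ) : ℝ) * φ θ}
  add_mem' := by
    intro φ ψ hφ hψ σ θ
    simp only [ContinuousMap.add_apply, hφ σ θ, hψ σ θ]
    ring
  zero_mem' := by
    intro σ θ
    simp
  smul_mem' := by
    intro c φ hφ σ θ
    simp only [ContinuousMap.smul_apply, hφ σ θ, smul_eq_mul]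
    ring

/-- The fundamental simplex `T_m` of ordered tuples. -/
def TsetC (m : ℕ) : Set (Cube m) := {θ | Monotone fun i => (θ i : ℝ)}

/-- The cone `K_m`. -/
def Kcone (m : ℕ) : Set (Xwedge m) :=
  {φ | ∀ θ ∈ TsetC m, 0 ≤ (φ : C(Cube m, ℝ)) θ}

/-- A solution of `x'(t) = -α(t) x(t) - β(t) x(t-1)` on `[τ-1, T]`. -/
def IsSolution (a c : ℝ → ℝ) (τ T : ℝ) (x : ℝ → ℝ) : Prop :=
  ContinuousOn x (Set.Icc (τ - 1) T) ∧
  ∀ t ∈ Set.Icc τ T, x t = x τ - ∫ s in τ..t, (a s * x s + c s * x (s - 1))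

/-- `W` is the `m`-fold exterior power of the solution operator from time `τ` to time `t`. -/
def IsWedgePower (a c : ℝ → ℝ) (m : ℕ) (τ t : ℝ) (W : Xwedge m →L[ℝ] Xwedge m) : Prop :=
  ∀ x : Fin m → ℝ → ℝ, (∀ i, IsSolution a c τ t (x i)) →
    ∀ Φ Ψ : Xwedge m,
      (∀ θ : Cube m, (Φ : C(Cube m, ℝ)) θ = (Matrix.of fun i j => x i (τ + (θ j : ℝ))).det) →
      (∀ θ : Cube m, (Ψ : C(Cube m, ℝ)) θ = (Matrix.of fun i j => x i (t + (θ j : ℝ))).det) →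
      W Φ = Ψ

/-- The polynomial `u_m(θ) = (∏_{1 ≤ i < j ≤ m} (θ_j - θ_i)) (∏_{1 ≤ i < j ≤ m-1} (1 + θ_i - θ_j))`
(here with `0`-indexed coordinates). -/
def umFun (m : ℕ) (θ : Fin m → ℝ) : ℝ :=
  (∏ p ∈ Finset.univ.filter (fun p : Fin m × Fin m => p.1 < p.2), (θ p.2 - θ p.1)) *
  (∏ p ∈ Finset.univ.filter (fun p : Fin m × Fin m => p.1 < p.2 ∧ (p.2 : ℕ) + 2 ≤ m),
    (1 + θ p.1 - θ p.2))

/-- Positivity and one-step estimates for a two-time function on the strip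
`s₁ ≤ s₂ ≤ s₁ + 1`, `s₂ ≤ T`. -/
structure IsFlow₂ (T c₁ c₂ : ℝ) (f : ℝ → ℝ → ℝ) : Prop where
  nonneg : ∀ s₁ s₂, -1 ≤ s₁ → s₁ ≤ s₂ → s₂ ≤ s₁ + 1 → s₂ ≤ T → 0 ≤ f s₁ s₂
  lower : ∀ s₁ s₂ u v ε, -1 ≤ s₁ → s₂ ≤ s₁ + 1 → s₂ ≤ T → s₁ ≤ u → 0 ≤ u → u ≤ v → v ≤ s₂ →
    0 ≤ ε → (∀ r ∈ Set.Icc u v, ε ≤ f (r - 1) s₁) → c₁ * (v - u) * ε ≤ f s₁ s₂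
  upper : ∀ s₁ s₂ M, 0 ≤ s₁ → s₁ ≤ s₂ → s₂ ≤ s₁ + 1 → s₂ ≤ T →
    (∀ r ∈ Set.Icc s₁ s₂, f (r - 1) s₁ ≤ M) → f s₁ s₂ ≤ c₂ * (s₂ - s₁) * M

/-- Local lower bound at `s`, uniform over the family `𝓕`. -/
def LocallyBddBelow₂ (T : ℝ) (𝓕 : Set (ℝ → ℝ → ℝ)) (s : ℝ × ℝ) : Prop :=
  ∃ ε > 0, ∀ᶠ t in nhds s, ∀ f ∈ 𝓕, -1 ≤ t.1 → t.1 ≤ t.2 → t.2 ≤ t.1 + 1 → t.2 ≤ T → ε ≤ f t.1 t.2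

theorem LocallyBddBelow₂.step {T c₁ c₂ : ℝ} {𝓕 : Set (ℝ → ℝ → ℝ)} (hc₁ : 0 < c₁)
    (h𝓕 : ∀ f ∈ 𝓕, IsFlow₂ T c₁ c₂ f) {p s₁ s₂ : ℝ} (hp : -1 < p) (hp₁ : s₁ - 1 < p)
    (hp₂ : p < s₂ - 1) (h : LocallyBddBelow₂ T 𝓕 (p, s₁)) : LocallyBddBelow₂ T 𝓕 (s₁, s₂) := by
  obtain ⟨ε, hε, h⟩ := h
  rw [Metric.eventually_nhds_iff] at h
  obtain ⟨δ, hδ, h⟩ := h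
  obtain ⟨ρ, hρ, hρ'⟩ : ∃ ρ, 0 < ρ ∧ ρ < δ ∧ ρ ≤ (p + 1) / 4 ∧ ρ ≤ (p - (s₁ - 1)) / 4 ∧
      ρ ≤ (s₂ - 1 - p) / 4 := by
    refine ⟨min (δ / 2) (min ((p + 1) / 4) (min ((p - (s₁ - 1)) / 4) ((s₂ - 1 - p) / 4))), ?_, ?_,
      ?_, ?_, ?_⟩
    · refine lt_min (by linarith) (lt_min (by linarith) (lt_min (by linarith) (by linarith)))
    · exact (min_le_left _ _).trans_lt (by linarith)
    · exact (min_le_right _ _).trans (min_le_left _ _)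
    · exact (min_le_right _ _).trans ((min_le_right _ _).trans (min_le_left _ _))
    · exact (min_le_right _ _).trans ((min_le_right _ _).trans (min_le_right _ _))
  refine ⟨c₁ * (2 * ρ) * ε, by positivity, ?_⟩
  rw [Metric.eventually_nhds_iff]
  refine ⟨ρ, hρ, ?_⟩
  rintro ⟨t₁, t₂⟩ ht f hf h₀ h₁ h₂ h₃
  simp only [Prod.dist_eq, Real.dist_eq, max_lt_iff, abs_lt] at ht h₀ h₁ h₂ h₃ ⊢
  have := (h𝓕 f hf).lower t₁ t₂ (p + 1 - ρ) (p + 1 + ρ) ε h₀ h₂ h₃ (by linarith) (by linarith)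
    (by linarith) (by linarith) hε.le ?_
  · convert this using 2
    ring
  · intro r hr
    refine h (y := (r - 1, t₁)) ?_ f hf ?_ ?_ ?_ ?_
    · simp only [Prod.dist_eq, Real.dist_eq, max_lt_iff, abs_lt]
      refine ⟨⟨?_, ?_⟩, ?_, ?_⟩ <;> linarith [hr.1, hr.2]
    all_goals simp only; linarith [hr.1, hr.2]

theorem LocallyBddBelow₂.of_box {T c₁ c₂ : ℝ} {𝓕 : Set (ℝ → ℝ → ℝ)} (hc₁ : 0 < c₁)
    (h𝓕 : ∀ f ∈ 𝓕, IsFlow₂ T c₁ c₂ f) {x₁ y₁ x₂ y₂ ε : ℝ} (hx₁ : -1 < x₁) (h₁ : x₁ < y₁)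
    (h₁₂ : y₁ < x₂) (h₂ : x₂ < y₂) (hy₂ : y₂ < 0) (hε : 0 < ε)
    (hbox : ∀ f ∈ 𝓕, ∀ s₁ s₂, x₁ ≤ s₁ → s₁ ≤ y₁ → x₂ ≤ s₂ → s₂ ≤ y₂ → ε ≤ f s₁ s₂)
    {s₁ s₂ : ℝ} (hs₁ : 1 ≤ s₁) (hs₂ : 2 ≤ s₂) (hs : s₁ < s₂) (hs' : s₂ ≤ s₁ + 1) :
    LocallyBddBelow₂ T 𝓕 (s₁, s₂) := by
  have A0 : ∀ s₁ s₂, x₁ < s₁ → s₁ < y₁ → x₂ < s₂ → s₂ < y₂ → LocallyBddBelow₂ T 𝓕 (s₁, s₂) := by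
    intro s₁ s₂ a b c d
    refine ⟨ε, hε, ?_⟩
    filter_upwards [(isOpen_Ioo.prod isOpen_Ioo).mem_nhds
      (show (s₁, s₂) ∈ Set.Ioo x₁ y₁ ×ˢ Set.Ioo x₂ y₂ from ⟨⟨a, b⟩, c, d⟩)] with t ht f hf _ _ _ _
    exact hbox f hf _ _ ht.1.1.le ht.1.2.le ht.2.1.le ht.2.2.le
  have A1 : ∀ s₁ s₂, x₂ < s₁ → s₁ < y₂ → x₁ + 1 < s₂ → s₁ < s₂ →
      LocallyBddBelow₂ T 𝓕 (s₁, s₂) := by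
    intro s₁ s₂ a b c d
    obtain ⟨p, hp, hp'⟩ := exists_between (show max x₁ (s₁ - 1) < min (s₂ - 1) y₁ by
      rw [max_lt_iff, lt_min_iff, lt_min_iff]; refine ⟨⟨?_, ?_⟩, ?_, ?_⟩ <;> linarith)
    rw [max_lt_iff] at hp
    rw [lt_min_iff] at hp'
    exact (A0 p s₁ hp.1 hp'.2 a b).step hc₁ h𝓕 (by linarith) hp.2 hp'.1
  have A2 : ∀ s₁ s₂, x₁ + 1 < s₁ → s₁ < 1 + y₂ → x₂ + 1 < s₂ → s₁ < s₂ → s₂ ≤ s₁ + 1 →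
      LocallyBddBelow₂ T 𝓕 (s₁, s₂) := by
    intro s₁ s₂ a b c d e
    obtain ⟨p, hp, hp'⟩ := exists_between (show max x₂ (s₁ - 1) < min (s₂ - 1) y₂ by
      rw [max_lt_iff, lt_min_iff, lt_min_iff]; refine ⟨⟨?_, ?_⟩, ?_, ?_⟩ <;> linarith)
    rw [max_lt_iff] at hp
    rw [lt_min_iff] at hp'
    exact (A1 p s₁ hp.1 hp'.2 a (by linarith)).step hc₁ h𝓕 (by linarith) hp.2 hp'.1
  have A3 : ∀ s₁ s₂, x₂ + 1 < s₁ → s₁ < 2 + y₂ → x₁ + 2 < s₂ → s₁ < s₂ → s₂ ≤ s₁ + 1 →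
      LocallyBddBelow₂ T 𝓕 (s₁, s₂) := by
    intro s₁ s₂ a b c d e
    obtain ⟨p, hp, hp'⟩ := exists_between (show max (x₁ + 1) (s₁ - 1) < min (s₂ - 1) (1 + y₂) by
      rw [max_lt_iff, lt_min_iff, lt_min_iff]; refine ⟨⟨?_, ?_⟩, ?_, ?_⟩ <;> linarith)
    rw [max_lt_iff] at hp
    rw [lt_min_iff] at hp'
    exact (A2 p s₁ hp.1 hp'.2 a (by linarith) (by linarith)).step hc₁ h𝓕 (by linarith) hp.2 hp'.1
  have A4 : ∀ s₁ s₂, x₁ + 2 < s₁ → s₁ < 3 + y₂ → x₂ + 2 < s₂ → s₁ < s₂ → s₂ ≤ s₁ + 1 →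
      LocallyBddBelow₂ T 𝓕 (s₁, s₂) := by
    intro s₁ s₂ a b c d e
    obtain ⟨p, hp, hp'⟩ := exists_between (show max (x₂ + 1) (s₁ - 1) < min (s₂ - 1) (2 + y₂) by
      rw [max_lt_iff, lt_min_iff, lt_min_iff]; refine ⟨⟨?_, ?_⟩, ?_, ?_⟩ <;> linarith)
    rw [max_lt_iff] at hp
    rw [lt_min_iff] at hp'
    exact (A3 p s₁ hp.1 hp'.2 a (by linarith) (by linarith)).step hc₁ h𝓕 (by linarith) hp.2 hp'.1
  have main : ∀ n : ℕ, ∀ s₁ s₂ : ℝ, s₁ < 2 + n / 2 → 1 ≤ s₁ → 2 ≤ s₂ → s₁ < s₂ → s₂ ≤ s₁ + 1 →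
      LocallyBddBelow₂ T 𝓕 (s₁, s₂) := by
    intro n
    induction n with
    | zero =>
      intro s₁ s₂ h a b c d
      simp only [Nat.cast_zero, zero_div, add_zero] at h
      rcases lt_or_ge s₁ (2 + y₂) with h' | h'
      · exact A3 _ _ (by linarith) h' (by linarith) c d
      · exact A4 _ _ (by linarith) (by linarith) (by linarith) c d
    | succ n ih =>
      intro s₁ s₂ h a b c d
      rcases lt_or_ge s₁ (2 + n / 2) with h' | h'
      · exact ih _ _ h' a b c d
      have hn : (0 : ℝ) ≤ n := n.cast_nonneg
      obtain ⟨p, hp, hp'⟩ := exists_between (show s₁ - 1 < min (s₂ - 1) (s₁ - 1 / 2) by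
        rw [lt_min_iff]; constructor <;> linarith)
      rw [lt_min_iff] at hp'
      push_cast at h
      exact (ih p s₁ (by linarith) (by linarith) (by linarith) (by linarith) (by linarith)).step
        hc₁ h𝓕 (by linarith) hp hp'.1
  obtain ⟨n, hn⟩ := exists_nat_gt (2 * (s₁ - 2))
  exact main n _ _ (by linarith) hs₁ hs₂ hs hs'

theorem exists_two_sided_bound₂ {T c₁ c₂ M : ℝ} {𝓕 : Set (ℝ → ℝ → ℝ)} (hc₁ : 0 < c₁)
    (hc₂ : 0 < c₂) (hM : 0 < M) (h𝓕 : ∀ f ∈ 𝓕, IsFlow₂ T c₁ c₂ f)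
    (hbdd : ∀ f ∈ 𝓕, ∀ s₁ s₂, -1 ≤ s₁ → s₁ ≤ s₂ → s₂ ≤ s₁ + 1 → s₂ ≤ T → f s₁ s₂ ≤ M)
    {x₁ y₁ x₂ y₂ ε : ℝ} (hx₁ : -1 < x₁) (h₁ : x₁ < y₁)
    (h₁₂ : y₁ < x₂) (h₂ : x₂ < y₂) (hy₂ : y₂ < 0) (hε : 0 < ε)
    (hbox : ∀ f ∈ 𝓕, ∀ s₁ s₂, x₁ ≤ s₁ → s₁ ≤ y₁ → x₂ ≤ s₂ → s₂ ≤ y₂ → ε ≤ f s₁ s₂) :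
    ∃ C₁ C₂, 0 < C₁ ∧ 0 < C₂ ∧ ∀ f ∈ 𝓕, ∀ s₁ s₂, 2 ≤ s₁ → s₁ ≤ s₂ → s₂ ≤ s₁ + 1 → s₂ ≤ T →
      C₁ * (s₂ - s₁) ≤ f s₁ s₂ ∧ f s₁ s₂ ≤ C₂ * (s₂ - s₁) := by
  have hK : IsCompact {s : ℝ × ℝ | 1 ≤ s.1 ∧ 2 ≤ s.2 ∧ s.1 + 1 / 2 ≤ s.2 ∧ s.2 ≤ s.1 + 1 ∧
      s.2 ≤ T} := by
    refine (isCompact_Icc (a := ((1 : ℝ), (2 : ℝ))) (b := (T, T))).of_isClosed_subset ?_ ?_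
    · simp only [Set.ofPred_and]
      refine IsClosed.inter ?_ (IsClosed.inter ?_ (IsClosed.inter ?_ (IsClosed.inter ?_ ?_)))
      all_goals exact isClosed_le (by fun_prop) (by fun_prop)
    · rintro ⟨s₁, s₂⟩ ⟨a, b, c, d, e⟩
      simp only at a b c d e
      exact ⟨⟨a, b⟩, ⟨by simp only; linarith, e⟩⟩
  obtain ⟨κ, hκ, hlow⟩ : ∃ κ > 0, ∀ s ∈ {s : ℝ × ℝ | 1 ≤ s.1 ∧ 2 ≤ s.2 ∧ s.1 + 1 / 2 ≤ s.2 ∧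
      s.2 ≤ s.1 + 1 ∧ s.2 ≤ T}, ∀ f ∈ 𝓕, κ ≤ f s.1 s.2 := by
    refine hK.induction_on (p := fun S => ∃ κ > 0, ∀ s ∈ S, ∀ f ∈ 𝓕, κ ≤ f s.1 s.2)
      ⟨1, one_pos, by simp⟩ ?_ ?_ ?_
    · rintro S S' hSS' ⟨κ, hκ, h⟩
      exact ⟨κ, hκ, fun s hs => h s (hSS' hs)⟩
    · rintro S S' ⟨κ, hκ, h⟩ ⟨κ', hκ', h'⟩
      refine ⟨min κ κ', lt_min hκ hκ', ?_⟩
      rintro s (hs | hs) f hf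
      · exact (min_le_left _ _).trans (h s hs f hf)
      · exact (min_le_right _ _).trans (h' s hs f hf)
    · rintro ⟨s₁, s₂⟩ ⟨a, b, c, d, e⟩
      simp only at a b c d e
      obtain ⟨κ, hκ, h⟩ := LocallyBddBelow₂.of_box hc₁ h𝓕 hx₁ h₁ h₁₂ h₂ hy₂ hε hbox a b
        (by linarith) d
      refine ⟨_, Filter.inter_mem self_mem_nhdsWithin (mem_nhdsWithin_of_mem_nhds h), κ, hκ, ?_⟩
      rintro ⟨t₁, t₂⟩ ⟨⟨a', b', c', d', e'⟩, ht⟩ f hf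
      simp only at a' b' c' d' e'
      exact ht f hf (by simp only; linarith) (by simp only; linarith) d' e'
  refine ⟨c₁ * κ / 2, c₂ * M, by positivity, by positivity, fun f hf s₁ s₂ a b c d => ⟨?_, ?_⟩⟩
  · have := (h𝓕 f hf).lower s₁ s₂ s₁ ((s₁ + s₂) / 2) κ (by linarith) c d le_rfl (by linarith)
      (by linarith) (by linarith) hκ.le ?_
    · calc c₁ * κ / 2 * (s₂ - s₁) = c₁ * ((s₁ + s₂) / 2 - s₁) * κ := by ring
        _ ≤ _ := this
    · rintro r ⟨hr, hr'⟩
      exact hlow (r - 1, s₁) ⟨by simp only; linarith, a, by simp only; linarith,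
        by simp only; linarith, by simp only; linarith⟩ f hf
  · have := (h𝓕 f hf).upper s₁ s₂ M (by linarith) b c d ?_
    · calc f s₁ s₂ ≤ _ := this
        _ = _ := by ring
    · rintro r ⟨hr, hr'⟩
      exact hbdd f hf _ _ (by linarith) (by linarith) (by linarith) (by linarith)

/-- Positivity and one-step estimates for a three-time function on the strip
`s₁ ≤ s₂ ≤ s₃ ≤ s₁ + 1`, `s₃ ≤ T`. -/
structure IsFlow₃ (T c₁ c₂ : ℝ) (f : ℝ → ℝ → ℝ → ℝ) : Prop where
  nonneg : ∀ s₁ s₂ s₃, -1 ≤ s₁ → s₁ ≤ s₂ → s₂ ≤ s₃ → s₃ ≤ s₁ + 1 → s₃ ≤ T → 0 ≤ f s₁ s₂ s₃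
  lower : ∀ s₁ s₂ s₃ u v ε, -1 ≤ s₁ → s₁ ≤ s₂ → s₃ ≤ s₁ + 1 → s₃ ≤ T → s₂ ≤ u → 0 ≤ u → u ≤ v →
    v ≤ s₃ → 0 ≤ ε → (∀ r ∈ Set.Icc u v, ε ≤ f (r - 1) s₁ s₂) → c₁ * (v - u) * ε ≤ f s₁ s₂ s₃
  upper : ∀ s₁ s₂ s₃ M, -1 ≤ s₁ → s₁ ≤ s₂ → 0 ≤ s₂ → s₂ ≤ s₃ → s₃ ≤ s₁ + 1 → s₃ ≤ T →
    (∀ r ∈ Set.Icc s₂ s₃, f (r - 1) s₁ s₂ ≤ M) → f s₁ s₂ s₃ ≤ c₂ * (s₃ - s₂) * M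

/-- Local lower bound at `s`, uniform over the family `𝓕`. -/
def LocallyBddBelow₃ (T : ℝ) (𝓕 : Set (ℝ → ℝ → ℝ → ℝ)) (s : ℝ × ℝ × ℝ) : Prop :=
  ∃ ε > 0, ∀ᶠ t in nhds s, ∀ f ∈ 𝓕, -1 ≤ t.1 → t.1 ≤ t.2.1 → t.2.1 ≤ t.2.2 → t.2.2 ≤ t.1 + 1 →
    t.2.2 ≤ T → ε ≤ f t.1 t.2.1 t.2.2

theorem LocallyBddBelow₃.step {T c₁ c₂ : ℝ} {𝓕 : Set (ℝ → ℝ → ℝ → ℝ)} (hc₁ : 0 < c₁)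
    (h𝓕 : ∀ f ∈ 𝓕, IsFlow₃ T c₁ c₂ f) {p s₁ s₂ s₃ : ℝ} (hp : -1 < p) (hp₁ : s₂ - 1 < p)
    (hp₂ : p < s₃ - 1) (h : LocallyBddBelow₃ T 𝓕 (p, s₁, s₂)) :
    LocallyBddBelow₃ T 𝓕 (s₁, s₂, s₃) := by
  obtain ⟨ε, hε, h⟩ := h
  rw [Metric.eventually_nhds_iff] at h
  obtain ⟨δ, hδ, h⟩ := h
  obtain ⟨ρ, hρ, hρ'⟩ : ∃ ρ, 0 < ρ ∧ ρ < δ ∧ ρ ≤ (p + 1) / 4 ∧ ρ ≤ (p - (s₂ - 1)) / 4 ∧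
      ρ ≤ (s₃ - 1 - p) / 4 := by
    refine ⟨min (δ / 2) (min ((p + 1) / 4) (min ((p - (s₂ - 1)) / 4) ((s₃ - 1 - p) / 4))), ?_, ?_,
      ?_, ?_, ?_⟩
    · refine lt_min (by linarith) (lt_min (by linarith) (lt_min (by linarith) (by linarith)))
    · exact (min_le_left _ _).trans_lt (by linarith)
    · exact (min_le_right _ _).trans (min_le_left _ _)
    · exact (min_le_right _ _).trans ((min_le_right _ _).trans (min_le_left _ _))
    · exact (min_le_right _ _).trans ((min_le_right _ _).trans (min_le_right _ _))
  refine ⟨c₁ * (2 * ρ) * ε, by positivity, ?_⟩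
  rw [Metric.eventually_nhds_iff]
  refine ⟨ρ, hρ, ?_⟩
  rintro ⟨t₁, t₂, t₃⟩ ht f hf h₀ h₁ h₂ h₃ h₄
  simp only [Prod.dist_eq, Real.dist_eq, max_lt_iff, abs_lt] at ht h₀ h₁ h₂ h₃ h₄ ⊢
  have := (h𝓕 f hf).lower t₁ t₂ t₃ (p + 1 - ρ) (p + 1 + ρ) ε h₀ h₁ h₃ h₄ (by linarith)
    (by linarith) (by linarith) (by linarith) hε.le ?_
  · convert this using 2
    ring
  · intro r hr
    refine h (y := (r - 1, t₁, t₂)) ?_ f hf ?_ ?_ ?_ ?_ ?_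
    · simp only [Prod.dist_eq, Real.dist_eq, max_lt_iff, abs_lt]
      refine ⟨⟨?_, ?_⟩, ⟨?_, ?_⟩, ?_, ?_⟩ <;> linarith [hr.1, hr.2]
    all_goals simp only; linarith [hr.1, hr.2]

theorem LocallyBddBelow₃.step_of_lt {T c₁ c₂ : ℝ} {𝓕 : Set (ℝ → ℝ → ℝ → ℝ)} (hc₁ : 0 < c₁)
    (h𝓕 : ∀ f ∈ 𝓕, IsFlow₃ T c₁ c₂ f) {a b s₁ s₂ s₃ : ℝ} (ha : -1 < a) (has : a < s₃ - 1)
    (hab : a < b) (hsb : s₂ - 1 < b) (hs : s₂ < s₃)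
    (h : ∀ p, a < p → p < b → s₂ - 1 < p → p < s₃ - 1 → LocallyBddBelow₃ T 𝓕 (p, s₁, s₂)) :
    LocallyBddBelow₃ T 𝓕 (s₁, s₂, s₃) := by
  obtain ⟨p, hp, hp'⟩ := exists_between (show max a (s₂ - 1) < min (s₃ - 1) b by
    rw [max_lt_iff, lt_min_iff, lt_min_iff]; refine ⟨⟨?_, ?_⟩, ?_, ?_⟩ <;> linarith)
  rw [max_lt_iff] at hp
  rw [lt_min_iff] at hp'
  exact (h p hp.1 hp'.2 hp.2 hp'.1).step hc₁ h𝓕 (by linarith) hp.2 hp'.1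

theorem LocallyBddBelow₃.of_box {T c₁ c₂ : ℝ} {𝓕 : Set (ℝ → ℝ → ℝ → ℝ)} (hc₁ : 0 < c₁)
    (h𝓕 : ∀ f ∈ 𝓕, IsFlow₃ T c₁ c₂ f) {x₁ y₁ x₂ y₂ x₃ y₃ ε : ℝ} (hx₁ : -1 < x₁) (h₁ : x₁ < y₁)
    (h₁₂ : y₁ < x₂) (h₂ : x₂ < y₂) (h₂₃ : y₂ < x₃) (h₃ : x₃ < y₃) (hy₃ : y₃ < 0) (hε : 0 < ε)
    (hbox : ∀ f ∈ 𝓕, ∀ s₁ s₂ s₃, x₁ ≤ s₁ → s₁ ≤ y₁ → x₂ ≤ s₂ → s₂ ≤ y₂ → x₃ ≤ s₃ → s₃ ≤ y₃ →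
      ε ≤ f s₁ s₂ s₃)
    {s₁ s₂ s₃ : ℝ} (hs₁ : 2 ≤ s₁) (hs₃ : 3 ≤ s₃) (h12 : s₁ < s₂) (h23 : s₂ < s₃)
    (hs' : s₃ ≤ s₁ + 1) : LocallyBddBelow₃ T 𝓕 (s₁, s₂, s₃) := by
  have A0 : ∀ s₁ s₂ s₃, x₁ < s₁ → x₂ < s₂ → x₃ < s₃ → s₁ < y₁ → s₂ < y₂ → s₃ < y₃ →
      LocallyBddBelow₃ T 𝓕 (s₁, s₂, s₃) := by
    intro s₁ s₂ s₃ a b c d e g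
    refine ⟨ε, hε, ?_⟩
    filter_upwards [(isOpen_Ioo.prod (isOpen_Ioo.prod isOpen_Ioo)).mem_nhds
      (show (s₁, s₂, s₃) ∈ Set.Ioo x₁ y₁ ×ˢ Set.Ioo x₂ y₂ ×ˢ Set.Ioo x₃ y₃ from
        ⟨⟨a, d⟩, ⟨b, e⟩, c, g⟩)] with t ht f hf _ _ _ _ _
    exact hbox f hf _ _ _ ht.1.1.le ht.1.2.le ht.2.1.1.le ht.2.1.2.le ht.2.2.1.le ht.2.2.2.le
  have A1 : ∀ s₁ s₂ s₃, x₂ < s₁ → x₃ < s₂ → x₁ + 1 < s₃ → s₁ < y₂ → s₂ < y₃ →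
      s₁ < s₂ → s₂ < s₃ → s₃ ≤ s₁ + 1 → LocallyBddBelow₃ T 𝓕 (s₁, s₂, s₃) := by
    intro s₁ s₂ s₃ a b c d e f g h
    refine .step_of_lt (a := x₁) (b := y₁) hc₁ h𝓕 ?_ ?_ ?_ ?_ ?_ fun p q i j k =>
      A0 p _ _ ?_ ?_ ?_ ?_ ?_ ?_
    all_goals linarith
  have A2 : ∀ s₁ s₂ s₃, x₃ < s₁ → x₁ + 1 < s₂ → x₂ + 1 < s₃ → s₁ < y₃ → s₂ < 1 + y₂ →
      s₁ < s₂ → s₂ < s₃ → s₃ ≤ s₁ + 1 → LocallyBddBelow₃ T 𝓕 (s₁, s₂, s₃) := by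
    intro s₁ s₂ s₃ a b c d e f g h
    refine .step_of_lt (a := x₂) (b := y₂) hc₁ h𝓕 ?_ ?_ ?_ ?_ ?_ fun p q i j k =>
      A1 p _ _ ?_ ?_ ?_ ?_ ?_ ?_ ?_ ?_
    all_goals linarith
  have A3 : ∀ s₁ s₂ s₃, x₁ + 1 < s₁ → x₂ + 1 < s₂ → x₃ + 1 < s₃ → s₁ < 1 + y₂ → s₂ < 1 + y₃ →
      s₁ < s₂ → s₂ < s₃ → s₃ ≤ s₁ + 1 → LocallyBddBelow₃ T 𝓕 (s₁, s₂, s₃) := by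
    intro s₁ s₂ s₃ a b c d e f g h
    refine .step_of_lt (a := x₃) (b := y₃) hc₁ h𝓕 ?_ ?_ ?_ ?_ ?_ fun p q i j k =>
      A2 p _ _ ?_ ?_ ?_ ?_ ?_ ?_ ?_ ?_
    all_goals linarith
  have A4 : ∀ s₁ s₂ s₃, x₂ + 1 < s₁ → x₃ + 1 < s₂ → x₁ + 2 < s₃ → s₁ < 1 + y₃ → s₂ < 2 + y₂ →
      s₁ < s₂ → s₂ < s₃ → s₃ ≤ s₁ + 1 → LocallyBddBelow₃ T 𝓕 (s₁, s₂, s₃) := by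
    intro s₁ s₂ s₃ a b c d e f g h
    refine .step_of_lt (a := x₁ + 1) (b := 1 + y₂) hc₁ h𝓕 ?_ ?_ ?_ ?_ ?_ fun p q i j k =>
      A3 p _ _ ?_ ?_ ?_ ?_ ?_ ?_ ?_ ?_
    all_goals linarith
  have A5 : ∀ s₁ s₂ s₃, x₃ + 1 < s₁ → x₁ + 2 < s₂ → x₂ + 2 < s₃ → s₁ < 2 + y₂ → s₂ < 2 + y₃ →
      s₁ < s₂ → s₂ < s₃ → s₃ ≤ s₁ + 1 → LocallyBddBelow₃ T 𝓕 (s₁, s₂, s₃) := by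
    intro s₁ s₂ s₃ a b c d e f g h
    refine .step_of_lt (a := x₂ + 1) (b := 1 + y₃) hc₁ h𝓕 ?_ ?_ ?_ ?_ ?_ fun p q i j k =>
      A4 p _ _ ?_ ?_ ?_ ?_ ?_ ?_ ?_ ?_
    all_goals linarith
  have A6 : ∀ s₁ s₂ s₃, x₁ + 2 < s₁ → x₂ + 2 < s₂ → x₃ + 2 < s₃ → s₁ < 2 + y₃ → s₂ < 3 + y₂ →
      s₁ < s₂ → s₂ < s₃ → s₃ ≤ s₁ + 1 → LocallyBddBelow₃ T 𝓕 (s₁, s₂, s₃) := by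
    intro s₁ s₂ s₃ a b c d e f g h
    refine .step_of_lt (a := x₃ + 1) (b := 2 + y₂) hc₁ h𝓕 ?_ ?_ ?_ ?_ ?_ fun p q i j k =>
      A5 p _ _ ?_ ?_ ?_ ?_ ?_ ?_ ?_ ?_
    all_goals linarith
  have A7 : ∀ s₁ s₂ s₃, x₂ + 2 < s₁ → x₃ + 2 < s₂ → x₁ + 3 < s₃ → s₁ < 3 + y₂ → s₂ < 3 + y₃ →
      s₁ < s₂ → s₂ < s₃ → s₃ ≤ s₁ + 1 → LocallyBddBelow₃ T 𝓕 (s₁, s₂, s₃) := by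
    intro s₁ s₂ s₃ a b c d e f g h
    refine .step_of_lt (a := x₁ + 2) (b := 2 + y₃) hc₁ h𝓕 ?_ ?_ ?_ ?_ ?_ fun p q i j k =>
      A6 p _ _ ?_ ?_ ?_ ?_ ?_ ?_ ?_ ?_
    all_goals linarith
  have A8 : ∀ s₁ s₂ s₃, x₃ + 2 < s₁ → x₁ + 3 < s₂ → x₂ + 3 < s₃ → s₁ < 3 + y₃ → s₂ < 4 + y₂ →
      s₁ < s₂ → s₂ < s₃ → s₃ ≤ s₁ + 1 → LocallyBddBelow₃ T 𝓕 (s₁, s₂, s₃) := by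
    intro s₁ s₂ s₃ a b c d e f g h
    refine .step_of_lt (a := x₂ + 2) (b := 3 + y₂) hc₁ h𝓕 ?_ ?_ ?_ ?_ ?_ fun p q i j k =>
      A7 p _ _ ?_ ?_ ?_ ?_ ?_ ?_ ?_ ?_
    all_goals linarith
  have A9 : ∀ s₁ s₂ s₃, x₁ + 3 < s₁ → x₂ + 3 < s₂ → x₃ + 3 < s₃ → s₁ < 4 + y₂ → s₂ < 4 + y₃ →
      s₁ < s₂ → s₂ < s₃ → s₃ ≤ s₁ + 1 → LocallyBddBelow₃ T 𝓕 (s₁, s₂, s₃) := by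
    intro s₁ s₂ s₃ a b c d e f g h
    refine .step_of_lt (a := x₃ + 2) (b := 3 + y₃) hc₁ h𝓕 ?_ ?_ ?_ ?_ ?_ fun p q i j k =>
      A8 p _ _ ?_ ?_ ?_ ?_ ?_ ?_ ?_ ?_
    all_goals linarith
  have A10 : ∀ s₁ s₂ s₃, x₂ + 3 < s₁ → x₃ + 3 < s₂ → x₁ + 4 < s₃ → s₁ < 4 + y₃ → s₂ < 5 + y₂ →
      s₁ < s₂ → s₂ < s₃ → s₃ ≤ s₁ + 1 → LocallyBddBelow₃ T 𝓕 (s₁, s₂, s₃) := by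
    intro s₁ s₂ s₃ a b c d e f g h
    refine .step_of_lt (a := x₁ + 3) (b := 4 + y₂) hc₁ h𝓕 ?_ ?_ ?_ ?_ ?_ fun p q i j k =>
      A9 p _ _ ?_ ?_ ?_ ?_ ?_ ?_ ?_ ?_
    all_goals linarith
  have main : ∀ n : ℕ, ∀ s₁ s₂ s₃ : ℝ, s₁ < 3 + n / 2 → 2 ≤ s₁ → 3 ≤ s₃ → s₁ < s₂ → s₂ < s₃ →
      s₃ ≤ s₁ + 1 → LocallyBddBelow₃ T 𝓕 (s₁, s₂, s₃) := by
    intro n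
    induction n with
    | zero =>
      intro s₁ s₂ s₃ h a b c d e
      simp only [Nat.cast_zero, zero_div, add_zero] at h
      rcases lt_or_ge s₁ (3 + y₂) with h₁ | h₁ <;> rcases lt_or_ge s₂ (3 + y₃) with h₂ | h₂
      · apply A7 <;> linarith
      · rcases lt_or_ge s₂ (4 + y₂) with h₃ | h₃
        · apply A8 <;> linarith
        · apply A9 <;> linarith
      · apply A9 <;> linarith
      · rcases lt_or_ge s₂ (4 + y₃) with h₃ | h₃
        · apply A9 <;> linarith
        · apply A10 <;> linarith
    | succ n ih =>
      intro s₁ s₂ s₃ h a b c d e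
      rcases lt_or_ge s₁ (3 + n / 2) with h' | h'
      · exact ih _ _ _ h' a b c d e
      have hn : (0 : ℝ) ≤ n := n.cast_nonneg
      push_cast at h
      refine .step_of_lt (a := s₂ - 1) (b := s₂) hc₁ h𝓕 ?_ ?_ ?_ ?_ ?_ fun p _ _ hp hp' => ?_
      any_goals linarith
      refine .step_of_lt (a := s₁ - 1) (b := s₁ - 1 / 2) hc₁ h𝓕 ?_ ?_ ?_ ?_ ?_
        fun q _ hq' hq _ => ?_
      any_goals linarith
      apply ih <;> linarith
  obtain ⟨n, hn⟩ := exists_nat_gt (2 * (s₁ - 3))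
  exact main n _ _ _ (by linarith) hs₁ hs₃ h12 h23 hs'

theorem exists_uniform_lower₃ {T c₁ c₂ : ℝ} {𝓕 : Set (ℝ → ℝ → ℝ → ℝ)} (hc₁ : 0 < c₁)
    (h𝓕 : ∀ f ∈ 𝓕, IsFlow₃ T c₁ c₂ f)
    {x₁ y₁ x₂ y₂ x₃ y₃ ε : ℝ} (hx₁ : -1 < x₁) (h₁ : x₁ < y₁)
    (h₁₂ : y₁ < x₂) (h₂ : x₂ < y₂) (h₂₃ : y₂ < x₃) (h₃ : x₃ < y₃) (hy₃ : y₃ < 0) (hε : 0 < ε)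
    (hbox : ∀ f ∈ 𝓕, ∀ s₁ s₂ s₃, x₁ ≤ s₁ → s₁ ≤ y₁ → x₂ ≤ s₂ → s₂ ≤ y₂ → x₃ ≤ s₃ → s₃ ≤ y₃ →
      ε ≤ f s₁ s₂ s₃) :
    ∃ κ > 0, ∀ f ∈ 𝓕, ∀ s₁ s₂ s₃, 2 ≤ s₁ → 3 ≤ s₃ → s₁ + 1 / 9 ≤ s₂ → s₂ + 1 / 9 ≤ s₃ →
      s₃ ≤ s₁ + 1 → s₃ ≤ T → κ ≤ f s₁ s₂ s₃ := by
  have hK : IsCompact {s : ℝ × ℝ × ℝ | 2 ≤ s.1 ∧ 3 ≤ s.2.2 ∧ s.1 + 1 / 9 ≤ s.2.1 ∧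
      s.2.1 + 1 / 9 ≤ s.2.2 ∧ s.2.2 ≤ s.1 + 1 ∧ s.2.2 ≤ T} := by
    refine (isCompact_Icc (a := ((2 : ℝ), (2 : ℝ), (2 : ℝ)))
      (b := (T, T, T))).of_isClosed_subset ?_ ?_
    · simp only [Set.ofPred_and]
      refine IsClosed.inter ?_ (IsClosed.inter ?_ (IsClosed.inter ?_ (IsClosed.inter ?_
        (IsClosed.inter ?_ ?_))))
      all_goals exact isClosed_le (by fun_prop) (by fun_prop)
    · rintro ⟨s₁, s₂, s₃⟩ ⟨a, b, c, d, e, f⟩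
      simp only at a b c d e f
      refine ⟨⟨a, ?_, ?_⟩, ⟨?_, ?_, f⟩⟩ <;> simp only <;> linarith
  obtain ⟨κ, hκ, h⟩ : ∃ κ > 0, ∀ s ∈ {s : ℝ × ℝ × ℝ | 2 ≤ s.1 ∧ 3 ≤ s.2.2 ∧
      s.1 + 1 / 9 ≤ s.2.1 ∧ s.2.1 + 1 / 9 ≤ s.2.2 ∧ s.2.2 ≤ s.1 + 1 ∧ s.2.2 ≤ T},
      ∀ f ∈ 𝓕, κ ≤ f s.1 s.2.1 s.2.2 := by
    refine hK.induction_on (p := fun S => ∃ κ > 0, ∀ s ∈ S, ∀ f ∈ 𝓕, κ ≤ f s.1 s.2.1 s.2.2)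
      ⟨1, one_pos, by simp⟩ ?_ ?_ ?_
    · rintro S S' hSS' ⟨κ, hκ, h⟩
      exact ⟨κ, hκ, fun s hs => h s (hSS' hs)⟩
    · rintro S S' ⟨κ, hκ, h⟩ ⟨κ', hκ', h'⟩
      refine ⟨min κ κ', lt_min hκ hκ', ?_⟩
      rintro s (hs | hs) f hf
      · exact (min_le_left _ _).trans (h s hs f hf)
      · exact (min_le_right _ _).trans (h' s hs f hf)
    · rintro ⟨s₁, s₂, s₃⟩ ⟨a, b, c, d, e, g⟩
      simp only at a b c d e g
      obtain ⟨κ, hκ, h⟩ := LocallyBddBelow₃.of_box hc₁ h𝓕 hx₁ h₁ h₁₂ h₂ h₂₃ h₃ hy₃ hε hbox a b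
        (by linarith : s₁ < s₂) (by linarith) e
      refine ⟨_, Filter.inter_mem self_mem_nhdsWithin (mem_nhdsWithin_of_mem_nhds h), κ, hκ, ?_⟩
      rintro ⟨t₁, t₂, t₃⟩ ⟨⟨a', b', c', d', e', g'⟩, ht⟩ f hf
      simp only at a' b' c' d' e' g'
      apply ht f hf <;> simp only <;> linarith
  exact ⟨κ, hκ, fun f hf s₁ s₂ s₃ a b c d e g => h (s₁, s₂, s₃) ⟨a, b, c, d, e, g⟩ f hf⟩

/-- Two successive steps, restricted to the middle thirds of the integration ranges. -/
theorem IsFlow₃.lower_two_steps {T c₁ c₂ : ℝ} {f : ℝ → ℝ → ℝ → ℝ} (hf : IsFlow₃ T c₁ c₂ f)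
    (hc₁ : 0 ≤ c₁) {s₁ s₂ s₃ ε : ℝ} (hs₁ : 0 ≤ s₁) (h₁₂ : s₁ ≤ s₂) (h₂₃ : s₂ ≤ s₃)
    (h : s₃ ≤ s₁ + 1) (hT : s₃ ≤ T) (hε : 0 ≤ ε)
    (hlow : ∀ v w, (s₃ - s₂) / 3 ≤ v → v ≤ 2 * (s₃ - s₂) / 3 → (s₂ - s₁) / 3 ≤ w →
      w ≤ 2 * (s₂ - s₁) / 3 → ε ≤ f (s₂ - 1 - w) (s₃ - 1 - v) s₁) :
    c₁ ^ 2 * ((s₂ - s₁) * (s₃ - s₂) / 9) * ε ≤ f s₁ s₂ s₃ := by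
  have := hf.lower s₁ s₂ s₃ (s₃ - 2 * (s₃ - s₂) / 3) (s₃ - (s₃ - s₂) / 3)
    (c₁ * ((s₂ - s₁) / 3) * ε) (by linarith) h₁₂ h hT (by linarith) (by linarith) (by linarith)
    (by linarith) (mul_nonneg (mul_nonneg hc₁ (by linarith)) hε) ?_
  · refine le_trans (le_of_eq ?_) this
    ring
  · rintro r ⟨hr, hr'⟩
    have := hf.lower (r - 1) s₁ s₂ (s₂ - 2 * (s₂ - s₁) / 3) (s₂ - (s₂ - s₁) / 3)
      ε (by linarith) (by linarith) (by linarith) (by linarith) (by linarith) (by linarith)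
      (by linarith) (by linarith) hε ?_
    · refine le_trans (le_of_eq ?_) this
      ring
    · rintro q ⟨hq, hq'⟩
      have := hlow (s₃ - r) (s₂ - q) (by linarith) (by linarith) (by linarith) (by linarith)
      convert this using 1
      congr 1 <;> ring

theorem IsFlow₃.lower_poly {T c₁ c₂ κ : ℝ} {f : ℝ → ℝ → ℝ → ℝ} (hf : IsFlow₃ T c₁ c₂ f)
    (hc₁ : 0 ≤ c₁) (hκ : 0 ≤ κ)
    (hlow : ∀ s₁ s₂ s₃, 2 ≤ s₁ → 3 ≤ s₃ → s₁ + 1 / 9 ≤ s₂ → s₂ + 1 / 9 ≤ s₃ → s₃ ≤ s₁ + 1 →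
      s₃ ≤ T → κ ≤ f s₁ s₂ s₃)
    {s₁ s₂ s₃ : ℝ} (hs₁ : 4 ≤ s₁) (h₁₂ : s₁ ≤ s₂) (h₂₃ : s₂ ≤ s₃) (h : s₃ ≤ s₁ + 1)
    (hT : s₃ ≤ T) :
    c₁ ^ 4 * κ / 729 * ((s₂ - s₁) * (s₃ - s₁) * (s₃ - s₂) * (1 + s₁ - s₂)) ≤ f s₁ s₂ s₃ := by
  have key : ∀ s₁ s₂ s₃, 3 ≤ s₁ → s₁ ≤ s₂ → s₂ ≤ s₃ → s₃ ≤ s₁ + 1 → s₃ ≤ T →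
      1 / 3 ≤ s₃ - s₁ → s₂ - s₁ ≤ 2 / 3 →
      c₁ ^ 2 * ((s₂ - s₁) * (s₃ - s₂) / 9) * κ ≤ f s₁ s₂ s₃ := by
    intro s₁ s₂ s₃ a b c d e g i
    refine hf.lower_two_steps hc₁ (by linarith) b c d e hκ fun v w hv hv' hw hw' => ?_
    apply hlow <;> linarith
  have := hf.lower_two_steps hc₁ (by linarith) h₁₂ h₂₃ h hT
    (ε := c₁ ^ 2 * ((s₃ - s₁) / 3 * ((1 + s₁ - s₂) / 3) / 9) * κ) ?_ fun v w hv hv' hw hw' => ?_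
  · refine le_trans (le_of_eq ?_) this
    ring
  · have h1 : 0 ≤ s₃ - s₁ := by linarith
    have h2 : 0 ≤ 1 + s₁ - s₂ := by linarith
    positivity
  · refine le_trans ?_ (key (s₂ - 1 - w) (s₃ - 1 - v) s₁ (by linarith) (by linarith) (by linarith)
      (by linarith) (by linarith) (by linarith) (by linarith))
    gcongr <;> linarith

theorem IsFlow₃.upper_poly {T c₁ c₂ M : ℝ} {f : ℝ → ℝ → ℝ → ℝ} (hf : IsFlow₃ T c₁ c₂ f)
    (hc₂ : 0 ≤ c₂) (hM : 0 ≤ M)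
    (hbdd : ∀ s₁ s₂ s₃, -1 ≤ s₁ → s₁ ≤ s₂ → s₂ ≤ s₃ → s₃ ≤ s₁ + 1 → s₃ ≤ T → f s₁ s₂ s₃ ≤ M)
    {s₁ s₂ s₃ : ℝ} (hs₁ : 1 ≤ s₁) (h₁₂ : s₁ ≤ s₂) (h₂₃ : s₂ ≤ s₃) (h : s₃ ≤ s₁ + 1)
    (hT : s₃ ≤ T) :
    f s₁ s₂ s₃ ≤ c₂ ^ 4 * M * ((s₂ - s₁) * (s₃ - s₁) * (s₃ - s₂) * (1 + s₁ - s₂)) := by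
  have B1 : ∀ s₁ s₂ s₃, -1 ≤ s₁ → s₁ ≤ s₂ → 0 ≤ s₂ → s₂ ≤ s₃ → s₃ ≤ s₁ + 1 → s₃ ≤ T →
      f s₁ s₂ s₃ ≤ c₂ * (s₃ - s₂) * M := by
    intro s₁ s₂ s₃ a b c d e g
    refine hf.upper s₁ s₂ s₃ M a b c d e g fun r hr => ?_
    obtain ⟨hr, hr'⟩ := hr
    apply hbdd <;> linarith
  have B2 : ∀ s₁ s₂ s₃, 0 ≤ s₁ → s₁ ≤ s₂ → s₂ ≤ s₃ → s₃ ≤ s₁ + 1 → s₃ ≤ T →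
      f s₁ s₂ s₃ ≤ c₂ * (s₃ - s₂) * (c₂ * (s₂ - s₁) * M) := by
    intro s₁ s₂ s₃ a b c d e
    refine hf.upper s₁ s₂ s₃ _ (by linarith) b (by linarith) c d e fun r hr => ?_
    obtain ⟨hr, hr'⟩ := hr
    apply B1 <;> linarith
  have B3 : ∀ s₁ s₂ s₃, 0 ≤ s₁ → s₁ ≤ s₂ → 1 ≤ s₂ → s₂ ≤ s₃ → s₃ ≤ s₁ + 1 → s₃ ≤ T →
      f s₁ s₂ s₃ ≤ c₂ * (s₃ - s₂) * (c₂ * (s₂ - s₁) * (c₂ * (1 + s₁ - s₂) * M)) := by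
    intro s₁ s₂ s₃ a b c d e g
    refine hf.upper s₁ s₂ s₃ _ (by linarith) b (by linarith) d e g fun r hr => ?_
    obtain ⟨hr, hr'⟩ := hr
    refine (B2 (r - 1) s₁ s₂ (by linarith) (by linarith) (by linarith) (by linarith)
      (by linarith)).trans ?_
    have h1 : 0 ≤ s₂ - s₁ := by linarith
    have h2 : s₁ - (r - 1) ≤ 1 + s₁ - s₂ := by linarith
    generalize s₁ - (r - 1) = p at *
    generalize 1 + s₁ - s₂ = q at *
    gcongr
  refine (hf.upper s₁ s₂ s₃ (c₂ * (s₂ - s₁) * (c₂ * (1 + s₁ - s₂) * (c₂ * (s₃ - s₁) * M)))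
    (by linarith) h₁₂ (by linarith) h₂₃ h hT fun r hr => ?_).trans (le_of_eq (by ring))
  obtain ⟨hr, hr'⟩ := hr
  refine (B3 (r - 1) s₁ s₂ (by linarith) (by linarith) (by linarith) (by linarith) (by linarith)
    (by linarith)).trans ?_
  have h1 : 0 ≤ s₂ - s₁ := by linarith
  have h2 : s₁ - (r - 1) ≤ 1 + s₁ - s₂ := by linarith
  have h3 : 1 + (r - 1) - s₁ ≤ s₃ - s₁ := by linarith
  have h4 : 0 ≤ 1 + s₁ - s₂ := by linarith
  have h5 : 0 ≤ 1 + (r - 1) - s₁ := by linarith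
  generalize s₁ - (r - 1) = p at *
  generalize 1 + s₁ - s₂ = q at *
  generalize 1 + (r - 1) - s₁ = p' at *
  generalize s₃ - s₁ = q' at *
  gcongr

theorem exists_two_sided_bound₃ {T c₁ c₂ M : ℝ} {𝓕 : Set (ℝ → ℝ → ℝ → ℝ)} (hc₁ : 0 < c₁)
    (hc₂ : 0 < c₂) (hM : 0 < M) (h𝓕 : ∀ f ∈ 𝓕, IsFlow₃ T c₁ c₂ f)
    (hbdd : ∀ f ∈ 𝓕, ∀ s₁ s₂ s₃, -1 ≤ s₁ → s₁ ≤ s₂ → s₂ ≤ s₃ → s₃ ≤ s₁ + 1 → s₃ ≤ T →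
      f s₁ s₂ s₃ ≤ M)
    {x₁ y₁ x₂ y₂ x₃ y₃ ε : ℝ} (hx₁ : -1 < x₁) (h₁ : x₁ < y₁)
    (h₁₂ : y₁ < x₂) (h₂ : x₂ < y₂) (h₂₃ : y₂ < x₃) (h₃ : x₃ < y₃) (hy₃ : y₃ < 0) (hε : 0 < ε)
    (hbox : ∀ f ∈ 𝓕, ∀ s₁ s₂ s₃, x₁ ≤ s₁ → s₁ ≤ y₁ → x₂ ≤ s₂ → s₂ ≤ y₂ → x₃ ≤ s₃ → s₃ ≤ y₃ →
      ε ≤ f s₁ s₂ s₃) :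
    ∃ C₁ C₂, 0 < C₁ ∧ 0 < C₂ ∧ ∀ f ∈ 𝓕, ∀ s₁ s₂ s₃, 4 ≤ s₁ → s₁ ≤ s₂ → s₂ ≤ s₃ →
      s₃ ≤ s₁ + 1 → s₃ ≤ T →
      C₁ * ((s₂ - s₁) * (s₃ - s₁) * (s₃ - s₂) * (1 + s₁ - s₂)) ≤ f s₁ s₂ s₃ ∧
      f s₁ s₂ s₃ ≤ C₂ * ((s₂ - s₁) * (s₃ - s₁) * (s₃ - s₂) * (1 + s₁ - s₂)) := by
  obtain ⟨κ, hκ, hlow⟩ := exists_uniform_lower₃ hc₁ h𝓕 hx₁ h₁ h₁₂ h₂ h₂₃ h₃ hy₃ hε hbox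
  exact ⟨c₁ ^ 4 * κ / 729, c₂ ^ 4 * M, by positivity, by positivity,
    fun f hf s₁ s₂ s₃ a b c d e => ⟨(h𝓕 f hf).lower_poly hc₁.le hκ.le (hlow f hf) a b c d e,
      (h𝓕 f hf).upper_poly hc₂.le hM.le (hbdd f hf) (by linarith) b c d e⟩⟩

theorem mul_le_integral_mul {B g : ℝ → ℝ} {T c₁ c₂ l s u v ε : ℝ} (hc₁ : 0 ≤ c₁)
    (hB : LocallyIntegrable B volume)
    (hBbd : ∀ᵐ r ∂volume.restrict (Set.Icc 0 T), c₁ ≤ B r ∧ B r ≤ c₂) (hg : Continuous g)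
    (hl : 0 ≤ l) (hlu : l ≤ u) (huv : u ≤ v) (hvs : v ≤ s) (hs : s ≤ T)
    (hg0 : ∀ r ∈ Set.Icc l s, 0 ≤ g r) (hε : 0 ≤ ε) (hgε : ∀ r ∈ Set.Icc u v, ε ≤ g r) :
    c₁ * (v - u) * ε ≤ ∫ r in l..s, B r * g r := by
  have hint : ∀ a c, IntervalIntegrable (fun r => B r * g r) volume a c := fun a c =>
    (hB.integrableOn_isCompact isCompact_uIcc).intervalIntegrable.mul_continuousOn hg.continuousOn
  have hsub : ∀ a c, 0 ≤ a → c ≤ T → ∀ᵐ r ∂volume.restrict (Set.Icc a c), c₁ ≤ B r ∧ B r ≤ c₂ :=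
    fun a c ha hc => ae_restrict_of_ae_restrict_of_subset (Set.Icc_subset_Icc ha hc) hBbd
  have h1 : c₁ * (v - u) * ε ≤ ∫ r in u..v, B r * g r := by
    have : c₁ * (v - u) * ε = ∫ r in u..v, c₁ * ε := by
      rw [intervalIntegral.integral_const, smul_eq_mul]; ring
    rw [this]
    refine intervalIntegral.integral_mono_ae_restrict huv (by simp) (hint u v) ?_
    filter_upwards [hsub u v (by linarith) (by linarith), ae_restrict_mem measurableSet_Icc]
      with r hr hmem
    exact mul_le_mul hr.1 (hgε r hmem) hε (hc₁.trans hr.1)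
  refine h1.trans (intervalIntegral.integral_mono_interval hlu huv hvs ?_ (hint l s))
  have h2 := hsub l s hl hs
  rw [← restrict_Ioc_eq_restrict_Icc] at h2
  filter_upwards [h2, ae_restrict_mem measurableSet_Ioc] with r hr hmem
  exact mul_nonneg (hc₁.trans hr.1) (hg0 r ⟨hmem.1.le, hmem.2⟩)

theorem integral_mul_le_mul {B g : ℝ → ℝ} {T c₁ c₂ l s M : ℝ} (hc₁ : 0 ≤ c₁)
    (hB : LocallyIntegrable B volume)
    (hBbd : ∀ᵐ r ∂volume.restrict (Set.Icc 0 T), c₁ ≤ B r ∧ B r ≤ c₂) (hg : Continuous g)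
    (hl : 0 ≤ l) (hls : l ≤ s) (hs : s ≤ T)
    (hg0 : ∀ r ∈ Set.Icc l s, 0 ≤ g r) (hgM : ∀ r ∈ Set.Icc l s, g r ≤ M) :
    ∫ r in l..s, B r * g r ≤ c₂ * (s - l) * M := by
  have hint : IntervalIntegrable (fun r => B r * g r) volume l s :=
    (hB.integrableOn_isCompact isCompact_uIcc).intervalIntegrable.mul_continuousOn hg.continuousOn
  have : c₂ * (s - l) * M = ∫ r in l..s, c₂ * M := by
    rw [intervalIntegral.integral_const, smul_eq_mul]; ring
  rw [this]
  refine intervalIntegral.integral_mono_ae_restrict hls hint (by simp) ?_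
  filter_upwards [ae_restrict_of_ae_restrict_of_subset (Set.Icc_subset_Icc hl hs) hBbd,
    ae_restrict_mem measurableSet_Icc] with r hr hmem
  exact mul_le_mul hr.2 (hgM r hmem) (hg0 r hmem) (hc₁.trans (hr.1.trans hr.2))

theorem IsFlow₂.of_recursion {B : ℝ → ℝ} {T c₁ c₂ : ℝ} {f : ℝ → ℝ → ℝ} (hc₁ : 0 ≤ c₁)
    (hB : LocallyIntegrable B volume)
    (hBbd : ∀ᵐ r ∂volume.restrict (Set.Icc 0 T), c₁ ≤ B r ∧ B r ≤ c₂)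
    (hcont : ∀ s, Continuous fun r => f r s) (hdiag : ∀ s, f s s = 0)
    (hinit : ∀ s₁ s₂, -1 ≤ s₁ → s₁ ≤ s₂ → s₂ ≤ 0 → 0 ≤ f s₁ s₂)
    (hrec : ∀ s₁ s₂ l, -1 ≤ s₁ → s₁ ≤ s₂ → s₂ ≤ T → 0 ≤ l → l ≤ s₂ →
      f s₁ s₂ = f s₁ l + ∫ r in l..s₂, B r * f (r - 1) s₁) : IsFlow₂ T c₁ c₂ f := by
  have hcont' : ∀ s, Continuous fun r => f (r - 1) s := fun s =>
    (hcont s).comp (continuous_sub_right 1)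
  have hstart : ∀ s, -1 ≤ s → 0 ≤ f s (max s 0) := by
    intro s hs
    rcases le_total s 0 with h | h
    · rw [max_eq_right h]; exact hinit _ _ hs h le_rfl
    · rw [max_eq_left h, hdiag]
  have hnonneg : ∀ n : ℕ, ∀ s₁ s₂ : ℝ, s₁ + s₂ ≤ n - 1 → -1 ≤ s₁ → s₁ ≤ s₂ → s₂ ≤ s₁ + 1 →
      s₂ ≤ T → 0 ≤ f s₁ s₂ := by
    intro n
    induction n with
    | zero =>
      intro s₁ s₂ hn a b c d
      push_cast at hn
      exact hinit s₁ s₂ a b (by linarith)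
    | succ n ih =>
      intro s₁ s₂ hn a b c d
      push_cast at hn
      rcases le_total s₂ 0 with h | h
      · exact hinit s₁ s₂ a b h
      have hl : max s₁ 0 ≤ s₂ := max_le b h
      rw [hrec s₁ s₂ _ a b d (le_max_right _ _) hl]
      refine add_nonneg (hstart s₁ a) ?_
      have := mul_le_integral_mul (u := max s₁ 0) (v := max s₁ 0) (ε := 0) hc₁ hB hBbd (hcont' s₁)
        (le_max_right _ _) le_rfl le_rfl hl d
        (fun r hr => ?_) le_rfl (fun r hr => ?_)
      · simpa using this
      all_goals
        obtain ⟨hr, hr'⟩ := hr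
        have := (le_max_left _ _).trans hr
        have := (le_max_right _ _).trans hr
        apply ih <;> linarith
  have hnonneg' : ∀ s₁ s₂, -1 ≤ s₁ → s₁ ≤ s₂ → s₂ ≤ s₁ + 1 → s₂ ≤ T → 0 ≤ f s₁ s₂ := by
    intro s₁ s₂
    obtain ⟨n, hn⟩ := exists_nat_ge (s₁ + s₂ + 1)
    exact hnonneg n s₁ s₂ (by linarith)
  refine ⟨hnonneg', ?_, ?_⟩
  · intro s₁ s₂ u v ε a b c d e g h hε hu
    have hl : max s₁ 0 ≤ u := max_le d e
    rw [hrec s₁ s₂ _ a (by linarith) c (le_max_right _ _) (hl.trans (g.trans h))]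
    have := mul_le_integral_mul hc₁ hB hBbd (hcont' s₁) (le_max_right _ _) hl g h c
      (fun r hr => ?_) hε hu
    · linarith [hstart s₁ a]
    · obtain ⟨hr, hr'⟩ := hr
      have := (le_max_left _ _).trans hr
      have := (le_max_right _ _).trans hr
      apply hnonneg' <;> linarith
  · intro s₁ s₂ M a b c d hM
    rw [hrec s₁ s₂ s₁ (by linarith) b d a b, hdiag, zero_add]
    refine integral_mul_le_mul hc₁ hB hBbd (hcont' s₁) a b d (fun r hr => ?_) hM
    obtain ⟨hr, hr'⟩ := hr
    apply hnonneg' <;> linarith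

theorem IsFlow₃.of_recursion {B : ℝ → ℝ} {T c₁ c₂ : ℝ} {f : ℝ → ℝ → ℝ → ℝ} (hc₁ : 0 ≤ c₁)
    (hB : LocallyIntegrable B volume)
    (hBbd : ∀ᵐ r ∂volume.restrict (Set.Icc 0 T), c₁ ≤ B r ∧ B r ≤ c₂)
    (hcont : ∀ s₁ s₂, Continuous fun r => f r s₁ s₂) (hdiag : ∀ s₁ s₂, f s₁ s₂ s₂ = 0)
    (hinit : ∀ s₁ s₂ s₃, -1 ≤ s₁ → s₁ ≤ s₂ → s₂ ≤ s₃ → s₃ ≤ 0 → 0 ≤ f s₁ s₂ s₃)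
    (hrec : ∀ s₁ s₂ s₃ l, -1 ≤ s₁ → s₁ ≤ s₂ → s₂ ≤ s₃ → s₃ ≤ T → 0 ≤ l → l ≤ s₃ →
      f s₁ s₂ s₃ = f s₁ s₂ l + ∫ r in l..s₃, B r * f (r - 1) s₁ s₂) : IsFlow₃ T c₁ c₂ f := by
  have hcont' : ∀ s₁ s₂, Continuous fun r => f (r - 1) s₁ s₂ := fun s₁ s₂ =>
    (hcont s₁ s₂).comp (continuous_sub_right 1)
  have hstart : ∀ s₁ s₂, -1 ≤ s₁ → s₁ ≤ s₂ → 0 ≤ f s₁ s₂ (max s₂ 0) := by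
    intro s₁ s₂ hs hs'
    rcases le_total s₂ 0 with h | h
    · rw [max_eq_right h]; exact hinit _ _ _ hs hs' h le_rfl
    · rw [max_eq_left h, hdiag]
  have hnonneg : ∀ n : ℕ, ∀ s₁ s₂ s₃ : ℝ, s₁ + s₂ + s₃ ≤ n - 2 → -1 ≤ s₁ → s₁ ≤ s₂ → s₂ ≤ s₃ →
      s₃ ≤ s₁ + 1 → s₃ ≤ T → 0 ≤ f s₁ s₂ s₃ := by
    intro n
    induction n with
    | zero =>
      intro s₁ s₂ s₃ hn a b b' c d
      push_cast at hn
      exact hinit s₁ s₂ s₃ a b b' (by linarith)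
    | succ n ih =>
      intro s₁ s₂ s₃ hn a b b' c d
      push_cast at hn
      rcases le_total s₃ 0 with h | h
      · exact hinit s₁ s₂ s₃ a b b' h
      have hl : max s₂ 0 ≤ s₃ := max_le b' h
      rw [hrec s₁ s₂ s₃ _ a b b' d (le_max_right _ _) hl]
      refine add_nonneg (hstart s₁ s₂ a b) ?_
      have := mul_le_integral_mul (u := max s₂ 0) (v := max s₂ 0) (ε := 0) hc₁ hB hBbd
        (hcont' s₁ s₂) (le_max_right _ _) le_rfl le_rfl hl d
        (fun r hr => ?_) le_rfl (fun r hr => ?_)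
      · simpa using this
      all_goals
        obtain ⟨hr, hr'⟩ := hr
        have := (le_max_left _ _).trans hr
        have := (le_max_right _ _).trans hr
        apply ih <;> linarith
  have hnonneg' : ∀ s₁ s₂ s₃, -1 ≤ s₁ → s₁ ≤ s₂ → s₂ ≤ s₃ → s₃ ≤ s₁ + 1 → s₃ ≤ T →
      0 ≤ f s₁ s₂ s₃ := by
    intro s₁ s₂ s₃
    obtain ⟨n, hn⟩ := exists_nat_ge (s₁ + s₂ + s₃ + 2)
    exact hnonneg n s₁ s₂ s₃ (by linarith)
  refine ⟨hnonneg', ?_, ?_⟩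
  · intro s₁ s₂ s₃ u v ε a a' b c d e g h hε hu
    have hl : max s₂ 0 ≤ u := max_le d e
    rw [hrec s₁ s₂ s₃ _ a a' (by linarith) c (le_max_right _ _) (hl.trans (g.trans h))]
    have := mul_le_integral_mul hc₁ hB hBbd (hcont' s₁ s₂) (le_max_right _ _) hl g h c
      (fun r hr => ?_) hε hu
    · linarith [hstart s₁ s₂ a a']
    · obtain ⟨hr, hr'⟩ := hr
      have := (le_max_left _ _).trans hr
      have := (le_max_right _ _).trans hr
      apply hnonneg' <;> linarith
  · intro s₁ s₂ s₃ M a a' b b' c d hM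
    rw [hrec s₁ s₂ s₃ s₂ a a' b' d b b', hdiag, zero_add]
    refine integral_mul_le_mul hc₁ hB hBbd (hcont' s₁ s₂) b b' d (fun r hr => ?_) hM
    obtain ⟨hr, hr'⟩ := hr
    apply hnonneg' <;> linarith

/-- The retraction of `ℝ` onto `[-1, T]`. -/
def clamp {T : ℝ} (hT : 0 ≤ T) : C(ℝ, Set.Icc (-1 : ℝ) T) :=
  ⟨Set.projIcc (-1) T (by linarith), continuous_projIcc⟩

theorem clamp_coe {T : ℝ} (hT : 0 ≤ T) (s : Set.Icc (-1 : ℝ) T) : clamp hT s = s :=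
  Set.projIcc_val (by linarith) s

theorem coe_clamp {T s : ℝ} (hT : 0 ≤ T)
    (hs : s ∈ Set.Icc (-1) T) : (clamp hT s : ℝ) = s :=
  congrArg Subtype.val (Set.projIcc_of_mem (by linarith) hs)

theorem intervalIntegrable_mul_clamp {b : ℝ → ℝ} (hb : LocallyIntegrable b volume) {T : ℝ}
    (hT : 0 ≤ T) (y : C(Set.Icc (-1 : ℝ) T, ℝ)) (p q : ℝ) :
    IntervalIntegrable (fun r => b r * y (clamp hT (r - 1))) volume p q :=
  (hb.integrableOn_isCompact isCompact_uIcc).intervalIntegrable.mul_continuousOn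
    (by fun_prop)

/-- The Picard operator of `y'(t) = -b(t) y(t-1)` with initial interval `[-1, 0]`, acting on
continuous functions on `[-1, T]`. -/
def picardFun {b : ℝ → ℝ} (hb : LocallyIntegrable b volume) {T : ℝ} (hT : 0 ≤ T)
    (y : C(Set.Icc (-1 : ℝ) T, ℝ)) : C(Set.Icc (-1 : ℝ) T, ℝ) where
  toFun t := y (clamp hT (min t 0)) - ∫ r in (0 : ℝ)..max t 0, b r * y (clamp hT (r - 1))
  continuous_toFun := by
    have h := intervalIntegral.continuous_primitive (intervalIntegrable_mul_clamp hb hT y) 0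
    exact (by fun_prop : Continuous fun t : Set.Icc (-1 : ℝ) T => y (clamp hT (min t 0))).sub
      (h.comp (by fun_prop : Continuous fun t : Set.Icc (-1 : ℝ) T => max (t : ℝ) 0))

theorem abs_integral_mul_le {b g : ℝ → ℝ} (hb : LocallyIntegrable b volume) {s T M : ℝ}
    (hs : 0 ≤ s) (hsT : s ≤ T) (hg : ∀ r, |g r| ≤ M) :
    |∫ r in (0 : ℝ)..s, b r * g r| ≤ (∫ r in (0 : ℝ)..T, |b r|) * M := by
  have hM : 0 ≤ M := (abs_nonneg _).trans (hg 0)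
  have hi : ∀ p q, IntervalIntegrable (fun r => |b r|) volume p q := fun p q =>
    ((hb.integrableOn_isCompact isCompact_uIcc).intervalIntegrable).abs
  calc |∫ r in (0 : ℝ)..s, b r * g r| ≤ ∫ r in (0 : ℝ)..s, |b r| * M := by
        rw [← Real.norm_eq_abs]
        refine intervalIntegral.norm_integral_le_of_norm_le hs ?_ ((hi _ _).mul_const _)
        refine Filter.Eventually.of_forall fun r _ => ?_
        rw [Real.norm_eq_abs, abs_mul]
        exact mul_le_mul_of_nonneg_left (hg r) (abs_nonneg _)
    _ = (∫ r in (0 : ℝ)..s, |b r|) * M := intervalIntegral.integral_mul_const _ _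
    _ ≤ _ := by
        refine mul_le_mul_of_nonneg_right ?_ hM
        exact intervalIntegral.integral_mono_interval le_rfl hs hsT
          (Filter.Eventually.of_forall fun r => abs_nonneg _) (hi _ _)

/-- The Picard operator as a bounded linear operator. -/
def picard {b : ℝ → ℝ} (hb : LocallyIntegrable b volume) {T : ℝ} (hT : 0 ≤ T) :
    C(Set.Icc (-1 : ℝ) T, ℝ) →L[ℝ] C(Set.Icc (-1 : ℝ) T, ℝ) :=
  LinearMap.mkContinuous
    { toFun := picardFun hb hT
      map_add' := by
        intro y z
        ext t
        simp only [picardFun, ContinuousMap.coe_mk, ContinuousMap.add_apply, mul_add]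
        rw [intervalIntegral.integral_add (intervalIntegrable_mul_clamp hb hT y _ _)
          (intervalIntegrable_mul_clamp hb hT z _ _)]
        ring
      map_smul' := by
        intro c y
        ext t
        simp only [picardFun, ContinuousMap.coe_mk, ContinuousMap.smul_apply, smul_eq_mul,
          RingHom.id_apply, mul_left_comm _ c]
        rw [intervalIntegral.integral_const_mul]
        ring }
    (1 + ∫ r in (0 : ℝ)..T, |b r|) <| by
      intro y
      have h0 : 0 ≤ ∫ r in (0 : ℝ)..T, |b r| :=
        intervalIntegral.integral_nonneg hT fun r _ => abs_nonneg _
      rw [ContinuousMap.norm_le _ (by positivity)]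
      intro t
      have h1 := y.norm_coe_le_norm (clamp hT (min t 0))
      have h2 := abs_integral_mul_le (g := fun r => y (clamp hT (r - 1))) hb
        (le_max_right (t : ℝ) 0) (max_le t.2.2 hT) fun r => y.norm_coe_le_norm _
      calc _ ≤ ‖y (clamp hT (min t 0))‖ +
            ‖∫ r in (0 : ℝ)..max t 0, b r * y (clamp hT (r - 1))‖ := norm_sub_le _ _
        _ ≤ ‖y‖ + (∫ r in (0 : ℝ)..T, |b r|) * ‖y‖ := add_le_add h1 h2
        _ = _ := by ring

theorem picard_apply {b : ℝ → ℝ} (hb : LocallyIntegrable b volume) {T : ℝ} (hT : 0 ≤ T)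
    (y : C(Set.Icc (-1 : ℝ) T, ℝ)) (t : Set.Icc (-1 : ℝ) T) :
    picard hb hT y t =
      y (clamp hT (min t 0)) - ∫ r in (0 : ℝ)..max t 0, b r * y (clamp hT (r - 1)) := rfl

theorem norm_picard_le {b : ℝ → ℝ} (hb : LocallyIntegrable b volume) {T : ℝ} (hT : 0 ≤ T) :
    ‖picard hb hT‖ ≤ 1 + ∫ r in (0 : ℝ)..T, |b r| :=
  LinearMap.mkContinuous_norm_le _
    (add_nonneg zero_le_one (intervalIntegral.integral_nonneg hT fun _ _ => abs_nonneg _)) _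

theorem picard_apply_of_nonpos {b : ℝ → ℝ} (hb : LocallyIntegrable b volume) {T : ℝ} (hT : 0 ≤ T)
    (y : C(Set.Icc (-1 : ℝ) T, ℝ)) {t : Set.Icc (-1 : ℝ) T} (ht : (t : ℝ) ≤ 0) :
    picard hb hT y t = y t := by
  rw [picard_apply, min_eq_left ht, max_eq_right ht, clamp_coe, intervalIntegral.integral_same,
    sub_zero]

/-- The solution operator of `y'(t) = -b(t) y(t-1)` on `[-1, T]`; only the values of the argument
on `[-1, 0]` matter. -/
def solOp {b : ℝ → ℝ} (hb : LocallyIntegrable b volume) {T : ℝ} (hT : 0 ≤ T) :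
    C(Set.Icc (-1 : ℝ) T, ℝ) →L[ℝ] C(Set.Icc (-1 : ℝ) T, ℝ) :=
  picard hb hT ^ ⌈T⌉₊

theorem norm_solOp_le {b : ℝ → ℝ} (hb : LocallyIntegrable b volume) {T : ℝ} (hT : 0 ≤ T) :
    ‖solOp hb hT‖ ≤ (1 + ∫ r in (0 : ℝ)..T, |b r|) ^ ⌈T⌉₊ := by
  rcases Nat.eq_zero_or_pos ⌈T⌉₊ with h | h
  · rw [solOp, h, pow_zero, pow_zero]
    exact ContinuousLinearMap.norm_id_le
  · refine (norm_pow_le' (picard hb hT) h).trans ?_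
    gcongr
    exact norm_picard_le hb hT

theorem solOp_apply_of_nonpos {b : ℝ → ℝ} (hb : LocallyIntegrable b volume) {T : ℝ} (hT : 0 ≤ T)
    (y : C(Set.Icc (-1 : ℝ) T, ℝ)) {t : Set.Icc (-1 : ℝ) T} (ht : (t : ℝ) ≤ 0) :
    solOp hb hT y t = y t := by
  rw [solOp]
  induction ⌈T⌉₊ with
  | zero => rfl
  | succ n ih =>
    rw [pow_succ', mul_apply_eq_comp, picard_apply_of_nonpos _ _ _ ht, ih]

theorem picard_pow_succ_apply {b : ℝ → ℝ} (hb : LocallyIntegrable b volume) {T : ℝ} (hT : 0 ≤ T)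
    (y : C(Set.Icc (-1 : ℝ) T, ℝ)) (n : ℕ) (t : Set.Icc (-1 : ℝ) T) (ht : (t : ℝ) ≤ n) :
    (picard hb hT ^ (n + 1)) y t = (picard hb hT ^ n) y t := by
  induction n generalizing t with
  | zero =>
    rw [zero_add, pow_one, picard_apply_of_nonpos _ _ _ (by simpa using ht)]
    rfl
  | succ n ih =>
    push_cast at ht
    have h (k : ℕ) : (picard hb hT ^ (k + 1)) y t =
        picard hb hT ((picard hb hT ^ k) y) t := by rw [pow_succ', mul_apply_eq_comp]
    rw [h (n + 1), h n, picard_apply, picard_apply]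
    have hn : (0 : ℝ) ≤ n := n.cast_nonneg
    congr 1
    · refine ih _ ?_
      rw [coe_clamp hT ⟨le_min t.2.1 (by norm_num), (min_le_left _ _).trans t.2.2⟩]
      exact (min_le_right _ _).trans hn
    · refine intervalIntegral.integral_congr fun r hr => ?_
      rw [Set.uIcc_of_le (le_max_right _ _)] at hr
      have h1 : max (t : ℝ) 0 ≤ T := max_le t.2.2 hT
      have h2 : max (t : ℝ) 0 ≤ n + 1 := max_le ht (by linarith)
      have h3 := hr.1
      have h4 := hr.2
      rw [ih]
      rw [coe_clamp hT ⟨by linarith, by linarith⟩]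
      linarith

theorem picard_solOp {b : ℝ → ℝ} (hb : LocallyIntegrable b volume) {T : ℝ} (hT : 0 ≤ T)
    (y : C(Set.Icc (-1 : ℝ) T, ℝ)) : picard hb hT (solOp hb hT y) = solOp hb hT y := by
  ext t
  rw [solOp, ← mul_apply_eq_comp, ← pow_succ']
  exact picard_pow_succ_apply hb hT y _ t (t.2.2.trans (Nat.le_ceil T))

theorem solOp_apply_of_nonneg {b : ℝ → ℝ} (hb : LocallyIntegrable b volume) {T : ℝ} (hT : 0 ≤ T)
    (y : C(Set.Icc (-1 : ℝ) T, ℝ)) {s : ℝ} (hs : 0 ≤ s) (hsT : s ≤ T) :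
    solOp hb hT y (clamp hT s) = solOp hb hT y (clamp hT 0) -
      ∫ r in (0 : ℝ)..s, b r * solOp hb hT y (clamp hT (r - 1)) := by
  conv_lhs => rw [← picard_solOp]
  rw [picard_apply, coe_clamp hT ⟨by linarith, hsT⟩, min_eq_right hs, max_eq_left hs]

/-- The product function `s ↦ ∏ i, f i (s i)`. -/
def prodFun {K : Type*} [TopologicalSpace K] {m : ℕ} (f : Fin m → C(K, ℝ)) :
    C(Fin m → K, ℝ) :=
  ⟨fun s => ∏ i, f i (s i), by fun_prop⟩

theorem prodFun_apply {K : Type*} [TopologicalSpace K] {m : ℕ} (f : Fin m → C(K, ℝ))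
    (s : Fin m → K) : prodFun f s = ∏ i, f i (s i) := rfl

theorem prodFun_update_apply {K : Type*} [TopologicalSpace K] {m : ℕ} (f : Fin m → C(K, ℝ))
    (s : Fin m → K) (j : Fin m) (r : K) :
    prodFun f (Function.update s j r) = f j r * ∏ i ∈ Finset.univ.erase j, f i (s i) := by
  rw [prodFun_apply, ← Finset.mul_prod_erase _ _ (Finset.mem_univ j), Function.update_self]
  congr 1
  refine Finset.prod_congr rfl fun i hi => ?_
  rw [Function.update_of_ne (Finset.ne_of_mem_erase hi)]

/-- Product functions span a dense subspace of the continuous functions on a compact power. -/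
theorem eq_zero_of_prodFun {K : Type*} [TopologicalSpace K] [CompactSpace K] {m : ℕ}
    {E : Type*} [NormedAddCommGroup E] [NormedSpace ℝ E]
    (hsep : ∀ x y : K, x ≠ y → ∃ f : C(K, ℝ), f x ≠ f y) (L : C(Fin m → K, ℝ) →L[ℝ] E)
    (hL : ∀ f, L (prodFun f) = 0) : L = 0 := by
  let A : Subalgebra ℝ C(Fin m → K, ℝ) :=
    Algebra.adjoin ℝ (Set.range (prodFun (K := K) (m := m)))
  have hmul : Submonoid.closure (Set.range (prodFun (K := K) (m := m))) ≤
      ({ carrier := Set.range (prodFun (K := K) (m := m))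
         one_mem' := ⟨fun _ => 1, by ext; simp [prodFun_apply]⟩
         mul_mem' := by
           rintro _ _ ⟨f, rfl⟩ ⟨g, rfl⟩
           exact ⟨fun i => f i * g i, by ext; simp [prodFun_apply, Finset.prod_mul_distrib]⟩ } :
        Submonoid C(Fin m → K, ℝ)) :=
    Submonoid.closure_le.2 fun _ h => h
  have hA : ∀ φ ∈ A, L φ = 0 := by
    intro φ hφ
    replace hφ : φ ∈ Submodule.span ℝ
        (Submonoid.closure (Set.range (prodFun (K := K) (m := m))) : Set C(Fin m → K, ℝ)) := by
      rw [← Algebra.adjoin_eq_span]; exact hφ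
    induction hφ using Submodule.span_induction with
    | mem x hx => obtain ⟨f, rfl⟩ := hmul hx; exact hL f
    | zero => simp
    | add x y _ _ hx hy => rw [map_add, hx, hy, add_zero]
    | smul c x _ hx => rw [map_smul, hx, smul_zero]
  have hsepA : A.SeparatesPoints := by
    intro x y hxy
    obtain ⟨i, hi⟩ := Function.ne_iff.1 hxy
    obtain ⟨f, hf⟩ := hsep _ _ hi
    refine ⟨_, ⟨prodFun (Function.update (fun _ => 1) i f), Algebra.subset_adjoin ⟨_, rfl⟩, rfl⟩, ?_⟩
    have : ∀ z : Fin m → K, prodFun (Function.update (fun _ => 1) i f) z = f (z i) := by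
      intro z
      rw [prodFun_apply, ← Finset.mul_prod_erase _ _ (Finset.mem_univ i), Function.update_self,
        Finset.prod_eq_one, mul_one]
      intro j hj
      rw [Function.update_of_ne (Finset.ne_of_mem_erase hj)]; rfl
    simpa [this] using hf
  have hdense := ContinuousMap.subalgebra_topologicalClosure_eq_top_of_separatesPoints A hsepA
  ext φ
  have hmem : φ ∈ closure (A : Set C(Fin m → K, ℝ)) := by
    rw [← Subalgebra.topologicalClosure_coe, hdense]; trivial
  exact closure_minimal (t := {φ | L φ = 0}) hA (isClosed_eq L.continuous continuous_const) hmem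

/-- Apply an operator on `C(K)` in the `j`-th variable. -/
def sliceLin {K : Type*} [TopologicalSpace K] [CompactSpace K] {m : ℕ}
    (L : C(K, ℝ) →L[ℝ] C(K, ℝ)) (j : Fin m) : C(Fin m → K, ℝ) →ₗ[ℝ] C(Fin m → K, ℝ) :=
  let upd : C((Fin m → K) × K, Fin m → K) := ⟨fun p => Function.update p.1 j p.2, by fun_prop⟩
  { toFun := fun φ => ⟨fun s => L ((φ.comp upd).curry s) (s j), by fun_prop⟩
    map_add' := fun φ ψ => by
      ext s
      simp
    map_smul' := fun c φ => by
      ext s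
      simp }

theorem norm_sliceLin_apply_le {K : Type*} [TopologicalSpace K] [CompactSpace K] {m : ℕ}
    (L : C(K, ℝ) →L[ℝ] C(K, ℝ)) (j : Fin m) (φ : C(Fin m → K, ℝ)) :
    ‖sliceLin L j φ‖ ≤ ‖L‖ * ‖φ‖ := by
  rw [ContinuousMap.norm_le _ (by positivity)]
  intro s
  refine ((L _).norm_coe_le_norm _).trans ((L.le_opNorm _).trans ?_)
  gcongr
  rw [ContinuousMap.norm_le _ (by positivity)]
  exact fun r => φ.norm_coe_le_norm _

/-- `sliceLin` as a bounded operator. -/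
def sliceOp {K : Type*} [TopologicalSpace K] [CompactSpace K] {m : ℕ}
    (L : C(K, ℝ) →L[ℝ] C(K, ℝ)) (j : Fin m) : C(Fin m → K, ℝ) →L[ℝ] C(Fin m → K, ℝ) :=
  (sliceLin L j).mkContinuous ‖L‖ (norm_sliceLin_apply_le L j)

theorem sliceOp_prodFun {K : Type*} [TopologicalSpace K] [CompactSpace K] {m : ℕ}
    (L : C(K, ℝ) →L[ℝ] C(K, ℝ)) (j : Fin m) (f : Fin m → C(K, ℝ)) :
    sliceOp L j (prodFun f) = prodFun (Function.update f j (L (f j))) := by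
  ext s
  have h : sliceOp L j (prodFun f) s =
      L ((∏ i ∈ Finset.univ.erase j, f i (s i)) • f j) (s j) := by
    change L _ (s j) = _
    congr 2
    ext r
    change prodFun f (Function.update s j r) = _
    rw [prodFun_update_apply, mul_comm]; rfl
  rw [h, map_smul, ContinuousMap.smul_apply, smul_eq_mul, prodFun_apply,
    ← Finset.mul_prod_erase _ _ (Finset.mem_univ j), Function.update_self, mul_comm]
  congr 1
  refine Finset.prod_congr rfl fun i hi => ?_
  rw [Function.update_of_ne (Finset.ne_of_mem_erase hi)]

/-- The tensor power of an operator on `C(K)`, acting on `C(K^m)`. -/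
def tensorPow {K : Type*} [TopologicalSpace K] [CompactSpace K] (m : ℕ)
    (L : C(K, ℝ) →L[ℝ] C(K, ℝ)) : C(Fin m → K, ℝ) →L[ℝ] C(Fin m → K, ℝ) :=
  ((List.finRange m).map (sliceOp L)).prod

theorem norm_tensorPow_apply_le {K : Type*} [TopologicalSpace K] [CompactSpace K] (m : ℕ)
    (L : C(K, ℝ) →L[ℝ] C(K, ℝ)) (φ : C(Fin m → K, ℝ)) :
    ‖tensorPow m L φ‖ ≤ ‖L‖ ^ m * ‖φ‖ := by
  have : ∀ l : List (Fin m), ‖(l.map (sliceOp L)).prod φ‖ ≤ ‖L‖ ^ l.length * ‖φ‖ := by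
    intro l
    induction l with
    | nil => simp
    | cons j l ih =>
      rw [List.map_cons, List.prod_cons, mul_apply_eq_comp, List.length_cons, pow_succ', mul_assoc]
      exact (norm_sliceLin_apply_le _ _ _).trans (mul_le_mul_of_nonneg_left ih (norm_nonneg L))
  simpa [tensorPow] using this (List.finRange m)

theorem tensorPow_prodFun {K : Type*} [TopologicalSpace K] [CompactSpace K] {m : ℕ}
    (L : C(K, ℝ) →L[ℝ] C(K, ℝ)) (f : Fin m → C(K, ℝ)) :
    tensorPow m L (prodFun f) = prodFun fun i => L (f i) := by
  have : ∀ l : List (Fin m), l.Nodup → (l.map (sliceOp L)).prod (prodFun f) =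
      prodFun fun i => if i ∈ l then L (f i) else f i := by
    intro l hl
    induction l with
    | nil => simp
    | cons j l ih =>
      rw [List.map_cons, List.prod_cons, mul_apply_eq_comp, ih (List.nodup_cons.1 hl).2,
        sliceOp_prodFun]
      congr 1
      funext i
      rcases eq_or_ne i j with rfl | h
      · simp [(List.nodup_cons.1 hl).1]
      · simp [h]
  simpa [tensorPow] using this _ (List.nodup_finRange m)

theorem LipschitzOnWith.comp_absolutelyContinuousOnInterval {f g : ℝ → ℝ} {a b : ℝ}
    {K : NNReal} (hf : LipschitzOnWith K f (g '' Set.uIcc a b))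
    (hg : AbsolutelyContinuousOnInterval g a b) :
    AbsolutelyContinuousOnInterval (fun s => f (g s)) a b := by
  unfold AbsolutelyContinuousOnInterval at hg ⊢
  refine squeeze_zero' (Filter.Eventually.of_forall fun E => Finset.sum_nonneg fun _ _ =>
    dist_nonneg) ?_ (by simpa using hg.const_mul (K : ℝ))
  filter_upwards [Filter.mem_inf_of_right (Filter.mem_principal_self _)] with E hE
  rw [Finset.mul_sum]
  refine Finset.sum_le_sum fun i hi => ?_
  exact hf.dist_le_mul _ ⟨_, (hE.1 i hi).1, rfl⟩ _ ⟨_, (hE.1 i hi).2, rfl⟩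

theorem intervalIntegrable_of_locallyIntegrable {f : ℝ → ℝ} (hf : LocallyIntegrable f volume)
    (a b : ℝ) : IntervalIntegrable f volume a b :=
  (hf.integrableOn_isCompact isCompact_uIcc).intervalIntegrable

theorem continuous_primitive_of_locallyIntegrable {f : ℝ → ℝ} (hf : LocallyIntegrable f volume)
    (c : ℝ) : Continuous fun t => ∫ s in c..t, f s :=
  intervalIntegral.continuous_primitive (intervalIntegrable_of_locallyIntegrable hf) c

theorem absolutelyContinuousOnInterval_primitive {f : ℝ → ℝ} (hf : LocallyIntegrable f volume)
    (a b c : ℝ) : AbsolutelyContinuousOnInterval (fun t => ∫ s in c..t, f s) a b := by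
  refine ((intervalIntegrable_of_locallyIntegrable hf (min c (min a b))
    (max c (max a b))).absolutelyContinuousOnInterval_intervalIntegral (c := c) ?_).mono ?_
  · exact Set.mem_uIcc_of_le (min_le_left _ _) (le_max_left _ _)
  · rw [Set.uIcc_of_le ((min_le_left c _).trans (le_max_left _ _)), Set.uIcc]
    exact Set.Icc_subset_Icc (min_le_right _ _) (le_max_right _ _)

/-- Multiplying a solution of the pure delay equation by the integrating factor gives a solution
of the full equation. -/
theorem isSolution_of_pure {α β y : ℝ → ℝ} (hα : LocallyIntegrable α volume)
    (hβ : LocallyIntegrable β volume) (hy : Continuous y) {τ T : ℝ}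
    (h : ∀ t ∈ Set.Icc τ T, y t = y τ - ∫ s in τ..t,
      β s * Real.exp ((∫ r in (0 : ℝ)..s, α r) - ∫ r in (0 : ℝ)..(s - 1), α r) * y (s - 1)) :
    IsSolution α β τ T fun t => Real.exp (-∫ r in (0 : ℝ)..t, α r) * y t := by
  have hA : Continuous fun t => ∫ r in (0 : ℝ)..t, α r :=
    continuous_primitive_of_locallyIntegrable hα 0
  set A : ℝ → ℝ := fun t => ∫ r in (0 : ℝ)..t, α r with hAdef
  refine ⟨((Real.continuous_exp.comp hA.neg).mul hy).continuousOn, fun t ht => ?_⟩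
  set g : ℝ → ℝ := fun s => β s * Real.exp (A s - A (s - 1)) * y (s - 1) with hgdef
  have hg : LocallyIntegrable g volume := by
    have : g = fun s => β s * (Real.exp (A s - A (s - 1)) * y (s - 1)) := by
      funext s; rw [hgdef]; ring
    rw [this]
    exact hβ.mul_continuous (by fun_prop)
  set z : ℝ → ℝ := fun s => y τ - ∫ r in τ..s, g r with hz
  have hyz : ∀ s ∈ Set.Icc τ T, y s = z s := h
  have hzac : AbsolutelyContinuousOnInterval z τ t :=
    (LipschitzWith.const (y τ)).lipschitzOnWith.absolutelyContinuousOnInterval.sub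
      (absolutelyContinuousOnInterval_primitive hg τ t τ)
  have hEac : AbsolutelyContinuousOnInterval (fun s => Real.exp (-A s)) τ t := by
    have hcpt : IsCompact ((fun s => -A s) '' Set.uIcc τ t) :=
      isCompact_uIcc.image (by fun_prop)
    obtain ⟨K, hK⟩ := (Real.contDiff_exp (n := 1)).locallyLipschitz.locallyLipschitzOn
      |>.exists_lipschitzOnWith_of_compact hcpt
    exact hK.comp_absolutelyContinuousOnInterval
      (absolutelyContinuousOnInterval_primitive hα τ t 0).neg
  have hftc := (hEac.mul hzac).integral_deriv_eq_sub
  have hderiv : ∫ s in τ..t, deriv ((fun s => Real.exp (-A s)) * z) s =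
      ∫ s in τ..t, -(α s * (Real.exp (-A s) * y s) +
        β s * (Real.exp (-A (s - 1)) * y (s - 1))) := by
    refine intervalIntegral.integral_congr_ae ?_
    filter_upwards [LocallyIntegrable.ae_hasDerivAt_integral hα,
      LocallyIntegrable.ae_hasDerivAt_integral hg] with s hs1 hs2 hs
    rw [Set.uIoc_of_le ht.1] at hs
    have h1 : HasDerivAt (fun s => Real.exp (-A s)) (Real.exp (-A s) * -α s) s :=
      (hs1 0).fun_neg.exp
    have h2 : HasDerivAt z (-g s) s := (hs2 τ).const_sub (y τ)
    rw [(h1.mul h2).deriv, ← hyz s ⟨hs.1.le, hs.2.trans ht.2⟩, hgdef]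
    have : Real.exp (-A (s - 1)) = Real.exp (-A s) * Real.exp (A s - A (s - 1)) := by
      rw [← Real.exp_add]; congr 1; ring
    rw [this]
    ring
  rw [hderiv, intervalIntegral.integral_neg] at hftc
  simp only [Pi.mul_apply] at hftc
  rw [← hyz t ht, ← hyz τ ⟨le_rfl, ht.1.trans ht.2⟩] at hftc
  linarith

/-- The operator `φ ↦ g · (φ ∘ h)`. -/
def weightedComp {X Y : Type*} [TopologicalSpace X] [CompactSpace X] [TopologicalSpace Y]
    [CompactSpace Y] (g : C(X, ℝ)) (h : C(X, Y)) : C(Y, ℝ) →L[ℝ] C(X, ℝ) :=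
  LinearMap.mkContinuous
    { toFun := fun φ => g * φ.comp h
      map_add' := fun φ ψ => by ext; simp [mul_add]
      map_smul' := fun c φ => by ext; simp }
    ‖g‖ fun φ => by
      refine (norm_mul_le _ _).trans ?_
      gcongr
      rw [ContinuousMap.norm_le _ (by positivity)]
      exact fun r => φ.norm_coe_le_norm _

theorem weightedComp_apply {X Y : Type*} [TopologicalSpace X] [CompactSpace X]
    [TopologicalSpace Y] [CompactSpace Y] (g : C(X, ℝ)) (h : C(X, Y)) (φ : C(Y, ℝ)) (x : X) :
    weightedComp g h φ x = g x * φ (h x) := rfl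

/-- Permutation of the variables. -/
def permOp {K : Type*} [TopologicalSpace K] [CompactSpace K] {m : ℕ} (σ : Equiv.Perm (Fin m)) :
    C(Fin m → K, ℝ) →L[ℝ] C(Fin m → K, ℝ) :=
  weightedComp 1 ⟨fun s => s ∘ σ, by fun_prop⟩

theorem permOp_apply {K : Type*} [TopologicalSpace K] [CompactSpace K] {m : ℕ}
    (σ : Equiv.Perm (Fin m)) (φ : C(Fin m → K, ℝ)) (s : Fin m → K) :
    permOp σ φ s = φ (s ∘ σ) := by
  rw [permOp, weightedComp_apply]; simp

theorem permOp_prodFun {K : Type*} [TopologicalSpace K] [CompactSpace K] {m : ℕ}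
    (σ : Equiv.Perm (Fin m)) (f : Fin m → C(K, ℝ)) :
    permOp σ (prodFun f) = prodFun fun i => f (σ.symm i) := by
  ext s
  rw [permOp_apply, prodFun_apply, prodFun_apply,
    ← Equiv.prod_comp σ fun i => f (σ.symm i) (s i)]
  simp

/-- The map sending an initial function on `[-1, 0]^m` to its multi-time extension on `[-1, T]^m`,
which in each variable solves `y'(t) = -b(t) y(t-1)` with initial data weighted by `e`. -/
def wedgeExt {b : ℝ → ℝ} (hb : LocallyIntegrable b volume) {T : ℝ} (hT : 0 ≤ T) (e : C(ℝ, ℝ))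
    (m : ℕ) : C(Cube m, ℝ) →L[ℝ] C(Fin m → Set.Icc (-1 : ℝ) T, ℝ) :=
  tensorPow m (solOp hb hT) ∘L
    weightedComp ⟨fun s => ∏ i, e (clamp le_rfl (s i)), by fun_prop⟩
      ⟨fun s i => clamp le_rfl (s i), by fun_prop⟩

/-- The one-variable version of `wedgeExt`. -/
def singleExt {b : ℝ → ℝ} (hb : LocallyIntegrable b volume) {T : ℝ} (hT : 0 ≤ T) (e : C(ℝ, ℝ)) :
    C(I01, ℝ) →L[ℝ] C(Set.Icc (-1 : ℝ) T, ℝ) :=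
  solOp hb hT ∘L weightedComp ⟨fun s => e (clamp le_rfl s), by fun_prop⟩
      ⟨fun s => clamp le_rfl s, by fun_prop⟩

theorem exists_separating (x y : I01) (hxy : x ≠ y) : ∃ f : C(I01, ℝ), f x ≠ f y :=
  ⟨⟨fun x => x, by fun_prop⟩, fun h => hxy (Subtype.ext h)⟩

section wedgeExt

variable {b : ℝ → ℝ} (hb : LocallyIntegrable b volume) {T : ℝ} (hT : 0 ≤ T) (e : C(ℝ, ℝ)) {m : ℕ}

theorem wedgeExt_prodFun (f : Fin m → C(I01, ℝ)) :
    wedgeExt hb hT e m (prodFun f) = prodFun fun i => singleExt hb hT e (f i) := by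
  rw [wedgeExt, ContinuousLinearMap.comp_apply]
  have : ∀ (g : C(Fin m → Set.Icc (-1 : ℝ) T, ℝ)) h, (∀ s, g s = ∏ i, e (clamp le_rfl (s i))) →
      (∀ s, h s = fun i => clamp le_rfl (s i : ℝ)) → weightedComp g h (prodFun f) =
        prodFun fun i => weightedComp (⟨fun s => e (clamp le_rfl s), by fun_prop⟩ :
          C(Set.Icc (-1 : ℝ) T, ℝ)) ⟨fun s => clamp le_rfl s, by fun_prop⟩ (f i) := by
    intro g h hg hh
    ext s
    simp only [weightedComp_apply, prodFun_apply, hg, hh, ContinuousMap.coe_mk,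
      Finset.prod_mul_distrib]
  rw [this _ _ (fun _ => rfl) (fun _ => rfl), tensorPow_prodFun]
  rfl

theorem singleExt_apply_of_nonpos (f : C(I01, ℝ)) {t : Set.Icc (-1 : ℝ) T} (ht : (t : ℝ) ≤ 0) :
    singleExt hb hT e f t = e t * f ⟨t, t.2.1, ht⟩ := by
  rw [singleExt, ContinuousLinearMap.comp_apply, solOp_apply_of_nonpos _ _ _ ht,
    weightedComp_apply]
  have : clamp le_rfl (t : ℝ) = (⟨t, t.2.1, ht⟩ : I01) := clamp_coe le_rfl ⟨t, t.2.1, ht⟩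
  simp only [ContinuousMap.coe_mk, this]

theorem singleExt_apply_of_nonneg (f : C(I01, ℝ)) {s : ℝ} (hs : 0 ≤ s) (hsT : s ≤ T) :
    singleExt hb hT e f (clamp hT s) = singleExt hb hT e f (clamp hT 0) -
      ∫ r in (0 : ℝ)..s, b r * singleExt hb hT e f (clamp hT (r - 1)) :=
  solOp_apply_of_nonneg hb hT _ hs hsT

theorem wedgeExt_apply_of_nonpos (φ : C(Cube m, ℝ)) (s : Fin m → Set.Icc (-1 : ℝ) T)
    (hs : ∀ i, (s i : ℝ) ≤ 0) :
    wedgeExt hb hT e m φ s = (∏ i, e (s i)) * φ fun i => ⟨s i, (s i).2.1, hs i⟩ := by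
  have := eq_zero_of_prodFun (m := m) exists_separating
    (ContinuousMap.evalCLM ℝ s ∘L wedgeExt hb hT e m - (∏ i, e (s i)) •
      ContinuousMap.evalCLM ℝ (fun i => (⟨s i, (s i).2.1, hs i⟩ : I01))) fun f => by
    simp only [sub_apply, ContinuousLinearMap.comp_apply, ContinuousMap.evalCLM_apply,
      smul_apply, smul_eq_mul, wedgeExt_prodFun, prodFun_apply,
      singleExt_apply_of_nonpos hb hT e _ (hs _), Finset.prod_mul_distrib, sub_self]
  exact sub_eq_zero.1 (DFunLike.congr_fun this φ)

theorem wedgeExt_permOp (σ : Equiv.Perm (Fin m)) (φ : C(Cube m, ℝ))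
    (s : Fin m → Set.Icc (-1 : ℝ) T) :
    wedgeExt hb hT e m (permOp σ φ) s = wedgeExt hb hT e m φ (s ∘ σ) := by
  have := eq_zero_of_prodFun (m := m) exists_separating
    (ContinuousMap.evalCLM ℝ s ∘L wedgeExt hb hT e m ∘L permOp σ -
      ContinuousMap.evalCLM ℝ (s ∘ σ) ∘L wedgeExt hb hT e m) fun f => by
    simp only [sub_apply, ContinuousLinearMap.comp_apply, ContinuousMap.evalCLM_apply,
      permOp_prodFun, wedgeExt_prodFun, prodFun_apply, Function.comp_apply]
    rw [← Equiv.prod_comp σ]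
    simp
  exact sub_eq_zero.1 (DFunLike.congr_fun this φ)

theorem wedgeExt_comp_perm {φ : C(Cube m, ℝ)} (hφ : φ ∈ Xwedge m) (σ : Equiv.Perm (Fin m))
    (s : Fin m → Set.Icc (-1 : ℝ) T) : wedgeExt hb hT e m φ (s ∘ σ) =
      ((Equiv.Perm.sign σ : ℤ) : ℝ) * wedgeExt hb hT e m φ s := by
  have : permOp σ φ = ((Equiv.Perm.sign σ : ℤ) : ℝ) • φ := by
    ext θ
    rw [permOp_apply, ContinuousMap.smul_apply, smul_eq_mul, hφ σ θ]
  rw [← wedgeExt_permOp, this, map_smul, ContinuousMap.smul_apply, smul_eq_mul]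

/-- Integration of the `j`-th variable against `b r` at the delayed argument. -/
def sliceIntegral (s : Fin m → Set.Icc (-1 : ℝ) T) (j : Fin m) {x : ℝ} (hx : 0 ≤ x) :
    C(Fin m → Set.Icc (-1 : ℝ) T, ℝ) →L[ℝ] ℝ :=
  LinearMap.mkContinuous
    { toFun := fun φ => ∫ r in (0 : ℝ)..x, b r * φ (Function.update s j (clamp hT (r - 1)))
      map_add' := fun φ ψ => by
        simp only [ContinuousMap.add_apply, mul_add]
        exact intervalIntegral.integral_add
          ((intervalIntegrable_of_locallyIntegrable hb _ _).mul_continuousOn (by fun_prop))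
          ((intervalIntegrable_of_locallyIntegrable hb _ _).mul_continuousOn (by fun_prop))
      map_smul' := fun c φ => by
        simp only [ContinuousMap.smul_apply, smul_eq_mul, mul_left_comm _ c, RingHom.id_apply]
        exact intervalIntegral.integral_const_mul _ _ }
    (∫ r in (0 : ℝ)..x, |b r|) fun φ => abs_integral_mul_le
      (g := fun r => φ (Function.update s j (clamp hT (r - 1)))) hb hx le_rfl
        fun r => φ.norm_coe_le_norm _

theorem wedgeExt_update (φ : C(Cube m, ℝ)) (s : Fin m → Set.Icc (-1 : ℝ) T) (j : Fin m)
    {x : ℝ} (hx : 0 ≤ x) (hxT : x ≤ T) :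
    wedgeExt hb hT e m φ (Function.update s j (clamp hT x)) =
      wedgeExt hb hT e m φ (Function.update s j (clamp hT 0)) - ∫ r in (0 : ℝ)..x,
        b r * wedgeExt hb hT e m φ (Function.update s j (clamp hT (r - 1))) := by
  have := eq_zero_of_prodFun (m := m) exists_separating
    (ContinuousMap.evalCLM ℝ (Function.update s j (clamp hT x)) ∘L wedgeExt hb hT e m -
      (ContinuousMap.evalCLM ℝ (Function.update s j (clamp hT 0)) ∘L wedgeExt hb hT e m -
        sliceIntegral hb hT s j hx ∘L wedgeExt hb hT e m)) fun f => by
    have h : ∀ ψ, sliceIntegral hb hT s j hx ψ =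
      ∫ r in (0 : ℝ)..x, b r * ψ (Function.update s j (clamp hT (r - 1))) := fun _ => rfl
    simp only [sub_apply, ContinuousLinearMap.comp_apply, ContinuousMap.evalCLM_apply,
      wedgeExt_prodFun, h, prodFun_update_apply, ← mul_assoc, intervalIntegral.integral_mul_const]
    rw [singleExt_apply_of_nonneg hb hT e _ hx hxT]
    ring
  have h := DFunLike.congr_fun this φ
  exact sub_eq_zero.1 h

theorem wedgeExt_recursion (φ : C(Cube m, ℝ)) (s : Fin m → Set.Icc (-1 : ℝ) T) (j : Fin m)
    {l x : ℝ} (hl : 0 ≤ l) (hlx : l ≤ x) (hxT : x ≤ T) :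
    wedgeExt hb hT e m φ (Function.update s j (clamp hT x)) =
      wedgeExt hb hT e m φ (Function.update s j (clamp hT l)) - ∫ r in l..x,
        b r * wedgeExt hb hT e m φ (Function.update s j (clamp hT (r - 1))) := by
  have hi : ∀ p q, IntervalIntegrable (fun r => b r *
      wedgeExt hb hT e m φ (Function.update s j (clamp hT (r - 1)))) volume p q := fun p q =>
    (intervalIntegrable_of_locallyIntegrable hb _ _).mul_continuousOn (by fun_prop)
  rw [wedgeExt_update hb hT e φ s j (hl.trans hlx) hxT,
    wedgeExt_update hb hT e φ s j hl (hlx.trans hxT),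
    ← intervalIntegral.integral_add_adjacent_intervals (hi 0 l) (hi l x)]
  ring

theorem norm_wedgeExt_apply_le {φ : C(Cube m, ℝ)} {C : ℝ}
    (he : ∀ θ ∈ I01, |e θ| ≤ C) (s : Fin m → Set.Icc (-1 : ℝ) T) :
    |wedgeExt hb hT e m φ s| ≤ ((1 + ∫ r in (0 : ℝ)..T, |b r|) ^ ⌈T⌉₊) ^ m * (C ^ m * ‖φ‖) := by
  have hC : 0 ≤ C := (abs_nonneg _).trans (he 0 ⟨by norm_num, le_rfl⟩)
  refine ((wedgeExt hb hT e m φ).norm_coe_le_norm s).trans ?_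
  refine (norm_tensorPow_apply_le _ _ _).trans ?_
  have h0 : 0 ≤ ∫ r in (0 : ℝ)..T, |b r| :=
    intervalIntegral.integral_nonneg hT fun _ _ => abs_nonneg _
  gcongr
  · exact norm_solOp_le hb hT
  · rw [ContinuousMap.norm_le _ (by positivity)]
    intro s
    change ‖(∏ i, e (clamp le_rfl (s i : ℝ))) * φ fun i => clamp le_rfl (s i : ℝ)‖ ≤ _
    rw [norm_mul]
    gcongr
    · rw [Real.norm_eq_abs, Finset.abs_prod]
      refine (Finset.prod_le_prod (fun _ _ => abs_nonneg _) fun i _ => he _ (clamp _ _).2).trans ?_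
      simp
    · exact φ.norm_coe_le_norm _

end wedgeExt

/-- The primitive of `α` vanishing at `0`. -/
def cumul {α : ℝ → ℝ} (hα : LocallyIntegrable α volume) : C(ℝ, ℝ) :=
  ⟨fun t => ∫ r in (0 : ℝ)..t, α r, continuous_primitive_of_locallyIntegrable hα 0⟩

/-- The delay coefficient, in time shifted by `τ`, after removing the instantaneous term. -/
def delayCoeff {α : ℝ → ℝ} (hα : LocallyIntegrable α volume) (β : ℝ → ℝ) (τ r : ℝ) : ℝ :=
  β (τ + r) * Real.exp (cumul hα (τ + r) - cumul hα (τ + r - 1))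

theorem locallyIntegrable_delayCoeff {α β : ℝ → ℝ} (hα : LocallyIntegrable α volume)
    (hβ : LocallyIntegrable β volume) (τ : ℝ) :
    LocallyIntegrable (delayCoeff hα β τ) volume := by
  have h : LocallyIntegrable (fun r => β (τ + r)) volume := by
    have := (locallyIntegrable_map_homeomorph (μ := (volume : Measure ℝ)) (f := β)
      (Homeomorph.addLeft τ)).1
    rw [Homeomorph.coe_addLeft, map_add_left_eq_self] at this
    exact this hβ
  exact h.mul_continuous (by fun_prop)

/-- The integrating factor in time shifted by `τ`. -/
def expFactor {α : ℝ → ℝ} (hα : LocallyIntegrable α volume) (τ : ℝ) : C(ℝ, ℝ) :=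
  ⟨fun r => Real.exp (cumul hα (τ + r)), by fun_prop⟩

theorem sign_mul_sign_self {m : ℕ} (σ : Equiv.Perm (Fin m)) :
    ((Equiv.Perm.sign σ : ℤ) : ℝ) * ((Equiv.Perm.sign σ : ℤ) : ℝ) = 1 := by
  rw [← Int.cast_mul, ← Units.val_mul, Int.units_mul_self, Units.val_one, Int.cast_one]

/-- The (unnormalised) antisymmetrisation. -/
def antisymmetrize (m : ℕ) : C(Cube m, ℝ) →L[ℝ] Xwedge m :=
  (∑ σ : Equiv.Perm (Fin m), ((Equiv.Perm.sign σ : ℤ) : ℝ) • permOp σ).codRestrict (Xwedge m) <| by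
    intro φ σ θ
    simp only [sum_apply, smul_apply, ContinuousMap.coe_sum, Finset.sum_apply,
      ContinuousMap.smul_apply, permOp_apply, smul_eq_mul, Finset.mul_sum]
    refine Fintype.sum_equiv (Equiv.mulLeft σ) _ _ fun ρ => ?_
    simp only [Equiv.coe_mulLeft, Equiv.Perm.sign_mul, Equiv.Perm.coe_mul, Units.val_mul,
      Int.cast_mul, Function.comp_assoc]
    linear_combination (-((Equiv.Perm.sign ρ : ℤ) : ℝ) * φ (θ ∘ σ ∘ ρ)) * sign_mul_sign_self σ

theorem antisymmetrize_apply {m : ℕ} (φ : C(Cube m, ℝ)) (θ : Cube m) :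
    (antisymmetrize m φ : C(Cube m, ℝ)) θ =
      ∑ σ : Equiv.Perm (Fin m), ((Equiv.Perm.sign σ : ℤ) : ℝ) * φ (θ ∘ σ) := by
  change (∑ σ : Equiv.Perm (Fin m), ((Equiv.Perm.sign σ : ℤ) : ℝ) • permOp σ) φ θ = _
  simp [permOp_apply]

theorem coe_antisymmetrize {m : ℕ} (φ : C(Cube m, ℝ)) :
    (antisymmetrize m φ : C(Cube m, ℝ)) =
      ∑ σ : Equiv.Perm (Fin m), ((Equiv.Perm.sign σ : ℤ) : ℝ) • permOp σ φ := by
  ext θ; simp [antisymmetrize_apply, permOp_apply]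

theorem antisymmetrize_of_mem {m : ℕ} (φ : Xwedge m) :
    antisymmetrize m (φ : C(Cube m, ℝ)) = (m.factorial : ℝ) • φ := by
  ext θ
  rw [antisymmetrize_apply]
  simp_rw [φ.2 _ θ, ← mul_assoc, sign_mul_sign_self]
  simp [Fintype.card_perm]

theorem antisymmetrize_prodFun_apply {m : ℕ} (f : Fin m → C(I01, ℝ)) (θ : Cube m) :
    (antisymmetrize m (prodFun f) : C(Cube m, ℝ)) θ = (Matrix.of fun i j => f i (θ j)).det := by
  rw [antisymmetrize_apply, ← Matrix.det_transpose, Matrix.det_apply']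
  rfl

theorem wedge_apply_eq {α β : ℝ → ℝ} (hα : LocallyIntegrable α volume)
    (hβ : LocallyIntegrable β volume) {m : ℕ} {τ t T : ℝ} (hT : 0 ≤ T)
    (ht : t ≤ τ + T) {W : Xwedge m →L[ℝ] Xwedge m} (hW : IsWedgePower α β m τ t W)
    (φ : Xwedge m) (θ : Cube m) :
    (W φ : C(Cube m, ℝ)) θ = (∏ i, Real.exp (-cumul hα (t + θ i))) *
      wedgeExt (locallyIntegrable_delayCoeff hα hβ τ) hT (expFactor hα τ) m φ
        fun i => clamp hT (t - τ + θ i) := by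
  set G := wedgeExt (locallyIntegrable_delayCoeff hα hβ τ) hT (expFactor hα τ) m with hG
  set R := singleExt (locallyIntegrable_delayCoeff hα hβ τ) hT (expFactor hα τ) with hR
  set p : Fin m → Set.Icc (-1 : ℝ) T := fun i => clamp hT (t - τ + θ i) with hp
  have key := eq_zero_of_prodFun (m := m) exists_separating
    (ContinuousMap.evalCLM ℝ θ ∘L (Xwedge m).subtypeL ∘L W ∘L antisymmetrize m -
      (∏ i, Real.exp (-cumul hα (t + θ i))) •
        (ContinuousMap.evalCLM ℝ p ∘L G ∘L (Xwedge m).subtypeL ∘L antisymmetrize m)) fun f => by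
    let x : Fin m → ℝ → ℝ := fun i s => Real.exp (-cumul hα s) * R (f i) (clamp hT (s - τ))
    have hx : ∀ i, IsSolution α β τ t (x i) := by
      intro i
      refine isSolution_of_pure (y := fun s => R (f i) (clamp hT (s - τ))) hα hβ (by fun_prop) ?_
      intro s hs
      rw [singleExt_apply_of_nonneg _ hT _ _ (sub_nonneg.2 hs.1) (by linarith [hs.2]), sub_self]
      congr 1
      have h := intervalIntegral.integral_comp_sub_right (a := τ) (b := s)
        (fun r => delayCoeff hα β τ r * R (f i) (clamp hT (r - 1))) τ
      rw [sub_self] at h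
      rw [← h]
      refine intervalIntegral.integral_congr fun r _ => ?_
      simp only [delayCoeff, add_sub_cancel, sub_right_comm r τ 1]
      rfl
    let g : Fin m → C(I01, ℝ) := fun i => ⟨fun θ => x i (t + θ), by fun_prop⟩
    have hWf : W (antisymmetrize m (prodFun f)) = antisymmetrize m (prodFun g) := by
      refine hW x hx _ _ (fun θ => ?_) fun θ => antisymmetrize_prodFun_apply g θ
      rw [antisymmetrize_prodFun_apply]
      congr 1
      ext i j
      simp only [Matrix.of_apply, x]
      have h1 : (clamp hT (τ + (θ j : ℝ) - τ) : ℝ) = θ j := by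
        rw [add_sub_cancel_left, coe_clamp hT ⟨(θ j).2.1, (θ j).2.2.trans hT⟩]
      rw [hR, singleExt_apply_of_nonpos _ hT _ _ (h1.trans_le (θ j).2.2)]
      simp only [h1, expFactor, ContinuousMap.coe_mk, ← mul_assoc, ← Real.exp_add]
      simp
    simp only [sub_apply, ContinuousLinearMap.comp_apply, ContinuousMap.evalCLM_apply,
      smul_apply, smul_eq_mul, Submodule.subtypeL_apply, hWf]
    rw [antisymmetrize_apply, coe_antisymmetrize, map_sum, ContinuousMap.coe_sum, Finset.sum_apply,
      Finset.mul_sum, sub_eq_zero]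
    refine Finset.sum_congr rfl fun σ _ => ?_
    rw [map_smul, ContinuousMap.smul_apply, smul_eq_mul, mul_left_comm]
    congr 1
    rw [hG, wedgeExt_permOp, wedgeExt_prodFun, prodFun_apply, prodFun_apply,
      ← Equiv.prod_comp σ fun i => Real.exp (-cumul hα (t + θ i)), ← Finset.prod_mul_distrib]
    refine Finset.prod_congr rfl fun i _ => ?_
    simp only [g, x, hp, ContinuousMap.coe_mk, Function.comp_apply, add_sub_right_comm]
    rfl
  have hkey := DFunLike.congr_fun key (φ : C(Cube m, ℝ))
  simp only [sub_apply, ContinuousLinearMap.comp_apply, ContinuousMap.evalCLM_apply,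
    smul_apply, smul_eq_mul, Submodule.subtypeL_apply, antisymmetrize_of_mem, map_smul,
    zero_apply] at hkey
  have hm : (m.factorial : ℝ) ≠ 0 := by positivity
  apply mul_left_cancel₀ hm
  linarith

section flow

variable {b : ℝ → ℝ} (hb : LocallyIntegrable b volume) {T : ℝ} (hT : 0 ≤ T) (e : C(ℝ, ℝ))

theorem wedgeExt_nonneg_of_nonpos {m : ℕ} {φ : Xwedge m} (hφ : φ ∈ Kcone m)
    (he : ∀ r, 0 < e r) (s : Fin m → Set.Icc (-1 : ℝ) T) (hs : ∀ i, (s i : ℝ) ≤ 0)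
    (hmono : Monotone fun i => (s i : ℝ)) : 0 ≤ wedgeExt hb hT e m φ s := by
  rw [wedgeExt_apply_of_nonpos _ _ _ _ _ hs]
  exact mul_nonneg (Finset.prod_nonneg fun i _ => (he _).le) (hφ _ hmono)

theorem wedgeExt_two_swap (φ : Xwedge 2) (x y : Set.Icc (-1 : ℝ) T) :
    wedgeExt hb hT e 2 φ ![x, y] = -wedgeExt hb hT e 2 φ ![y, x] := by
  have h := wedgeExt_comp_perm hb hT e φ.2 (Equiv.swap 0 1) ![y, x]
  have h' : ![y, x] ∘ Equiv.swap (0 : Fin 2) 1 = ![x, y] := by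
    ext i; fin_cases i <;> rfl
  rw [h', Equiv.Perm.sign_swap (by decide)] at h
  simpa using h

theorem wedgeExt_three_swap (φ : Xwedge 3) (x y z : Set.Icc (-1 : ℝ) T) :
    wedgeExt hb hT e 3 φ ![x, y, z] = -wedgeExt hb hT e 3 φ ![x, z, y] := by
  have h := wedgeExt_comp_perm hb hT e φ.2 (Equiv.swap 1 2) ![x, z, y]
  have h' : ![x, z, y] ∘ Equiv.swap (1 : Fin 3) 2 = ![x, y, z] := by
    ext i; fin_cases i <;> rfl
  rw [h', Equiv.Perm.sign_swap (by decide)] at h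
  simpa using h

theorem wedgeExt_three_rotate (φ : Xwedge 3) (x y z : Set.Icc (-1 : ℝ) T) :
    wedgeExt hb hT e 3 φ ![x, y, z] = wedgeExt hb hT e 3 φ ![z, x, y] := by
  have h := wedgeExt_comp_perm hb hT e φ.2 (finRotate 3) ![z, x, y]
  have h' : ![z, x, y] ∘ finRotate 3 = ![x, y, z] := by
    ext i; fin_cases i <;> rfl
  rw [h', sign_finRotate] at h
  simpa using h

theorem isFlow₂_wedgeExt {c₁ c₂ : ℝ} (hc₁ : 0 ≤ c₁) (he : ∀ r, 0 < e r)
    (hbd : ∀ᵐ r ∂volume.restrict (Set.Icc 0 T), c₁ ≤ b r ∧ b r ≤ c₂) {φ : Xwedge 2}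
    (hφ : φ ∈ Kcone 2) :
    IsFlow₂ T c₁ c₂ fun s₁ s₂ => wedgeExt hb hT e 2 φ ![clamp hT s₁, clamp hT s₂] := by
  refine IsFlow₂.of_recursion hc₁ hb hbd (fun s => by fun_prop) (fun s => ?_)
    (fun s₁ s₂ h₁ h₂ h₃ => ?_) fun s₁ s₂ l h₁ h₂ h₃ h₄ h₅ => ?_
  · have := wedgeExt_two_swap hb hT e φ (clamp hT s) (clamp hT s)
    linarith
  · have e₁ := coe_clamp hT (s := s₁) ⟨h₁, by linarith⟩
    have e₂ := coe_clamp hT (s := s₂) ⟨by linarith, by linarith⟩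
    refine wedgeExt_nonneg_of_nonpos hb hT e hφ he _ ?_ ?_
    · simp [Fin.forall_fin_two, e₁, e₂, h₃, h₂.trans h₃]
    · rw [Fin.monotone_iff_le_succ]
      simp [e₁, e₂, h₂]
  · have h := wedgeExt_recursion hb hT e φ ![clamp hT s₁, clamp hT 0] 1 h₄ h₅ h₃
    have hu : ∀ c, Function.update ![clamp hT s₁, clamp hT 0] 1 c = ![clamp hT s₁, c] := fun c => by
      ext i; fin_cases i <;> rfl
    simp only [hu] at h
    rw [h, sub_eq_add_neg, ← intervalIntegral.integral_neg]
    congr 1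
    refine intervalIntegral.integral_congr fun r _ => ?_
    simp only [wedgeExt_two_swap hb hT e φ (clamp hT s₁), mul_neg, neg_neg]

theorem isFlow₃_wedgeExt {c₁ c₂ : ℝ} (hc₁ : 0 ≤ c₁) (he : ∀ r, 0 < e r)
    (hbd : ∀ᵐ r ∂volume.restrict (Set.Icc 0 T), c₁ ≤ -b r ∧ -b r ≤ c₂) {φ : Xwedge 3}
    (hφ : φ ∈ Kcone 3) :
    IsFlow₃ T c₁ c₂ fun s₁ s₂ s₃ =>
      wedgeExt hb hT e 3 φ ![clamp hT s₁, clamp hT s₂, clamp hT s₃] := by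
  refine IsFlow₃.of_recursion hc₁ hb.neg hbd (fun s₁ s₂ => by fun_prop) (fun s₁ s₂ => ?_)
    (fun s₁ s₂ s₃ h₁ h₂ h₂' h₃ => ?_) fun s₁ s₂ s₃ l h₁ h₂ h₂' h₃ h₄ h₅ => ?_
  · have := wedgeExt_three_swap hb hT e φ (clamp hT s₁) (clamp hT s₂) (clamp hT s₂)
    linarith
  · have e₁ := coe_clamp hT (s := s₁) ⟨h₁, by linarith⟩
    have e₂ := coe_clamp hT (s := s₂) ⟨by linarith, by linarith⟩
    have e₃ := coe_clamp hT (s := s₃) ⟨by linarith, by linarith⟩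
    refine wedgeExt_nonneg_of_nonpos hb hT e hφ he _ ?_ ?_
    · simp [Fin.forall_fin_succ, e₁, e₂, e₃, h₃, h₂'.trans h₃, h₂.trans (h₂'.trans h₃)]
    · rw [Fin.monotone_iff_le_succ]
      simp [Fin.forall_fin_two, -Subtype.coe_le_coe, e₁, e₂, e₃, h₂, h₂']
  · have h := wedgeExt_recursion hb hT e φ ![clamp hT s₁, clamp hT s₂, clamp hT 0] 2 h₄ h₅ h₃
    have hu : ∀ c, Function.update ![clamp hT s₁, clamp hT s₂, clamp hT 0] 2 c =
        ![clamp hT s₁, clamp hT s₂, c] := fun c => by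
      ext i; fin_cases i <;> rfl
    simp only [hu] at h
    rw [h, sub_eq_add_neg, ← intervalIntegral.integral_neg]
    congr 1
    refine intervalIntegral.integral_congr fun r _ => ?_
    simp only [wedgeExt_three_rotate hb hT e φ (clamp hT s₁), Pi.neg_apply, neg_mul]

end flow

theorem exists_abs_cumul_le {α : ℝ → ℝ} (hα : LocallyIntegrable α volume) (p q : ℝ) :
    ∃ K, ∀ s ∈ Set.Icc p q, |cumul hα s| ≤ K :=
  isCompact_Icc.exists_bound_of_continuousOn (cumul hα).continuous.continuousOn

theorem ae_delayCoeff_bounds {α β : ℝ → ℝ} (hα : LocallyIntegrable α volume)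
    {κ β₁ β₂ K τ₁ τ₂ T : ℝ} (hβ₁ : 0 < β₁)
    (hK : ∀ s ∈ Set.Icc (τ₁ - 1) (τ₂ + T), |cumul hα s| ≤ K)
    (hβ : ∀ᵐ t ∂volume.restrict (Set.Icc τ₁ (τ₂ + T)), β₁ ≤ κ * β t ∧ κ * β t ≤ β₂)
    {τ : ℝ} (hτ : τ ∈ Set.Icc τ₁ τ₂) :
    ∀ᵐ r ∂volume.restrict (Set.Icc 0 T), β₁ * Real.exp (-(2 * K)) ≤ κ * delayCoeff hα β τ r ∧
      κ * delayCoeff hα β τ r ≤ β₂ * Real.exp (2 * K) := by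
  rw [ae_restrict_iff' measurableSet_Icc] at hβ ⊢
  filter_upwards [(measurePreserving_add_left volume τ).quasiMeasurePreserving.ae hβ] with r h hr
  obtain ⟨h₁, h₂⟩ := h ⟨by linarith [hτ.1, hr.1], by linarith [hτ.2, hr.2]⟩
  have k₁ := abs_le.1 (hK (τ + r) ⟨by linarith [hτ.1, hr.1], by linarith [hτ.2, hr.2]⟩)
  have k₂ := abs_le.1 (hK (τ + r - 1) ⟨by linarith [hτ.1, hr.1], by linarith [hτ.2, hr.2]⟩)
  rw [delayCoeff, ← mul_assoc]
  exact ⟨mul_le_mul h₁ (Real.exp_le_exp.2 (by linarith)) (Real.exp_pos _).le (by linarith),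
    mul_le_mul h₂ (Real.exp_le_exp.2 (by linarith)) (Real.exp_pos _).le (by linarith)⟩

theorem integral_abs_le_of_ae_bounds {b : ℝ → ℝ} (hb : LocallyIntegrable b volume)
    {T c₁ c₂ κ : ℝ} (hT : 0 ≤ T) (hκ : |κ| = 1) (hc₁ : 0 ≤ c₁)
    (h : ∀ᵐ r ∂volume.restrict (Set.Icc 0 T), c₁ ≤ κ * b r ∧ κ * b r ≤ c₂) :
    ∫ r in (0 : ℝ)..T, |b r| ≤ c₂ * T := by
  have h₁ : ∫ r in (0 : ℝ)..T, |b r| ≤ ∫ r in (0 : ℝ)..T, c₂ := by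
    refine intervalIntegral.integral_mono_ae_restrict hT
      (intervalIntegrable_of_locallyIntegrable hb 0 T).abs intervalIntegrable_const ?_
    filter_upwards [h] with r hr
    rw [← one_mul |b r|, ← hκ, ← abs_mul, abs_of_nonneg (hc₁.trans hr.1)]
    exact hr.2
  simpa [mul_comm] using h₁

theorem exists_strictMono_pos {m : ℕ} {u : Xwedge m} (hu : u ∈ Kcone m) (hu0 : u ≠ 0) :
    ∃ θ : Cube m, StrictMono θ ∧ 0 < (u : C(Cube m, ℝ)) θ := by
  obtain ⟨θ, hθ⟩ : ∃ θ, (u : C(Cube m, ℝ)) θ ≠ 0 := by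
    by_contra! h
    exact hu0 (Subtype.ext (ContinuousMap.ext h))
  have hinj : Function.Injective θ := by
    intro i j hij
    by_contra hne
    have h := u.2 (Equiv.swap i j) θ
    have h' : θ ∘ Equiv.swap i j = θ := by
      ext k
      rw [Function.comp_apply, Equiv.apply_swap_eq_self hij]
    rw [h', Equiv.Perm.sign_swap hne] at h
    apply hθ
    push_cast at h
    linarith
  have hmono := Tuple.monotone_sort θ
  refine ⟨θ ∘ Tuple.sort θ, hmono.strictMono_of_injective (hinj.comp (Equiv.injective _)),
    lt_of_le_of_ne (hu _ hmono) ?_⟩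
  rw [u.2 (Tuple.sort θ) θ]
  refine (mul_ne_zero ?_ hθ).symm
  exact_mod_cast (Equiv.Perm.sign (Tuple.sort θ)).ne_zero

theorem exists_box {m : ℕ} {u : Xwedge m} (hu : u ∈ Kcone m) (hu0 : u ≠ 0) :
    ∃ (x y : Fin m → ℝ) (ε : ℝ), 0 < ε ∧ (∀ i, -1 < x i) ∧ (∀ i, x i < y i) ∧
      (∀ i j, i < j → y i < x j) ∧ (∀ i, y i < 0) ∧
      ∀ θ : Cube m, (∀ i, (θ i : ℝ) ∈ Set.Icc (x i) (y i)) → ε ≤ (u : C(Cube m, ℝ)) θ := by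
  obtain ⟨ψ, hψ, hpos⟩ := exists_strictMono_pos hu hu0
  let g : C(Fin m → ℝ, Cube m) := ⟨fun q i => clamp le_rfl (q i), by fun_prop⟩
  let p : ℝ → Fin m → ℝ := fun c i => (1 - c) * ψ i - c / 2
  have hp0 : g (p 0) = ψ := by
    ext i
    simp only [g, p, ContinuousMap.coe_mk]
    rw [coe_clamp le_rfl (by simp)]
    simp
  obtain ⟨c, hcu, hc0, hc1⟩ : ∃ c, 0 < (u : C(Cube m, ℝ)) (g (p c)) ∧ 0 < c ∧ c < 1 := by
    have h : ∀ᶠ c in nhdsWithin 0 (Set.Ioi 0), 0 < (u : C(Cube m, ℝ)) (g (p c)) := by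
      refine nhdsWithin_le_nhds (ContinuousAt.eventually_lt continuousAt_const ?_ (by rwa [hp0]))
      exact Continuous.continuousAt (by fun_prop)
    exact (h.and (Ioo_mem_nhdsGT one_pos)).exists
  have hbd : ∀ i, -1 < p c i ∧ p c i < 0 := fun i => by
    have := (ψ i).2
    constructor <;> simp only [p] <;> nlinarith [this.1, this.2]
  have hlt : ∀ i j, i < j → p c i < p c j := fun i j hij => by
    have : (ψ i : ℝ) < ψ j := hψ hij
    simp only [p]
    nlinarith
  obtain ⟨δ, hδ, hball⟩ := Metric.eventually_nhds_iff.1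
    (ContinuousAt.eventually_lt continuousAt_const
      (Continuous.continuousAt (f := fun q => (u : C(Cube m, ℝ)) (g q)) (x := p c)
        (by fun_prop)) (half_lt_self hcu))
  have hev : ∀ᶠ ρ in nhdsWithin (0 : ℝ) (Set.Ioi 0), (∀ i, -1 < p c i - ρ) ∧
      (∀ i j, i < j → p c i + ρ < p c j - ρ) ∧ (∀ i, p c i + ρ < 0) := by
    refine Filter.Eventually.filter_mono nhdsWithin_le_nhds ?_
    simp only [Filter.eventually_and, Filter.eventually_all]
    refine ⟨fun i => ?_, fun i j hij => ?_, fun i => ?_⟩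
    all_goals
      refine ContinuousAt.eventually_lt (Continuous.continuousAt (by fun_prop))
        (Continuous.continuousAt (by fun_prop)) ?_
    · simpa using (hbd i).1
    · simpa using hlt i j hij
    · simpa using (hbd i).2
  obtain ⟨ρ, ⟨h₁, h₂, h₃⟩, hρ0, hρδ⟩ := (hev.and (Ioo_mem_nhdsGT hδ)).exists
  refine ⟨fun i => p c i - ρ, fun i => p c i + ρ, _, half_pos hcu, h₁, fun i => by linarith, h₂, h₃,
    fun θ hθ => ?_⟩
  have hg : g (fun i => (θ i : ℝ)) = θ := by
    ext i
    exact coe_clamp le_rfl (θ i).2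
  have := hball (y := fun i => (θ i : ℝ)) (lt_of_le_of_lt ?_ hρδ)
  · rw [hg] at this
    exact this.le
  · refine (dist_pi_le_iff hρ0.le).2 fun i => ?_
    rw [Real.dist_eq, abs_le]
    constructor <;> linarith [(hθ i).1, (hθ i).2]

theorem umFun_nonneg {m : ℕ} {θ : Cube m} (hθ : θ ∈ TsetC m) :
    0 ≤ umFun m fun i => (θ i : ℝ) := by
  refine mul_nonneg (Finset.prod_nonneg fun p hp => ?_) (Finset.prod_nonneg fun p _ => ?_)
  · exact sub_nonneg.2 (hθ (Finset.mem_filter.1 hp).2.le)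
  · linarith [(θ p.1).2.1, (θ p.2).2.2]

theorem umFun_two (θ : Fin 2 → ℝ) : umFun 2 θ = θ 1 - θ 0 := by
  have h₁ : Finset.univ.filter (fun p : Fin 2 × Fin 2 => p.1 < p.2) = {(0, 1)} := by decide
  have h₂ : Finset.univ.filter (fun p : Fin 2 × Fin 2 => p.1 < p.2 ∧ (p.2 : ℕ) + 2 ≤ 2) = ∅ := by
    decide
  rw [umFun, h₁, h₂, Finset.prod_singleton, Finset.prod_empty, mul_one]

theorem umFun_three (θ : Fin 3 → ℝ) :
    umFun 3 θ = (θ 1 - θ 0) * (θ 2 - θ 0) * (θ 2 - θ 1) * (1 + θ 0 - θ 1) := by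
  have h₁ : Finset.univ.filter (fun p : Fin 3 × Fin 3 => p.1 < p.2) =
      {(0, 1), (0, 2), (1, 2)} := by decide
  have h₂ : Finset.univ.filter (fun p : Fin 3 × Fin 3 => p.1 < p.2 ∧ (p.2 : ℕ) + 2 ≤ 3) =
      {(0, 1)} := by decide
  rw [umFun, h₁, h₂, Finset.prod_insert (by decide), Finset.prod_insert (by decide),
    Finset.prod_singleton, Finset.prod_singleton]
  ring

section delay

variable {α β : ℝ → ℝ} (hα : LocallyIntegrable α volume) (hβ : LocallyIntegrable β volume)
  {τ₁ τ₂ T κ : ℝ} (hT : 0 ≤ T)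

theorem exists_uniform_constants {m : ℕ} (hκ : |κ| = 1)
    (hbd : ∃ β₁ β₂ : ℝ, 0 < β₁ ∧ β₁ ≤ β₂ ∧
      ∀ᵐ t ∂volume.restrict (Set.Icc τ₁ (τ₂ + T)), β₁ ≤ κ * β t ∧ κ * β t ≤ β₂)
    (u : C(Cube m, ℝ)) :
    ∃ c₁ c₂ M L : ℝ, 0 < c₁ ∧ 0 < c₂ ∧ 0 < M ∧ 0 < L ∧ ∀ τ ∈ Set.Icc τ₁ τ₂,
      (∀ᵐ r ∂volume.restrict (Set.Icc 0 T), c₁ ≤ κ * delayCoeff hα β τ r ∧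
        κ * delayCoeff hα β τ r ≤ c₂) ∧
      (∀ s, wedgeExt (locallyIntegrable_delayCoeff hα hβ τ) hT (expFactor hα τ) m u s ≤ M) ∧
      ∀ θ : Cube m, 0 ≤ u θ → L * u θ ≤
        wedgeExt (locallyIntegrable_delayCoeff hα hβ τ) hT (expFactor hα τ) m u
          fun i => clamp hT (θ i) := by
  obtain ⟨β₁, β₂, hβ₁, hβ₁₂, hae⟩ := hbd
  obtain ⟨K, hK⟩ := exists_abs_cumul_le hα (τ₁ - 1) (τ₂ + T)
  have hβ₂ := hβ₁.trans_le hβ₁₂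
  refine ⟨β₁ * Real.exp (-(2 * K)), β₂ * Real.exp (2 * K),
    ((1 + β₂ * Real.exp (2 * K) * T) ^ ⌈T⌉₊) ^ m * (Real.exp K ^ m * ‖u‖) + 1,
    Real.exp (-K) ^ m, by positivity, by positivity, by positivity, by positivity,
    fun τ hτ => ?_⟩
  have hb := ae_delayCoeff_bounds hα hβ₁ hK hae hτ
  have hKτ : ∀ θ ∈ I01, |cumul hα (τ + θ)| ≤ K := fun θ hθ =>
    hK _ ⟨by linarith [hτ.1, hθ.1], by linarith [hτ.2, hθ.2]⟩
  refine ⟨hb, fun s => ?_, fun θ hθ => ?_⟩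
  · have h := norm_wedgeExt_apply_le (locallyIntegrable_delayCoeff hα hβ τ) hT (expFactor hα τ)
      (φ := u) (C := Real.exp K) (fun θ hθ => by
        rw [expFactor, ContinuousMap.coe_mk, abs_of_pos (Real.exp_pos _)]
        exact Real.exp_le_exp.2 (abs_le.1 (hKτ θ hθ)).2) s
    have hI := integral_abs_le_of_ae_bounds (locallyIntegrable_delayCoeff hα hβ τ) hT hκ
      (by positivity) hb
    have hI0 : 0 ≤ ∫ r in (0 : ℝ)..T, |delayCoeff hα β τ r| :=
      intervalIntegral.integral_nonneg hT fun _ _ => abs_nonneg _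
    refine (le_abs_self _).trans (h.trans (le_add_of_le_of_nonneg ?_ zero_le_one))
    gcongr
  · have hc : ∀ i, (clamp hT (θ i : ℝ) : ℝ) = θ i := fun i =>
      coe_clamp hT ⟨(θ i).2.1, (θ i).2.2.trans hT⟩
    rw [wedgeExt_apply_of_nonpos _ _ _ _ _ fun i => (hc i).trans_le (θ i).2.2]
    simp only [hc]
    refine mul_le_mul_of_nonneg_right ?_ hθ
    rw [← Fin.prod_const]
    refine Finset.prod_le_prod (fun _ _ => (Real.exp_pos _).le) fun i _ => ?_
    exact Real.exp_le_exp.2 (abs_le.1 (hKτ _ (θ i).2)).1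

theorem exists_wedgeExt_bounds₂
    (hbd : ∃ β₁ β₂ : ℝ, 0 < β₁ ∧ β₁ ≤ β₂ ∧
      ∀ᵐ t ∂volume.restrict (Set.Icc τ₁ (τ₂ + T)),
        β₁ ≤ (-1 : ℝ) ^ 2 * β t ∧ (-1 : ℝ) ^ 2 * β t ≤ β₂)
    {u : Xwedge 2} (hu : u ∈ Kcone 2) (hu0 : u ≠ 0) :
    ∃ C₁ C₂ : ℝ, 0 < C₁ ∧ 0 < C₂ ∧ ∀ τ ∈ Set.Icc τ₁ τ₂, ∀ η ∈ Set.Icc 3 T, ∀ θ ∈ TsetC 2,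
      C₁ * umFun 2 (fun i => (θ i : ℝ)) ≤ wedgeExt (locallyIntegrable_delayCoeff hα hβ τ) hT
        (expFactor hα τ) 2 u (fun i => clamp hT (η + θ i)) ∧
      wedgeExt (locallyIntegrable_delayCoeff hα hβ τ) hT (expFactor hα τ) 2 u
        (fun i => clamp hT (η + θ i)) ≤ C₂ * umFun 2 (fun i => (θ i : ℝ)) := by
  obtain ⟨c₁, c₂, M, L, hc₁, hc₂, hM, hL, h⟩ :=
    exists_uniform_constants hα hβ hT (by simp) hbd (u : C(Cube 2, ℝ))
  obtain ⟨x, y, ε, hε, hx, hxy, hyx, hy, hbox⟩ := exists_box hu hu0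
  obtain ⟨C₁, C₂, hC₁, hC₂, H⟩ := exists_two_sided_bound₂ (T := T) (M := M)
    (𝓕 := (fun τ s₁ s₂ => wedgeExt (locallyIntegrable_delayCoeff hα hβ τ) hT (expFactor hα τ) 2 u
      ![clamp hT s₁, clamp hT s₂]) '' Set.Icc τ₁ τ₂) hc₁ hc₂ hM
    (by
      rintro _ ⟨τ, hτ, rfl⟩
      exact isFlow₂_wedgeExt _ hT _ hc₁.le (fun r => Real.exp_pos _)
        (by simpa using (h τ hτ).1) hu)
    (by
      rintro _ ⟨τ, hτ, rfl⟩ s₁ s₂ - - - -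
      exact (h τ hτ).2.1 _)
    (hx 0) (hxy 0) (hyx 0 1 (by decide)) (hxy 1) (hy 1) (mul_pos hL hε)
    (by
      rintro _ ⟨τ, hτ, rfl⟩ s₁ s₂ a₁ a₂ b₁ b₂
      have e₁ := coe_clamp (le_refl (0 : ℝ)) (s := s₁) ⟨by linarith [hx 0], by linarith [hy 0]⟩
      have e₂ := coe_clamp (le_refl (0 : ℝ)) (s := s₂) ⟨by linarith [hx 1], by linarith [hy 1]⟩
      have hb := hbox ![clamp le_rfl s₁, clamp le_rfl s₂]
        (Fin.forall_fin_two.2 ⟨by simpa [e₁] using ⟨a₁, a₂⟩, by simpa [e₂] using ⟨b₁, b₂⟩⟩)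
      refine (mul_le_mul_of_nonneg_left hb hL.le).trans
        (((h τ hτ).2.2 _ (hε.le.trans hb)).trans_eq ?_)
      congr 1
      ext i
      fin_cases i <;> simp [e₁, e₂])
  refine ⟨C₁, C₂, hC₁, hC₂, fun τ hτ η hη θ hθ => ?_⟩
  have hv : (fun i => clamp hT (η + θ i)) = ![clamp hT (η + θ 0), clamp hT (η + θ 1)] := by
    ext i; fin_cases i <;> rfl
  have h₀ := (θ 0).2
  have h₁ := (θ 1).2
  have h₀₁ : (θ 0 : ℝ) ≤ θ 1 := hθ (by decide)
  have := H _ (Set.mem_image_of_mem _ hτ) (η + θ 0) (η + θ 1) (by linarith [hη.1, h₀.1])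
    (by linarith) (by linarith [h₀.1, h₁.2]) (by linarith [hη.2, h₁.2])
  rw [umFun_two, hv]
  simpa only [add_sub_add_left_eq_sub] using this

theorem exists_wedgeExt_bounds₃
    (hbd : ∃ β₁ β₂ : ℝ, 0 < β₁ ∧ β₁ ≤ β₂ ∧
      ∀ᵐ t ∂volume.restrict (Set.Icc τ₁ (τ₂ + T)),
        β₁ ≤ (-1 : ℝ) ^ 3 * β t ∧ (-1 : ℝ) ^ 3 * β t ≤ β₂)
    {u : Xwedge 3} (hu : u ∈ Kcone 3) (hu0 : u ≠ 0) :
    ∃ C₁ C₂ : ℝ, 0 < C₁ ∧ 0 < C₂ ∧ ∀ τ ∈ Set.Icc τ₁ τ₂, ∀ η ∈ Set.Icc 5 T, ∀ θ ∈ TsetC 3,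
      C₁ * umFun 3 (fun i => (θ i : ℝ)) ≤ wedgeExt (locallyIntegrable_delayCoeff hα hβ τ) hT
        (expFactor hα τ) 3 u (fun i => clamp hT (η + θ i)) ∧
      wedgeExt (locallyIntegrable_delayCoeff hα hβ τ) hT (expFactor hα τ) 3 u
        (fun i => clamp hT (η + θ i)) ≤ C₂ * umFun 3 (fun i => (θ i : ℝ)) := by
  obtain ⟨c₁, c₂, M, L, hc₁, hc₂, hM, hL, h⟩ :=
    exists_uniform_constants hα hβ hT (by simp) hbd (u : C(Cube 3, ℝ))
  obtain ⟨x, y, ε, hε, hx, hxy, hyx, hy, hbox⟩ := exists_box hu hu0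
  obtain ⟨C₁, C₂, hC₁, hC₂, H⟩ := exists_two_sided_bound₃ (T := T) (M := M)
    (𝓕 := (fun τ s₁ s₂ s₃ => wedgeExt (locallyIntegrable_delayCoeff hα hβ τ) hT
      (expFactor hα τ) 3 u ![clamp hT s₁, clamp hT s₂, clamp hT s₃]) '' Set.Icc τ₁ τ₂) hc₁ hc₂ hM
    (by
      rintro _ ⟨τ, hτ, rfl⟩
      exact isFlow₃_wedgeExt _ hT _ hc₁.le (fun r => Real.exp_pos _)
        (by simpa [pow_succ] using (h τ hτ).1) hu)
    (by
      rintro _ ⟨τ, hτ, rfl⟩ s₁ s₂ s₃ - - - - -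
      exact (h τ hτ).2.1 _)
    (hx 0) (hxy 0) (hyx 0 1 (by decide)) (hxy 1) (hyx 1 2 (by decide)) (hxy 2) (hy 2)
    (mul_pos hL hε)
    (by
      rintro _ ⟨τ, hτ, rfl⟩ s₁ s₂ s₃ a₁ a₂ b₁ b₂ d₁ d₂
      have e₁ := coe_clamp (le_refl (0 : ℝ)) (s := s₁) ⟨by linarith [hx 0], by linarith [hy 0]⟩
      have e₂ := coe_clamp (le_refl (0 : ℝ)) (s := s₂) ⟨by linarith [hx 1], by linarith [hy 1]⟩
      have e₃ := coe_clamp (le_refl (0 : ℝ)) (s := s₃) ⟨by linarith [hx 2], by linarith [hy 2]⟩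
      have hb := hbox ![clamp le_rfl s₁, clamp le_rfl s₂, clamp le_rfl s₃] (by
        intro i
        fin_cases i
        · simpa [e₁] using ⟨a₁, a₂⟩
        · simpa [e₂] using ⟨b₁, b₂⟩
        · simpa [e₃] using ⟨d₁, d₂⟩)
      refine (mul_le_mul_of_nonneg_left hb hL.le).trans
        (((h τ hτ).2.2 _ (hε.le.trans hb)).trans_eq ?_)
      congr 1
      ext i
      fin_cases i <;> simp [e₁, e₂, e₃])
  refine ⟨C₁, C₂, hC₁, hC₂, fun τ hτ η hη θ hθ => ?_⟩
  have hv : (fun i => clamp hT (η + θ i)) =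
      ![clamp hT (η + θ 0), clamp hT (η + θ 1), clamp hT (η + θ 2)] := by
    ext i; fin_cases i <;> rfl
  have h₀ := (θ 0).2
  have h₂ := (θ 2).2
  have h₀₁ : (θ 0 : ℝ) ≤ θ 1 := hθ (by decide)
  have h₁₂ : (θ 1 : ℝ) ≤ θ 2 := hθ (by decide)
  have := H _ (Set.mem_image_of_mem _ hτ) (η + θ 0) (η + θ 1) (η + θ 2)
    (by linarith [hη.1, h₀.1]) (by linarith) (by linarith) (by linarith [h₀.1, h₂.2])
    (by linarith [hη.2, h₂.2])
  rw [umFun_three, hv]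
  have e : 1 + (η + (θ 0 : ℝ)) - (η + θ 1) = 1 + θ 0 - θ 1 := by ring
  simpa only [add_sub_add_left_eq_sub, e] using this

theorem wedgeExt_nonneg₂ {τ : ℝ}
    (hbd : ∃ β₁ β₂ : ℝ, 0 < β₁ ∧ β₁ ≤ β₂ ∧
      ∀ᵐ t ∂volume.restrict (Set.Icc τ (τ + T)),
        β₁ ≤ (-1 : ℝ) ^ 2 * β t ∧ (-1 : ℝ) ^ 2 * β t ≤ β₂)
    {u : Xwedge 2} (hu : u ∈ Kcone 2) {θ : Cube 2} (hθ : θ ∈ TsetC 2) :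
    0 ≤ wedgeExt (locallyIntegrable_delayCoeff hα hβ τ) hT (expFactor hα τ) 2 u
      fun i => clamp hT (T + θ i) := by
  obtain ⟨c₁, c₂, M, L, hc₁, -, -, -, h⟩ :=
    exists_uniform_constants hα hβ hT (by simp) hbd (u : C(Cube 2, ℝ))
  have hflow := isFlow₂_wedgeExt (locallyIntegrable_delayCoeff hα hβ τ) hT (expFactor hα τ)
    hc₁.le (fun r => Real.exp_pos _) (by simpa using (h τ ⟨le_rfl, le_rfl⟩).1) hu
  have hv : (fun i => clamp hT (T + θ i)) = ![clamp hT (T + θ 0), clamp hT (T + θ 1)] := by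
    ext i; fin_cases i <;> rfl
  have h₀₁ : (θ 0 : ℝ) ≤ θ 1 := hθ (by decide)
  rw [hv]
  exact hflow.nonneg _ _ (by linarith [(θ 0).2.1]) (by linarith)
    (by linarith [(θ 0).2.1, (θ 1).2.2]) (by linarith [(θ 1).2.2])

theorem wedgeExt_nonneg₃ {τ : ℝ}
    (hbd : ∃ β₁ β₂ : ℝ, 0 < β₁ ∧ β₁ ≤ β₂ ∧
      ∀ᵐ t ∂volume.restrict (Set.Icc τ (τ + T)),
        β₁ ≤ (-1 : ℝ) ^ 3 * β t ∧ (-1 : ℝ) ^ 3 * β t ≤ β₂)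
    {u : Xwedge 3} (hu : u ∈ Kcone 3) {θ : Cube 3} (hθ : θ ∈ TsetC 3) :
    0 ≤ wedgeExt (locallyIntegrable_delayCoeff hα hβ τ) hT (expFactor hα τ) 3 u
      fun i => clamp hT (T + θ i) := by
  obtain ⟨c₁, c₂, M, L, hc₁, -, -, -, h⟩ :=
    exists_uniform_constants hα hβ hT (by simp) hbd (u : C(Cube 3, ℝ))
  have hflow := isFlow₃_wedgeExt (locallyIntegrable_delayCoeff hα hβ τ) hT (expFactor hα τ)
    hc₁.le (fun r => Real.exp_pos _) (by simpa [pow_succ] using (h τ ⟨le_rfl, le_rfl⟩).1) hu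
  have hv : (fun i => clamp hT (T + θ i)) =
      ![clamp hT (T + θ 0), clamp hT (T + θ 1), clamp hT (T + θ 2)] := by
    ext i; fin_cases i <;> rfl
  have h₀₁ : (θ 0 : ℝ) ≤ θ 1 := hθ (by decide)
  have h₁₂ : (θ 1 : ℝ) ≤ θ 2 := hθ (by decide)
  rw [hv]
  exact hflow.nonneg _ _ _ (by linarith [(θ 0).2.1]) (by linarith) (by linarith)
    (by linarith [(θ 0).2.1, (θ 2).2.2]) (by linarith [(θ 2).2.2])

end delay

/-- Two-sided bounds for the rescaled flow transfer to the exterior power of the solution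
operator. -/
theorem exists_wedge_bounds {α β : ℝ → ℝ} (hα : LocallyIntegrable α volume)
    (hβ : LocallyIntegrable β volume) {m : ℕ} {τ₁ τ₂ η₀ T C₁ C₂ : ℝ} (hT : 0 ≤ T) (hη₀ : 0 ≤ η₀)
    {W : ℝ → ℝ → (Xwedge m →L[ℝ] Xwedge m)}
    (hW : ∀ τ t : ℝ, τ ≤ t → IsWedgePower α β m τ t (W τ t)) {um u : Xwedge m}
    (hum : ∀ θ ∈ TsetC m, (um : C(Cube m, ℝ)) θ = umFun m (fun i => (θ i : ℝ)))
    (hC₁ : 0 < C₁) (hC₂ : 0 < C₂)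
    (h : ∀ τ ∈ Set.Icc τ₁ τ₂, ∀ η ∈ Set.Icc η₀ T, ∀ θ ∈ TsetC m,
      C₁ * umFun m (fun i => (θ i : ℝ)) ≤ wedgeExt (locallyIntegrable_delayCoeff hα hβ τ) hT
        (expFactor hα τ) m u (fun i => clamp hT (η + θ i)) ∧
      wedgeExt (locallyIntegrable_delayCoeff hα hβ τ) hT (expFactor hα τ) m u
        (fun i => clamp hT (η + θ i)) ≤ C₂ * umFun m (fun i => (θ i : ℝ))) :
    ∃ C₁ C₂ : ℝ, 0 < C₁ ∧ 0 < C₂ ∧ ∀ τ ∈ Set.Icc τ₁ τ₂, ∀ η ∈ Set.Icc η₀ T,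
      W τ (τ + η) u - C₁ • um ∈ Kcone m ∧ C₂ • um - W τ (τ + η) u ∈ Kcone m := by
  obtain ⟨K, hK⟩ := exists_abs_cumul_le hα (τ₁ + η₀ - 1) (τ₂ + T)
  refine ⟨Real.exp (-K) ^ m * C₁, Real.exp K ^ m * C₂, by positivity, by positivity,
    fun τ hτ η hη => ?_⟩
  have main : ∀ θ ∈ TsetC m,
      Real.exp (-K) ^ m * C₁ * umFun m (fun i => (θ i : ℝ)) ≤
        (W τ (τ + η) u : C(Cube m, ℝ)) θ ∧
      (W τ (τ + η) u : C(Cube m, ℝ)) θ ≤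
        Real.exp K ^ m * C₂ * umFun m (fun i => (θ i : ℝ)) := by
    intro θ hθ
    obtain ⟨h₁, h₂⟩ := h τ hτ η hη θ hθ
    have hK' : ∀ i, |cumul hα (τ + η + θ i)| ≤ K := fun i =>
      hK _ ⟨by linarith [hτ.1, hη.1, (θ i).2.1], by linarith [hτ.2, hη.2, (θ i).2.2]⟩
    have hp₁ : Real.exp (-K) ^ m ≤ ∏ i, Real.exp (-cumul hα (τ + η + θ i)) := by
      rw [← Fin.prod_const]
      exact Finset.prod_le_prod (fun _ _ => (Real.exp_pos _).le) fun i _ =>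
        Real.exp_le_exp.2 (neg_le_neg (abs_le.1 (hK' i)).2)
    have hp₂ : ∏ i, Real.exp (-cumul hα (τ + η + θ i)) ≤ Real.exp K ^ m := by
      rw [← Fin.prod_const]
      exact Finset.prod_le_prod (fun _ _ => (Real.exp_pos _).le) fun i _ =>
        Real.exp_le_exp.2 (neg_le.1 (abs_le.1 (hK' i)).1)
    have hu₀ := umFun_nonneg hθ
    have h₀ := (mul_nonneg hC₁.le hu₀).trans h₁
    rw [wedge_apply_eq hα hβ hT (by linarith [hη.2]) (hW τ (τ + η) (by linarith [hη.1]))]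
    simp only [add_sub_cancel_left, mul_assoc]
    exact ⟨mul_le_mul hp₁ h₁ (by positivity) ((by positivity : (0 : ℝ) ≤ _).trans hp₁),
      mul_le_mul hp₂ h₂ h₀ (by positivity)⟩
  constructor <;> intro θ hθ
  · change 0 ≤ (W τ (τ + η) u : C(Cube m, ℝ)) θ - _ * (um : C(Cube m, ℝ)) θ
    rw [hum θ hθ]
    exact sub_nonneg.2 (main θ hθ).1
  · change 0 ≤ _ * (um : C(Cube m, ℝ)) θ - (W τ (τ + η) u : C(Cube m, ℝ)) θ
    rw [hum θ hθ]
    exact sub_nonneg.2 (main θ hθ).2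

theorem statement11 (α β : ℝ → ℝ)
    (hα : LocallyIntegrable α volume) (hβ : LocallyIntegrable β volume)
    (m : ℕ) (hm : m = 2 ∨ m = 3)
    (hβbnd : ∀ t₁ t₂ : ℝ, t₁ ≤ t₂ → ∃ β₁ β₂ : ℝ, 0 < β₁ ∧ β₁ ≤ β₂ ∧
      ∀ᵐ t ∂(volume.restrict (Set.Icc t₁ t₂)),
        β₁ ≤ (-1 : ℝ) ^ m * β t ∧ (-1 : ℝ) ^ m * β t ≤ β₂)
    (W : ℝ → ℝ → (Xwedge m →L[ℝ] Xwedge m))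
    (hW : ∀ τ t : ℝ, τ ≤ t → IsWedgePower α β m τ t (W τ t))
    (um : Xwedge m)
    (hum : ∀ θ ∈ TsetC m, (um : C(Cube m, ℝ)) θ = umFun m (fun i => (θ i : ℝ))) :
    (∀ τ t : ℝ, τ ≤ t → ∀ φ ∈ Kcone m, W τ t φ ∈ Kcone m) ∧
    ∀ u : Xwedge m, u ∈ Kcone m → u ≠ 0 →
      ∀ τ₁ τ₂ : ℝ, τ₁ ≤ τ₂ → ∀ ηs : ℝ, (if m = 2 then (3 : ℝ) else 5) ≤ ηs →
        ∃ C₁ C₂ : ℝ, 0 < C₁ ∧ 0 < C₂ ∧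
          ∀ τ ∈ Set.Icc τ₁ τ₂, ∀ η ∈ Set.Icc (if m = 2 then (3 : ℝ) else 5) ηs,
            W τ (τ + η) u - C₁ • um ∈ Kcone m ∧ C₂ • um - W τ (τ + η) u ∈ Kcone m := by
  have hpos : ∀ {τ t : ℝ} (hτt : τ ≤ t) {φ : Xwedge m}, (∀ θ ∈ TsetC m,
      0 ≤ wedgeExt (locallyIntegrable_delayCoeff hα hβ τ) (sub_nonneg.2 hτt) (expFactor hα τ) m φ
        fun i => clamp (sub_nonneg.2 hτt) (t - τ + θ i)) → W τ t φ ∈ Kcone m := by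
    intro τ t hτt φ h θ hθ
    rw [wedge_apply_eq hα hβ (sub_nonneg.2 hτt) (by linarith) (hW τ t hτt)]
    exact mul_nonneg (Finset.prod_nonneg fun _ _ => (Real.exp_pos _).le) (h θ hθ)
  rcases hm with rfl | rfl
  · refine ⟨fun τ t hτt φ hφ => hpos hτt fun θ hθ =>
      wedgeExt_nonneg₂ hα hβ _ (hβbnd _ _ (by linarith)) hφ hθ,
      fun u hu hu0 τ₁ τ₂ hτ ηs hηs => ?_⟩
    simp only [if_true] at hηs ⊢
    have hT : 0 ≤ ηs := by linarith
    obtain ⟨C₁, C₂, hC₁, hC₂, h⟩ :=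
      exists_wedgeExt_bounds₂ hα hβ hT (hβbnd τ₁ (τ₂ + ηs) (by linarith)) hu hu0
    exact exists_wedge_bounds hα hβ hT (by norm_num) hW hum hC₁ hC₂ h
  · refine ⟨fun τ t hτt φ hφ => hpos hτt fun θ hθ =>
      wedgeExt_nonneg₃ hα hβ _ (hβbnd _ _ (by linarith)) hφ hθ,
      fun u hu hu0 τ₁ τ₂ hτ ηs hηs => ?_⟩
    simp only [if_neg (by norm_num : ¬(3 : ℕ) = 2)] at hηs ⊢
    have hT : 0 ≤ ηs := by linarith
    obtain ⟨C₁, C₂, hC₁, hC₂, h⟩ :=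
      exists_wedgeExt_bounds₃ hα hβ hT (hβbnd τ₁ (τ₂ + ηs) (by linarith)) hu hu0
    exact exists_wedge_bounds hα hβ hT (by norm_num) hW hum hC₁ hC₂ h
end
end

section
/- Let m = 2 or m = 3, and set k_0 = 3 if m = 2 and k_0 = 5 if m = 3. Then for every φ ∈ C(T_m, ℝ) with φ(θ) ≥ 0 for all θ ∈ T_m and φ not identically zero, and for every integer k ≥ k_0, there exist constants 0 < C_1 ≤ C_2 such that C_1·u_m(θ) ≤ (A^k φ)(θ) ≤ C_2·u_m(θ) for all θ ∈ T_m. In particular, A is a u_m-positive operator with respect to the cone C(T_m)^+ = {φ ∈ C(T_m,ℝ) : φ ≥ 0 on T_m}. -/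
open MeasureTheory

noncomputable section

/-- The fundamental simplex `T_m` of ordered tuples in `[-1,0]^m`. -/
def TsetR (m : ℕ) : Set (Fin m → ℝ) :=
  {θ | (∀ i, θ i ∈ Set.Icc (-1 : ℝ) 0) ∧ Monotone θ}

/-- `(A₀ φ)(θ) = ∫_{θ₁}^{θ₂} ⋯ ∫_{θ_{m-1}}^{θ_m} φ(t₁,…,t_{m-1},0) dt_{m-1} ⋯ dt₁`,
written as an integral over the box `∏_j [θ_j, θ_{j+1}]`. -/
def A0op (m : ℕ) (φ : (Fin m → ℝ) → ℝ) (θ : Fin m → ℝ) : ℝ :=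
  ∫ t : Fin (m - 1) → ℝ in
    Set.univ.pi (fun j : Fin (m - 1) => Set.Icc (θ ⟨(j : ℕ), by have := j.isLt; omega⟩)
      (θ ⟨(j : ℕ) + 1, by have := j.isLt; omega⟩)),
    φ (fun i => if h : (i : ℕ) < m - 1 then t ⟨(i : ℕ), h⟩ else 0)

/-- `(A₁ φ)(θ) = ∫_{-1}^{θ₁} ∫_{θ₁}^{θ₂} ⋯ ∫_{θ_{m-1}}^{θ_m} φ(t₀,…,t_{m-1}) dt_{m-1} ⋯ dt₀`,
written as an integral over the box `[-1,θ₁] × ∏_j [θ_j, θ_{j+1}]`. -/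
def A1op (m : ℕ) (φ : (Fin m → ℝ) → ℝ) (θ : Fin m → ℝ) : ℝ :=
  ∫ t : Fin m → ℝ in
    Set.univ.pi (fun j : Fin m => Set.Icc
      (if h : (j : ℕ) = 0 then (-1 : ℝ) else θ ⟨(j : ℕ) - 1, by have := j.isLt; omega⟩)
      (θ j)),
    φ t

/-- The operator `A = A₀ + A₁`. -/
def Aop (m : ℕ) (φ : (Fin m → ℝ) → ℝ) : (Fin m → ℝ) → ℝ :=
  fun θ => A0op m φ θ + A1op m φ θ

/-- The polynomial `u_m^q` (with `0`-indexed coordinates):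
`u_m^q(θ) = (∏_{i<j, j-i ≤ q} (θ_j - θ_i)) (∏_{i<j ≤ m-1, j-i ≥ m-q} (1 + θ_i - θ_j))`. -/
def umq (m q : ℕ) (θ : Fin m → ℝ) : ℝ :=
  (∏ p ∈ Finset.univ.filter
      (fun p : Fin m × Fin m => p.1 < p.2 ∧ (p.2 : ℕ) - (p.1 : ℕ) ≤ q),
    (θ p.2 - θ p.1)) *
  (∏ p ∈ Finset.univ.filter
      (fun p : Fin m × Fin m => p.1 < p.2 ∧ (p.2 : ℕ) + 2 ≤ m ∧ m - q ≤ (p.2 : ℕ) - (p.1 : ℕ)),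
    (1 + θ p.1 - θ p.2))

/-- The average of `F` over the box with corners `l` and `u`; degenerate boxes are allowed. -/
def boxAvg {n : ℕ} (F : (Fin n → ℝ) → ℝ) (l u : Fin n → ℝ) : ℝ :=
  ∫ s in Set.Icc (0 : Fin n → ℝ) 1, F (l + s * (u - l))

theorem add_mul_sub_mem_Icc {n : ℕ} {l u s : Fin n → ℝ} (hlu : l ≤ u)
    (hs : s ∈ Set.Icc (0 : Fin n → ℝ) 1) : l + s * (u - l) ∈ Set.Icc l u := by
  refine ⟨fun i => ?_, fun i => ?_⟩ <;>
    simp only [Pi.add_apply, Pi.mul_apply, Pi.sub_apply] <;>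
    have h0 := hs.1 i <;> have h1 := hs.2 i <;> have h2 := hlu i <;>
    simp only [Pi.zero_apply, Pi.one_apply] at h0 h1 <;> nlinarith

theorem setIntegral_pi_Icc_eq {n : ℕ} (F : (Fin n → ℝ) → ℝ) {l u : Fin n → ℝ} (hlu : l ≤ u) :
    ∫ t in Set.univ.pi (fun i => Set.Icc (l i) (u i)), F t = (∏ i, (u i - l i)) * boxAvg F l u := by
  by_cases hlt : ∀ i, l i < u i
  · have himage : (fun s : Fin n → ℝ => l + s * (u - l)) '' Set.Icc (0 : Fin n → ℝ) 1 =
        Set.univ.pi (fun i => Set.Icc (l i) (u i)) := by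
      rw [Set.pi_univ_Icc]
      ext t
      constructor
      · rintro ⟨s, hs, rfl⟩
        exact add_mul_sub_mem_Icc hlu hs
      · intro ht
        refine ⟨(t - l) / (u - l), ⟨fun i => ?_, fun i => ?_⟩, ?_⟩
        · exact div_nonneg (sub_nonneg.2 (ht.1 i)) (sub_nonneg.2 (hlu i))
        · exact (div_le_one (sub_pos.2 (hlt i))).2 (sub_le_sub_right (ht.2 i) _)
        · ext i
          have := (sub_pos.2 (hlt i)).ne'
          simp only [Pi.add_apply, Pi.mul_apply, Pi.sub_apply, Pi.div_apply]
          field_simp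
          ring
    let L : (Fin n → ℝ) →L[ℝ] (Fin n → ℝ) :=
      LinearMap.toContinuousLinearMap (Matrix.toLin' (Matrix.diagonal (u - l)))
    have hL : ∀ s, L s = s * (u - l) := by
      intro s
      ext i
      simp [L, Matrix.mulVec_diagonal, mul_comm]
    have hdet : L.det = ∏ i, (u i - l i) := by
      simp [L, ContinuousLinearMap.det, LinearMap.det_toLin', Matrix.det_diagonal]
    have hderiv : ∀ s ∈ Set.Icc (0 : Fin n → ℝ) 1,
        HasFDerivWithinAt (fun s : Fin n → ℝ => l + s * (u - l)) L (Set.Icc 0 1) s := by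
      intro s _
      have := (L.hasFDerivAt (x := s)).const_add l
      simp only [hL] at this
      exact this.hasFDerivWithinAt
    have hinj : Set.InjOn (fun s : Fin n → ℝ => l + s * (u - l)) (Set.Icc 0 1) := by
      intro s _ t _ h
      ext i
      have h1 := congrFun h i
      simp only [Pi.add_apply, Pi.mul_apply, Pi.sub_apply, add_right_inj] at h1
      exact mul_right_cancel₀ (sub_pos.2 (hlt i)).ne' h1
    rw [← himage, integral_image_eq_integral_abs_det_fderiv_smul volume measurableSet_Icc hderiv
      hinj, hdet, abs_of_pos (Finset.prod_pos fun i _ => sub_pos.2 (hlt i))]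
    simp only [smul_eq_mul, boxAvg]
    rw [integral_const_mul]
  · push Not at hlt
    obtain ⟨i, hi⟩ := hlt
    have hz : u i - l i = 0 := by linarith [hlu i]
    rw [Finset.prod_eq_zero (Finset.mem_univ i) hz, zero_mul]
    apply setIntegral_measure_zero
    rw [Set.pi_univ_Icc, Real.volume_Icc_pi]
    exact Finset.prod_eq_zero (Finset.mem_univ i) (by rw [hz, ENNReal.ofReal_zero])

theorem continuous_boxAvg {X : Type*} [TopologicalSpace X]
    [FirstCountableTopology X] [LocallyCompactSpace X] {n : ℕ} {F : (Fin n → ℝ) → ℝ}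
    {l u : X → Fin n → ℝ} (hF : Continuous F) (hl : Continuous l) (hu : Continuous u) :
    Continuous fun x => boxAvg F (l x) (u x) := by
  unfold boxAvg
  apply continuous_parametric_integral_of_continuous _ isCompact_Icc
  fun_prop

theorem integrableOn_unit_cube {n : ℕ} {F : (Fin n → ℝ) → ℝ} (hF : Continuous F)
    (l u : Fin n → ℝ) :
    IntegrableOn (fun s => F (l + s * (u - l))) (Set.Icc (0 : Fin n → ℝ) 1) :=
  Continuous.integrableOn_Icc (by fun_prop)

theorem boxAvg_congr {n : ℕ} {F G : (Fin n → ℝ) → ℝ} {l u : Fin n → ℝ} (hlu : l ≤ u)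
    (h : ∀ t ∈ Set.Icc l u, F t = G t) : boxAvg F l u = boxAvg G l u :=
  setIntegral_congr_fun measurableSet_Icc fun _ hs => h _ (add_mul_sub_mem_Icc hlu hs)

theorem boxAvg_nonneg {n : ℕ} {F : (Fin n → ℝ) → ℝ} {l u : Fin n → ℝ} (hlu : l ≤ u)
    (h : ∀ t ∈ Set.Icc l u, 0 ≤ F t) : 0 ≤ boxAvg F l u :=
  setIntegral_nonneg measurableSet_Icc fun _ hs => h _ (add_mul_sub_mem_Icc hlu hs)

theorem boxAvg_le {n : ℕ} {F : (Fin n → ℝ) → ℝ} {l u : Fin n → ℝ} (hF : Continuous F)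
    (hlu : l ≤ u) {C : ℝ} (h : ∀ t ∈ Set.Icc l u, F t ≤ C) : boxAvg F l u ≤ C := by
  have h1 : boxAvg F l u ≤ ∫ _ in Set.Icc (0 : Fin n → ℝ) 1, C :=
    setIntegral_mono_on (integrableOn_unit_cube hF l u)
      (Continuous.integrableOn_Icc continuous_const) measurableSet_Icc
      fun _ hs => h _ (add_mul_sub_mem_Icc hlu hs)
  simpa [Measure.real, Real.volume_Icc_pi] using h1

theorem mul_pow_le_boxAvg {n : ℕ} {F : (Fin n → ℝ) → ℝ} {l u : Fin n → ℝ} (hF : Continuous F)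
    (hlu : l ≤ u) (h0 : ∀ t ∈ Set.Icc l u, 0 ≤ F t) {κ : ℝ}
    (h : ∀ s : Fin n → ℝ, (∀ i, s i ∈ Set.Icc (1 / 4 : ℝ) (1 / 2)) → κ ≤ F (l + s * (u - l))) :
    κ * (1 / 4) ^ n ≤ boxAvg F l u := by
  have hsub : Set.Icc (fun _ : Fin n => (1 / 4 : ℝ)) (fun _ => 1 / 2) ⊆ Set.Icc 0 1 :=
    Set.Icc_subset_Icc (fun i => by norm_num) (fun i => by norm_num)
  have h1 : ∫ s in Set.Icc (fun _ : Fin n => (1 / 4 : ℝ)) (fun _ => 1 / 2), F (l + s * (u - l)) ≤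
      boxAvg F l u :=
    setIntegral_mono_set (integrableOn_unit_cube hF l u)
      ((ae_restrict_mem measurableSet_Icc).mono fun s hs => h0 _ (add_mul_sub_mem_Icc hlu hs))
      hsub.eventuallyLE
  have h2 : ∫ _ in Set.Icc (fun _ : Fin n => (1 / 4 : ℝ)) (fun _ => 1 / 2), κ ≤
      ∫ s in Set.Icc (fun _ : Fin n => (1 / 4 : ℝ)) (fun _ => 1 / 2), F (l + s * (u - l)) :=
    setIntegral_mono_on (Continuous.integrableOn_Icc continuous_const)
      ((integrableOn_unit_cube hF l u).mono_set hsub) measurableSet_Icc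
      fun s hs => h s fun i => ⟨hs.1 i, hs.2 i⟩
  refine le_trans (le_of_eq ?_) (h2.trans h1)
  rw [setIntegral_const, smul_eq_mul, Measure.real, Real.volume_Icc_pi_toReal]
  · rw [Finset.prod_const, Finset.card_univ, Fintype.card_fin, mul_comm]
    norm_num only
  · intro i
    norm_num

theorem boxAvg_pos {n : ℕ} {F : (Fin n → ℝ) → ℝ} {l u t : Fin n → ℝ} (hF : Continuous F)
    (h0 : ∀ t ∈ Set.Icc l u, 0 ≤ F t) (ht : t ∈ Set.Icc l u) (hpos : 0 < F t) :
    0 < boxAvg F l u := by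
  have hlu : l ≤ u := ht.1.trans ht.2
  obtain ⟨s, hs, rfl⟩ : ∃ s ∈ Set.Icc (0 : Fin n → ℝ) 1, l + s * (u - l) = t := by
    refine ⟨(t - l) / (u - l), ⟨fun i => ?_, fun i => ?_⟩, ?_⟩
    · exact div_nonneg (sub_nonneg.2 (ht.1 i)) (sub_nonneg.2 (hlu i))
    · exact div_le_one_of_le₀ (sub_le_sub_right (ht.2 i) _) (sub_nonneg.2 (hlu i))
    · ext i
      simp only [Pi.add_apply, Pi.mul_apply, Pi.sub_apply, Pi.div_apply]
      rw [div_mul_cancel_of_imp, add_sub_cancel]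
      intro h
      have h1 := ht.1 i
      have h2 := ht.2 i
      linarith
  let g : (Fin n → ℝ) → ℝ := fun s => F (l + s * (u - l))
  have hg : Continuous g := by fun_prop
  have hopen : IsOpen {s | 0 < g s} := isOpen_lt continuous_const hg
  have hclos : s ∈ closure (interior (Set.Icc (0 : Fin n → ℝ) 1)) := by
    rw [(convex_Icc (𝕜 := ℝ) (0 : Fin n → ℝ)
      1).closure_interior_eq_closure_of_nonempty_interior]
    · exact subset_closure hs
    · rw [← Set.pi_univ_Icc, interior_pi_set Set.finite_univ]
      refine ⟨fun _ => 1 / 2, fun i _ => ?_⟩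
      simp only [Pi.zero_apply, Pi.one_apply, interior_Icc]
      norm_num
  have hne : ({s | 0 < g s} ∩ interior (Set.Icc (0 : Fin n → ℝ) 1)).Nonempty :=
    mem_closure_iff.1 hclos _ hopen hpos
  rw [boxAvg, setIntegral_pos_iff_support_of_nonneg_ae
    ((ae_restrict_mem measurableSet_Icc).mono fun s hs => h0 _ (add_mul_sub_mem_Icc hlu hs))
    (integrableOn_unit_cube hF l u)]
  refine lt_of_lt_of_le ((hopen.inter isOpen_interior).measure_pos volume hne) (measure_mono ?_)
  exact Set.inter_subset_inter (fun s hs => (ne_of_gt hs)) interior_subset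

/-- The sum of box averages for which `Aop (n + 1) f θ` equals `(∏ j, (θ j.succ - θ j.castSucc))`
times `avgOp f θ` on the simplex. -/
def avgOp {n : ℕ} (f : (Fin (n + 1) → ℝ) → ℝ) (θ : Fin (n + 1) → ℝ) : ℝ :=
  boxAvg (fun t : Fin n → ℝ => f (Fin.snoc t 0)) (fun j => θ j.castSucc) (fun j => θ j.succ) +
    (1 + θ 0) * boxAvg f (Fin.cons (-1) (fun j : Fin n => θ j.castSucc)) θ

theorem mem_TsetR_succ {n : ℕ} {θ : Fin (n + 1) → ℝ} :
    θ ∈ TsetR (n + 1) ↔ -1 ≤ θ 0 ∧ θ (Fin.last n) ≤ 0 ∧ ∀ j : Fin n, θ j.castSucc ≤ θ j.succ := by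
  constructor
  · rintro ⟨h1, h2⟩
    exact ⟨(h1 0).1, (h1 _).2, fun j => h2 j.castSucc_le_succ⟩
  · rintro ⟨h1, h2, h3⟩
    have hm : Monotone θ := Fin.monotone_iff_le_succ.2 h3
    exact ⟨fun i => ⟨h1.trans (hm (Fin.zero_le i)), (hm (Fin.le_last i)).trans h2⟩, hm⟩

theorem snoc_zero_mem_TsetR {n : ℕ} {θ : Fin (n + 1) → ℝ} (hθ : θ ∈ TsetR (n + 1))
    {t : Fin n → ℝ} (ht : t ∈ Set.Icc (fun j : Fin n => θ j.castSucc) (fun j => θ j.succ)) :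
    (Fin.snoc t 0 : Fin (n + 1) → ℝ) ∈ TsetR (n + 1) := by
  have hmem : ∀ j : Fin n, t j ∈ Set.Icc (-1 : ℝ) 0 := fun j =>
    ⟨((hθ.1 _).1).trans (ht.1 j), (ht.2 j).trans (hθ.1 _).2⟩
  refine ⟨fun i => ?_, Fin.monotone_iff_le_succ.2 fun i => ?_⟩
  · refine Fin.lastCases ?_ (fun j => ?_) i
    · simp
    · simpa using hmem j
  · cases n with
    | zero => exact i.elim0
    | succ n =>
      refine Fin.lastCases ?_ (fun j => ?_) i
      · rw [Fin.succ_last, Fin.snoc_last, Fin.snoc_castSucc]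
        exact (hmem _).2
      · rw [Fin.succ_castSucc, Fin.snoc_castSucc, Fin.snoc_castSucc]
        exact (ht.2 _).trans (by simpa using ht.1 j.succ)

theorem mem_TsetR_of_mem_Icc {n : ℕ} {θ : Fin (n + 1) → ℝ} (hθ : θ ∈ TsetR (n + 1))
    {t : Fin (n + 1) → ℝ} (ht : t ∈ Set.Icc (Fin.cons (-1) (fun j : Fin n => θ j.castSucc)) θ) :
    t ∈ TsetR (n + 1) := by
  rw [mem_TsetR_succ] at hθ ⊢
  refine ⟨by simpa using ht.1 0, (ht.2 _).trans hθ.2.1, fun j => ?_⟩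
  exact (ht.2 _).trans (by simpa using ht.1 j.succ)

theorem cons_le_of_mem_TsetR {n : ℕ} {θ : Fin (n + 1) → ℝ} (hθ : θ ∈ TsetR (n + 1)) :
    Fin.cons (-1) (fun j : Fin n => θ j.castSucc) ≤ θ := by
  rw [mem_TsetR_succ] at hθ
  intro i
  refine Fin.cases ?_ (fun j => ?_) i
  · simpa using hθ.1
  · simpa using hθ.2.2 j

theorem Aop_eq_mul_avgOp {n : ℕ} (f : (Fin (n + 1) → ℝ) → ℝ) {θ : Fin (n + 1) → ℝ}
    (hθ : θ ∈ TsetR (n + 1)) :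
    Aop (n + 1) f θ = (∏ j : Fin n, (θ j.succ - θ j.castSucc)) * avgOp f θ := by
  have h0 : A0op (n + 1) f θ = (∏ j : Fin n, (θ j.succ - θ j.castSucc)) *
      boxAvg (fun t : Fin n → ℝ => f (Fin.snoc t 0)) (fun j => θ j.castSucc)
        (fun j => θ j.succ) := by
    rw [← setIntegral_pi_Icc_eq _ (fun j => (mem_TsetR_succ.1 hθ).2.2 j)]
    rfl
  have h1 : A1op (n + 1) f θ = ((1 + θ 0) * ∏ j : Fin n, (θ j.succ - θ j.castSucc)) *
      boxAvg f (Fin.cons (-1) (fun j : Fin n => θ j.castSucc)) θ := by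
    have h := setIntegral_pi_Icc_eq f (cons_le_of_mem_TsetR hθ)
    rw [Fin.prod_univ_succ] at h
    simp only [Fin.cons_zero, Fin.cons_succ, sub_neg_eq_add] at h
    rw [add_comm 1 (θ 0), ← h, A1op]
    congr 3
    funext j
    refine Fin.cases ?_ (fun j => ?_) j
    · simp
    · simp [Fin.castSucc, Fin.castAdd, Fin.castLE]
  rw [Aop, h0, h1, avgOp]
  ring

theorem avgOp_congr {n : ℕ} {f g : (Fin (n + 1) → ℝ) → ℝ} (h : ∀ θ ∈ TsetR (n + 1), f θ = g θ)
    {θ : Fin (n + 1) → ℝ} (hθ : θ ∈ TsetR (n + 1)) : avgOp f θ = avgOp g θ := by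
  rw [avgOp, avgOp, boxAvg_congr (fun j => (mem_TsetR_succ.1 hθ).2.2 j)
    fun t ht => h _ (snoc_zero_mem_TsetR hθ ht), boxAvg_congr (cons_le_of_mem_TsetR hθ)
    fun t ht => h _ (mem_TsetR_of_mem_Icc hθ ht)]

theorem continuous_snoc_zero {n : ℕ} :
    Continuous fun t : Fin n → ℝ => (Fin.snoc t 0 : Fin (n + 1) → ℝ) := by
  refine continuous_pi fun i => ?_
  refine Fin.lastCases ?_ (fun j => ?_) i
  · simpa using continuous_const
  · simpa using continuous_apply j

theorem continuous_avgOp {n : ℕ} {f : (Fin (n + 1) → ℝ) → ℝ} (hf : Continuous f) :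
    Continuous (avgOp f) := by
  refine (continuous_boxAvg (hf.comp continuous_snoc_zero) (by fun_prop) (by fun_prop)).add
    (Continuous.mul (by fun_prop) (continuous_boxAvg hf ?_ continuous_id))
  refine continuous_pi fun i => ?_
  refine Fin.cases ?_ (fun j => ?_) i
  · simpa using continuous_const
  · simpa using continuous_apply j.castSucc

theorem avgOp_pos_of_snoc {n : ℕ} {f : (Fin (n + 1) → ℝ) → ℝ} (hf : Continuous f)
    (h0 : ∀ θ ∈ TsetR (n + 1), 0 ≤ f θ) {θ : Fin (n + 1) → ℝ} (hθ : θ ∈ TsetR (n + 1))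
    {t : Fin n → ℝ} (ht : ∀ j, t j ∈ Set.Icc (θ j.castSucc) (θ j.succ))
    (hpos : 0 < f (Fin.snoc t 0)) : 0 < avgOp f θ := by
  refine add_pos_of_pos_of_nonneg (boxAvg_pos (hf.comp continuous_snoc_zero)
    (fun t ht => h0 _ (snoc_zero_mem_TsetR hθ ht))
    ⟨fun j => (ht j).1, fun j => (ht j).2⟩ hpos) (mul_nonneg ?_ ?_)
  · linarith [(mem_TsetR_succ.1 hθ).1]
  · exact boxAvg_nonneg (cons_le_of_mem_TsetR hθ) fun t ht => h0 _ (mem_TsetR_of_mem_Icc hθ ht)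

theorem avgOp_pos_of_mem {n : ℕ} {f : (Fin (n + 1) → ℝ) → ℝ} (hf : Continuous f)
    (h0 : ∀ θ ∈ TsetR (n + 1), 0 ≤ f θ) {θ : Fin (n + 1) → ℝ} (hθ : θ ∈ TsetR (n + 1))
    (hθ0 : -1 < θ 0) {t : Fin (n + 1) → ℝ}
    (ht : t ∈ Set.Icc (Fin.cons (-1) (fun j : Fin n => θ j.castSucc)) θ)
    (hpos : 0 < f t) : 0 < avgOp f θ :=
  add_pos_of_nonneg_of_pos (boxAvg_nonneg (fun j => (mem_TsetR_succ.1 hθ).2.2 j)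
    fun t ht => h0 _ (snoc_zero_mem_TsetR hθ ht)) (mul_pos (by linarith) (boxAvg_pos hf
      (fun t ht => h0 _ (mem_TsetR_of_mem_Icc hθ ht)) ht hpos))

theorem avgOp_nonneg {n : ℕ} {f : (Fin (n + 1) → ℝ) → ℝ}
    (h0 : ∀ θ ∈ TsetR (n + 1), 0 ≤ f θ) {θ : Fin (n + 1) → ℝ} (hθ : θ ∈ TsetR (n + 1)) :
    0 ≤ avgOp f θ :=
  add_nonneg (boxAvg_nonneg (fun j => (mem_TsetR_succ.1 hθ).2.2 j)
    fun t ht => h0 _ (snoc_zero_mem_TsetR hθ ht)) (mul_nonneg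
      (by linarith [(mem_TsetR_succ.1 hθ).1]) (boxAvg_nonneg (cons_le_of_mem_TsetR hθ)
        fun t ht => h0 _ (mem_TsetR_of_mem_Icc hθ ht)))

/-- The extension of `Aop (n + 1) f` from the simplex to the whole space. -/
def extAop {n : ℕ} (f : (Fin (n + 1) → ℝ) → ℝ) (θ : Fin (n + 1) → ℝ) : ℝ :=
  (∏ j : Fin n, (θ j.succ - θ j.castSucc)) * avgOp f θ

theorem continuous_extAop {n : ℕ} {f : (Fin (n + 1) → ℝ) → ℝ} (hf : Continuous f) :
    Continuous (extAop f) :=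
  Continuous.mul (by fun_prop) (continuous_avgOp hf)

theorem extAop_nonneg {n : ℕ} {f : (Fin (n + 1) → ℝ) → ℝ}
    (h0 : ∀ θ ∈ TsetR (n + 1), 0 ≤ f θ) : ∀ θ ∈ TsetR (n + 1), 0 ≤ extAop f θ := fun _ hθ =>
  mul_nonneg (Finset.prod_nonneg fun j _ => sub_nonneg.2 ((mem_TsetR_succ.1 hθ).2.2 j))
    (avgOp_nonneg h0 hθ)

theorem continuous_iterate_extAop {n : ℕ} {f : (Fin (n + 1) → ℝ) → ℝ} (hf : Continuous f)
    (k : ℕ) : Continuous (extAop^[k] f) := by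
  induction k with
  | zero => exact hf
  | succ k ih =>
    rw [Function.iterate_succ_apply']
    exact continuous_extAop ih

theorem iterate_extAop_nonneg {n : ℕ} {f : (Fin (n + 1) → ℝ) → ℝ}
    (h0 : ∀ θ ∈ TsetR (n + 1), 0 ≤ f θ) (k : ℕ) :
    ∀ θ ∈ TsetR (n + 1), 0 ≤ extAop^[k] f θ := by
  induction k with
  | zero => exact h0
  | succ k ih =>
    rw [Function.iterate_succ_apply']
    exact extAop_nonneg ih

theorem iterate_Aop_eq_iterate_extAop {n : ℕ} {φ f : (Fin (n + 1) → ℝ) → ℝ}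
    (h : ∀ θ ∈ TsetR (n + 1), φ θ = f θ) (k : ℕ) :
    ∀ θ ∈ TsetR (n + 1), (Aop (n + 1))^[k] φ θ = extAop^[k] f θ := by
  induction k with
  | zero => exact h
  | succ k ih =>
    intro θ hθ
    rw [Function.iterate_succ_apply', Function.iterate_succ_apply', Aop_eq_mul_avgOp _ hθ,
      avgOp_congr ih hθ, extAop]

theorem isCompact_TsetR (m : ℕ) : IsCompact (TsetR m) := by
  have h : TsetR m = Set.univ.pi (fun _ => Set.Icc (-1 : ℝ) 0) ∩ {θ | Monotone θ} := by
    ext θ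
    simp only [TsetR, Set.mem_ofPred_eq, Set.mem_inter_iff, Set.mem_univ_pi]
  rw [h]
  exact (isCompact_univ_pi fun _ => isCompact_Icc).inter_right isClosed_monotone

theorem exists_continuous_eqOn {m : ℕ} {φ : (Fin m → ℝ) → ℝ} (h : ContinuousOn φ (TsetR m)) :
    ∃ f : (Fin m → ℝ) → ℝ, Continuous f ∧ ∀ θ ∈ TsetR m, φ θ = f θ := by
  obtain ⟨g, hg⟩ := ContinuousMap.exists_restrict_eq (isCompact_TsetR m).isClosed
    (⟨(TsetR m).domRestrict φ, h.domRestrict⟩ : C(TsetR m, ℝ))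
  exact ⟨g, g.continuous, fun θ hθ => (DFunLike.congr_fun hg ⟨θ, hθ⟩).symm⟩

/-- A function positive somewhere on the simplex is positive at some point on the open segment
towards a given point. -/
theorem exists_pos_on_segment {m : ℕ} {f : (Fin m → ℝ) → ℝ} (hf : Continuous f)
    {θ : Fin m → ℝ} (hθ : 0 < f θ) (c : Fin m → ℝ) :
    ∃ ε : ℝ, 0 < ε ∧ ε < 1 ∧ 0 < f (θ + ε • (c - θ)) := by
  have hg : Continuous fun ε : ℝ => f (θ + ε • (c - θ)) := by fun_prop
  have hev : ∀ᶠ ε in nhdsWithin (0 : ℝ) (Set.Ioi 0), 0 < f (θ + ε • (c - θ)) :=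
    (hg.continuousAt.eventually (lt_mem_nhds (by simpa using hθ))).filter_mono nhdsWithin_le_nhds
  have hev' : ∀ᶠ ε in nhdsWithin (0 : ℝ) (Set.Ioi 0), ε ∈ Set.Ioo (0 : ℝ) 1 :=
    Ioo_mem_nhdsGT one_pos
  obtain ⟨ε, h1, h2⟩ := (hev.and hev').exists
  exact ⟨ε, h2.1, h2.2, h1⟩

theorem mem_TsetR_two {a b : ℝ} : ![a, b] ∈ TsetR 2 ↔ -1 ≤ a ∧ a ≤ b ∧ b ≤ 0 := by
  rw [mem_TsetR_succ]
  simp [Fin.forall_fin_one]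
  tauto

theorem extAop_two (f : (Fin 2 → ℝ) → ℝ) (a b : ℝ) :
    extAop f ![a, b] = (b - a) * avgOp f ![a, b] := by
  simp [extAop]

theorem umq_two (a b : ℝ) : umq 2 1 ![a, b] = b - a := by
  have h1 : Finset.univ.filter (fun p : Fin 2 × Fin 2 =>
      p.1 < p.2 ∧ (p.2 : ℕ) - (p.1 : ℕ) ≤ 1) = {(0, 1)} := by decide
  have h2 : Finset.univ.filter (fun p : Fin 2 × Fin 2 =>
      p.1 < p.2 ∧ (p.2 : ℕ) + 2 ≤ 2 ∧ 2 - 1 ≤ (p.2 : ℕ) - (p.1 : ℕ)) = ∅ := by decide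
  rw [umq, h1, h2]
  simp

theorem avgOp_two_pos_of_boundary {f : (Fin 2 → ℝ) → ℝ} (hf : Continuous f)
    (h0 : ∀ θ ∈ TsetR 2, 0 ≤ f θ) {a b x : ℝ} (ha : -1 ≤ a) (hb : b ≤ 0) (hax : a ≤ x)
    (hxb : x ≤ b) (hpos : 0 < f ![x, 0]) : 0 < avgOp f ![a, b] := by
  refine avgOp_pos_of_snoc hf h0 (mem_TsetR_two.2 ⟨ha, hax.trans hxb, hb⟩) (t := ![x]) ?_ ?_
  · simpa [Fin.forall_fin_one] using ⟨hax, hxb⟩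
  · convert hpos using 2
    ext i
    fin_cases i <;> simp [Fin.snoc]

theorem avgOp_two_pos_of_mem {f : (Fin 2 → ℝ) → ℝ} (hf : Continuous f)
    (h0 : ∀ θ ∈ TsetR 2, 0 ≤ f θ) {a b w x : ℝ} (ha : -1 < a) (hb : b ≤ 0) (hw : -1 ≤ w)
    (hwa : w ≤ a) (hax : a ≤ x) (hxb : x ≤ b) (hpos : 0 < f ![w, x]) : 0 < avgOp f ![a, b] := by
  refine avgOp_pos_of_mem hf h0 (mem_TsetR_two.2 ⟨ha.le, hax.trans hxb, hb⟩) (by simpa using ha)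
    (t := ![w, x]) ⟨?_, ?_⟩ hpos
  · intro i
    fin_cases i <;> simp [hw, hax]
  · intro i
    fin_cases i <;> simp [hwa, hxb]

theorem exists_interior_pos_two {f : (Fin 2 → ℝ) → ℝ} (hf : Continuous f)
    {θ : Fin 2 → ℝ} (hθ : θ ∈ TsetR 2) (hpos : 0 < f θ) :
    ∃ p q : ℝ, -1 < p ∧ p < q ∧ q < 0 ∧ 0 < f ![p, q] := by
  obtain ⟨ε, h0, h1, h⟩ := exists_pos_on_segment hf hpos ![-2 / 3, -1 / 3]
  obtain ⟨a, b, rfl⟩ : ∃ a b, θ = ![a, b] := ⟨θ 0, θ 1, by ext i; fin_cases i <;> rfl⟩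
  rw [mem_TsetR_two] at hθ
  refine ⟨a + ε * (-2 / 3 - a), b + ε * (-1 / 3 - b), by nlinarith, by nlinarith,
    by nlinarith, ?_⟩
  convert h using 2
  ext i
  fin_cases i <;> simp

theorem extAop_two_pos_at {f : (Fin 2 → ℝ) → ℝ} (hf : Continuous f)
    (h0 : ∀ θ ∈ TsetR 2, 0 ≤ f θ) {p q : ℝ} (hp : -1 < p) (hpq : p < q) (hq : q < 0)
    (hpos : 0 < f ![p, q]) : 0 < extAop f ![p, q] := by
  rw [extAop_two]
  exact mul_pos (sub_pos.2 hpq)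
    (avgOp_two_pos_of_mem hf h0 hp hq.le hp.le le_rfl hpq.le le_rfl hpos)

theorem avgOp_extAop_extAop_two_pos {f : (Fin 2 → ℝ) → ℝ} (hf : Continuous f)
    (h0 : ∀ θ ∈ TsetR 2, 0 ≤ f θ) {p q : ℝ} (hp : -1 < p) (hpq : p < q) (hq : q < 0)
    (hpos : 0 < f ![p, q]) {a b : ℝ} (hab : ![a, b] ∈ TsetR 2) :
    0 < avgOp (extAop (extAop f)) ![a, b] := by
  have hf1 := continuous_extAop hf
  have hf2 := continuous_extAop hf1
  have h1 := extAop_nonneg h0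
  have h2 := extAop_nonneg h1
  have S1 : ∀ a b : ℝ, p ≤ a → a ≤ q → q ≤ b → b ≤ 0 → a < b → 0 < extAop f ![a, b] := by
    intro a b h1 h2 h3 h4 h5
    rw [extAop_two]
    exact mul_pos (sub_pos.2 h5)
      (avgOp_two_pos_of_mem hf h0 (hp.trans_le h1) h4 hp.le h1 h2 h3 hpos)
  have S2 : ∀ a : ℝ, -1 ≤ a → a < 0 → 0 < extAop (extAop f) ![a, 0] := by
    intro a ha ha0
    rw [extAop_two]
    refine mul_pos (sub_pos.2 ha0) ?_
    rcases le_or_gt a q with haq | haq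
    · exact avgOp_two_pos_of_boundary hf1 h1 ha le_rfl (le_max_left a p) (max_le ha0.le (by linarith))
        (S1 _ _ (le_max_right _ _) (max_le haq hpq.le) hq.le le_rfl (max_lt ha0 (by linarith)))
    · exact avgOp_two_pos_of_mem hf1 h1 (w := p) (x := a) (by linarith) le_rfl hp.le
        (by linarith) le_rfl ha0.le (S1 _ _ le_rfl hpq.le haq.le ha0.le (by linarith))
  obtain ⟨ha, hab, hb⟩ := mem_TsetR_two.1 hab
  rcases hab.trans hb |>.lt_or_eq with ha0 | rfl
  · exact avgOp_two_pos_of_boundary hf2 h2 ha hb le_rfl hab (S2 a ha ha0)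
  · exact avgOp_two_pos_of_mem hf2 h2 (w := -1) (x := 0) (by norm_num) hb le_rfl (by norm_num)
      le_rfl hab (S2 (-1) le_rfl (by norm_num))

theorem exists_bounds_two {f : (Fin 2 → ℝ) → ℝ} (hf : Continuous f)
    (h0 : ∀ θ ∈ TsetR 2, 0 ≤ f θ) {p q : ℝ} (hp : -1 < p) (hpq : p < q) (hq : q < 0)
    (hpos : 0 < f ![p, q]) :
    ∃ C₁ C₂ : ℝ, 0 < C₁ ∧ C₁ ≤ C₂ ∧ ∀ θ ∈ TsetR 2,
      C₁ * umq 2 1 θ ≤ extAop^[3] f θ ∧ extAop^[3] f θ ≤ C₂ * umq 2 1 θ := by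
  have hM := continuous_avgOp (continuous_extAop (continuous_extAop hf))
  have hne : (TsetR 2).Nonempty := ⟨![0, 0], mem_TsetR_two.2 (by norm_num)⟩
  obtain ⟨θ₁, hθ₁, hmin⟩ := (isCompact_TsetR 2).exists_isMinOn hne hM.continuousOn
  obtain ⟨θ₂, hθ₂, hmax⟩ := (isCompact_TsetR 2).exists_isMaxOn hne hM.continuousOn
  refine ⟨avgOp (extAop (extAop f)) θ₁, avgOp (extAop (extAop f)) θ₂, ?_, hmin hθ₂, ?_⟩
  · obtain ⟨a, b, rfl⟩ : ∃ a b, θ₁ = ![a, b] := ⟨θ₁ 0, θ₁ 1, by ext i; fin_cases i <;> rfl⟩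
    exact avgOp_extAop_extAop_two_pos hf h0 hp hpq hq hpos hθ₁
  · intro θ hθ
    obtain ⟨a, b, rfl⟩ : ∃ a b, θ = ![a, b] := ⟨θ 0, θ 1, by ext i; fin_cases i <;> rfl⟩
    have hab := (mem_TsetR_two.1 hθ).2.1
    change _ ≤ extAop (extAop (extAop f)) _ ∧ extAop (extAop (extAop f)) _ ≤ _
    rw [umq_two, extAop_two, mul_comm (b - a)]
    exact ⟨mul_le_mul_of_nonneg_right (hmin hθ) (sub_nonneg.2 hab),
      mul_le_mul_of_nonneg_right (hmax hθ) (sub_nonneg.2 hab)⟩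

theorem mem_TsetR_three {a b c : ℝ} :
    ![a, b, c] ∈ TsetR 3 ↔ -1 ≤ a ∧ a ≤ b ∧ b ≤ c ∧ c ≤ 0 := by
  rw [mem_TsetR_succ]
  simp [Fin.forall_fin_two, Fin.last]
  tauto

theorem extAop_three (f : (Fin 3 → ℝ) → ℝ) (a b c : ℝ) :
    extAop f ![a, b, c] = (b - a) * (c - b) * avgOp f ![a, b, c] := by
  simp [extAop, Fin.prod_univ_two]

theorem umq_three (a b c : ℝ) :
    umq 3 2 ![a, b, c] = (b - a) * (c - b) * ((c - a) * (1 + a - b)) := by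
  have h1 : Finset.univ.filter (fun p : Fin 3 × Fin 3 =>
      p.1 < p.2 ∧ (p.2 : ℕ) - (p.1 : ℕ) ≤ 2) = {(0, 1), (0, 2), (1, 2)} := by decide
  have h2 : Finset.univ.filter (fun p : Fin 3 × Fin 3 =>
      p.1 < p.2 ∧ (p.2 : ℕ) + 2 ≤ 3 ∧ 3 - 2 ≤ (p.2 : ℕ) - (p.1 : ℕ)) = {(0, 1)} := by decide
  rw [umq, h1, h2, Finset.prod_insert (by decide), Finset.prod_insert (by decide),
    Finset.prod_singleton, Finset.prod_singleton]
  simp only [Matrix.cons_val]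
  ring

theorem snoc_two_eq (t : Fin 2 → ℝ) : (Fin.snoc t 0 : Fin 3 → ℝ) = ![t 0, t 1, 0] := by
  ext i
  fin_cases i <;> simp [Fin.snoc]

theorem avgOp_three (f : (Fin 3 → ℝ) → ℝ) (a b c : ℝ) :
    avgOp f ![a, b, c] = boxAvg (fun t : Fin 2 → ℝ => f ![t 0, t 1, 0]) ![a, b] ![b, c] +
      (1 + a) * boxAvg f ![-1, a, b] ![a, b, c] := by
  have h1 : (fun j : Fin 2 => (![a, b, c] : Fin 3 → ℝ) j.castSucc) = ![a, b] := by
    ext j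
    fin_cases j <;> rfl
  have h2 : (fun j : Fin 2 => (![a, b, c] : Fin 3 → ℝ) j.succ) = ![b, c] := by
    ext j
    fin_cases j <;> rfl
  rw [avgOp, h1, h2]
  simp only [snoc_two_eq]
  rfl

theorem avgOp_three_pos_of_boundary {f : (Fin 3 → ℝ) → ℝ} (hf : Continuous f)
    (h0 : ∀ θ ∈ TsetR 3, 0 ≤ f θ) {a b c x y : ℝ} (ha : -1 ≤ a) (hc : c ≤ 0) (hax : a ≤ x)
    (hxb : x ≤ b) (hby : b ≤ y) (hyc : y ≤ c) (hpos : 0 < f ![x, y, 0]) :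
    0 < avgOp f ![a, b, c] := by
  refine avgOp_pos_of_snoc hf h0
    (mem_TsetR_three.2 ⟨ha, hax.trans hxb, hby.trans hyc, hc⟩) (t := ![x, y]) ?_ ?_
  · simpa [Fin.forall_fin_two] using ⟨⟨hax, hxb⟩, hby, hyc⟩
  · simpa [snoc_two_eq] using hpos

theorem avgOp_three_pos_of_mem {f : (Fin 3 → ℝ) → ℝ} (hf : Continuous f)
    (h0 : ∀ θ ∈ TsetR 3, 0 ≤ f θ) {a b c w x y : ℝ} (ha : -1 < a) (hc : c ≤ 0) (hw : -1 ≤ w)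
    (hwa : w ≤ a) (hax : a ≤ x) (hxb : x ≤ b) (hby : b ≤ y) (hyc : y ≤ c)
    (hpos : 0 < f ![w, x, y]) : 0 < avgOp f ![a, b, c] := by
  refine avgOp_pos_of_mem hf h0
    (mem_TsetR_three.2 ⟨ha.le, hax.trans hxb, hby.trans hyc, hc⟩) (by simpa using ha)
    (t := ![w, x, y]) ⟨?_, ?_⟩ hpos
  · intro i
    fin_cases i
    exacts [hw, hax, hby]
  · intro i
    fin_cases i
    exacts [hwa, hxb, hyc]

theorem exists_interior_pos_three {f : (Fin 3 → ℝ) → ℝ} (hf : Continuous f)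
    {θ : Fin 3 → ℝ} (hθ : θ ∈ TsetR 3) (hpos : 0 < f θ) :
    ∃ p q r : ℝ, -1 < p ∧ p < q ∧ q < r ∧ r < 0 ∧ 0 < f ![p, q, r] := by
  obtain ⟨ε, h0, h1, h⟩ := exists_pos_on_segment hf hpos ![-3 / 4, -1 / 2, -1 / 4]
  obtain ⟨a, b, c, rfl⟩ : ∃ a b c, θ = ![a, b, c] :=
    ⟨θ 0, θ 1, θ 2, by ext i; fin_cases i <;> rfl⟩
  rw [mem_TsetR_three] at hθ
  refine ⟨a + ε * (-3 / 4 - a), b + ε * (-1 / 2 - b), c + ε * (-1 / 4 - c), by nlinarith,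
    by nlinarith, by nlinarith, by nlinarith, ?_⟩
  convert h using 2
  ext i
  fin_cases i <;> simp

theorem extAop_three_pos_at {f : (Fin 3 → ℝ) → ℝ} (hf : Continuous f)
    (h0 : ∀ θ ∈ TsetR 3, 0 ≤ f θ) {p q r : ℝ} (hp : -1 < p) (hpq : p < q) (hqr : q < r)
    (hr : r < 0) (hpos : 0 < f ![p, q, r]) : 0 < extAop f ![p, q, r] := by
  rw [extAop_three]
  exact mul_pos (mul_pos (sub_pos.2 hpq) (sub_pos.2 hqr))
    (avgOp_three_pos_of_mem hf h0 hp hr.le hp.le le_rfl hpq.le le_rfl hqr.le le_rfl hpos)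

/-- The third iterate is positive on a union of three regions covering enough of the simplex. -/
theorem iterate_three_extAop_pos {f : (Fin 3 → ℝ) → ℝ} (hf : Continuous f)
    (h0 : ∀ θ ∈ TsetR 3, 0 ≤ f θ) {p q r : ℝ} (hp : -1 < p) (hpq : p < q) (hqr : q < r)
    (hr : r < 0) (hpos : 0 < f ![p, q, r]) {a b c : ℝ} (ha : -1 ≤ a) (hab : a < b) (hbc : b < c)
    (hc : c ≤ 0) (h : (a ≤ q ∧ b ≤ r ∧ p ≤ c) ∨ (a ≤ r ∧ p ≤ b ∧ q ≤ c) ∨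
      (p ≤ a ∧ q ≤ b ∧ r ≤ c)) : 0 < extAop^[3] f ![a, b, c] := by
  have hf1 := continuous_extAop hf
  have hf2 := continuous_extAop hf1
  have h1 := extAop_nonneg h0
  have h2 := extAop_nonneg h1
  have S1 : ∀ a b c : ℝ, p ≤ a → a ≤ q → q ≤ b → b ≤ r → r ≤ c → c ≤ 0 → a < b → b < c →
      0 < extAop f ![a, b, c] := by
    intro a b c h1 h2 h3 h4 h5 h6 h7 h8
    rw [extAop_three]
    exact mul_pos (mul_pos (sub_pos.2 h7) (sub_pos.2 h8))
      (avgOp_three_pos_of_mem hf h0 (hp.trans_le h1) h6 hp.le h1 h2 h3 h4 h5 hpos)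
  have S2a : ∀ a b c : ℝ, -1 ≤ a → a < b → b < c → c ≤ 0 → a ≤ q → p ≤ b → b ≤ r → q ≤ c →
      0 < extAop (extAop f) ![a, b, c] := by
    intro a b c ha hab hbc hc h3 h4 h5 h6
    rw [extAop_three]
    refine mul_pos (mul_pos (sub_pos.2 hab) (sub_pos.2 hbc)) ?_
    exact avgOp_three_pos_of_boundary hf1 h1 (x := max a p) (y := max b q) ha hc
      (le_max_left _ _) (max_le hab.le h4) (le_max_left _ _) (max_le hbc.le h6)
      (S1 _ _ _ (le_max_right _ _) (max_le h3 hpq.le) (le_max_right _ _) (max_le h5 hqr.le) hr.le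
        le_rfl (max_lt_max hab hpq) (max_lt (by linarith) (by linarith)))
  have S2b : ∀ a b c : ℝ, a < b → b < c → c ≤ 0 → p ≤ a → a ≤ r → q ≤ b → r ≤ c →
      0 < extAop (extAop f) ![a, b, c] := by
    intro a b c hab hbc hc h3 h4 h5 h6
    rw [extAop_three]
    refine mul_pos (mul_pos (sub_pos.2 hab) (sub_pos.2 hbc)) ?_
    exact avgOp_three_pos_of_mem hf1 h1 (w := p) (x := max a q) (y := max b r) (by linarith) hc
      hp.le h3 (le_max_left _ _) (max_le hab.le h5) (le_max_left _ _) (max_le hbc.le h6)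
      (S1 _ _ _ le_rfl hpq.le (le_max_right _ _) (max_le h4 hqr.le) (le_max_right _ _)
        (max_le (by linarith) hr.le) (lt_max_of_lt_right hpq) (max_lt_max hab hqr))
  change 0 < extAop (extAop (extAop f)) _
  rw [extAop_three]
  refine mul_pos (mul_pos (sub_pos.2 hab) (sub_pos.2 hbc)) ?_
  rcases h with ⟨h3, h4, h5⟩ | ⟨h3, h4, h5⟩ | ⟨h3, h4, h5⟩
  · exact avgOp_three_pos_of_boundary hf2 h2 (x := a) (y := max b p) ha hc le_rfl hab.le
      (le_max_left _ _) (max_le hbc.le h5) (S2a _ _ _ ha (lt_max_of_lt_left hab)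
        (max_lt (by linarith) (by linarith)) le_rfl h3 (le_max_right _ _)
        (max_le h4 (by linarith)) (by linarith))
  · exact avgOp_three_pos_of_boundary hf2 h2 (x := max a p) (y := max b q) ha hc
      (le_max_left _ _) (max_le hab.le h4) (le_max_left _ _) (max_le hbc.le h5)
      (S2b _ _ _ (max_lt_max hab hpq) (max_lt (by linarith) (by linarith)) le_rfl
        (le_max_right _ _) (max_le h3 (by linarith)) (le_max_right _ _) hr.le)
  · exact avgOp_three_pos_of_mem hf2 h2 (w := p) (x := max a q) (y := max b r) (by linarith) hc
      hp.le h3 (le_max_left _ _) (max_le hab.le h4) (le_max_left _ _) (max_le hbc.le h5)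
      (S2b _ _ _ (lt_max_of_lt_right hpq) (max_lt_max hab hqr) (max_le (by linarith) hr.le) le_rfl
        (by linarith) (le_max_right _ _) (le_max_right _ _))

theorem avgOp_iterate_three_pos {f : (Fin 3 → ℝ) → ℝ} (hf : Continuous f)
    (h0 : ∀ θ ∈ TsetR 3, 0 ≤ f θ) {p q r : ℝ} (hp : -1 < p) (hpq : p < q) (hqr : q < r)
    (hr : r < 0) (hpos : 0 < f ![p, q, r]) {a b c : ℝ} (hT : ![a, b, c] ∈ TsetR 3)
    (hac : a < c) (hcorner : -1 < a ∨ b < 0) : 0 < avgOp (extAop^[3] f) ![a, b, c] := by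
  have hf3 := continuous_iterate_extAop hf 3
  have h3 := iterate_extAop_nonneg h0 3
  have S3 := @iterate_three_extAop_pos f hf h0 p q r hp hpq hqr hr hpos
  obtain ⟨ha, hab, hbc, hc⟩ := mem_TsetR_three.1 hT
  by_cases hqr' : a ≤ q ∧ b ≤ r
  · exact avgOp_three_pos_of_boundary hf3 h3 (x := a) (y := min c r) ha hc le_rfl hab
      (le_min hbc hqr'.2) (min_le_left _ _) (S3 ha (lt_min hac (by linarith))
        (min_lt_of_right_lt hr) le_rfl (Or.inl ⟨hqr'.1, min_le_right _ _, by linarith⟩))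
  have hpb : p ≤ b ∧ q ≤ b := by
    by_cases haq : a ≤ q
    · have : ¬ b ≤ r := fun h => hqr' ⟨haq, h⟩
      constructor <;> linarith
    · constructor <;> linarith
  rcases (hbc.trans hc).lt_or_eq with hb0 | rfl
  · refine avgOp_three_pos_of_boundary hf3 h3 (x := a) (y := (b + c) / 2) ha hc le_rfl hab
      (by linarith) (by linarith) (S3 ha (by linarith) (by linarith) le_rfl (Or.inr ?_))
    rcases le_or_gt a r with har | har
    · exact Or.inl ⟨har, by linarith, by linarith⟩
    · exact Or.inr ⟨by linarith, by linarith, hr.le⟩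
  · obtain rfl : c = 0 := le_antisymm hc hbc
    have ha1 : -1 < a := by simpa using hcorner
    refine avgOp_three_pos_of_mem hf3 h3 (w := -1) (x := a) (y := 0) ha1 hc le_rfl ha le_rfl hab
      le_rfl le_rfl (S3 le_rfl ha1 hac le_rfl ?_)
    rcases le_or_gt a r with har | har
    · exact Or.inl ⟨by linarith, har, by linarith⟩
    · exact Or.inr (Or.inl ⟨by linarith, by linarith, by linarith⟩)

theorem mem_TsetR_of_mem_Icc_cons {a b c : ℝ} (hT : ![a, b, c] ∈ TsetR 3) {t : Fin 3 → ℝ}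
    (ht : t ∈ Set.Icc ![-1, a, b] ![a, b, c]) : t ∈ TsetR 3 := by
  refine mem_TsetR_of_mem_Icc hT ⟨fun i => ?_, ht.2⟩
  fin_cases i
  exacts [ht.1 0, ht.1 1, ht.1 2]

/-- A function on triples vanishing to first order where consecutive coordinates agree. -/
def gapMul (M : (Fin 3 → ℝ) → ℝ) (θ : Fin 3 → ℝ) : ℝ :=
  (θ 1 - θ 0) * (θ 2 - θ 1) * M θ

theorem continuous_gapMul {M : (Fin 3 → ℝ) → ℝ} (hM : Continuous M) : Continuous (gapMul M) := by
  unfold gapMul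
  fun_prop

theorem gapMul_nonneg {M : (Fin 3 → ℝ) → ℝ} (hM0 : ∀ θ ∈ TsetR 3, 0 ≤ M θ) :
    ∀ θ ∈ TsetR 3, 0 ≤ gapMul M θ := fun θ hθ =>
  mul_nonneg (mul_nonneg (sub_nonneg.2 (hθ.2 (by decide))) (sub_nonneg.2 (hθ.2 (by decide))))
    (hM0 θ hθ)

theorem avgOp_gapMul_le {M : (Fin 3 → ℝ) → ℝ} (hM : Continuous M)
    (hM0 : ∀ θ ∈ TsetR 3, 0 ≤ M θ) {C : ℝ} (hMC : ∀ θ ∈ TsetR 3, M θ ≤ C) {a b c : ℝ}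
    (hT : ![a, b, c] ∈ TsetR 3) :
    avgOp (gapMul M) ![a, b, c] ≤ C * ((c - a) * (1 + a - b)) := by
  obtain ⟨ha, hab, hbc, hc⟩ := mem_TsetR_three.1 hT
  have hcont := continuous_gapMul hM
  have h1 : boxAvg (fun t : Fin 2 → ℝ => gapMul M ![t 0, t 1, 0]) ![a, b] ![b, c] ≤
      (c - a) * (-b) * C := by
    refine boxAvg_le (hcont.comp (by fun_prop))
      (by simp [Pi.le_def, Fin.forall_fin_two, hab, hbc]) ?_
    rintro t ⟨ht1, ht2⟩
    have h10 : a ≤ t 0 := ht1 0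
    have h11 : b ≤ t 1 := ht1 1
    have h20 : t 0 ≤ b := ht2 0
    have h21 : t 1 ≤ c := ht2 1
    have hmem : ![t 0, t 1, 0] ∈ TsetR 3 :=
      mem_TsetR_three.2 ⟨by linarith, by linarith, by linarith, le_rfl⟩
    change (t 1 - t 0) * (0 - t 1) * _ ≤ _
    exact mul_le_mul (mul_le_mul (by linarith) (by linarith) (by linarith) (by linarith))
      (hMC _ hmem) (hM0 _ hmem) (mul_nonneg (by linarith) (by linarith))
  have h2 : boxAvg (gapMul M) ![-1, a, b] ![a, b, c] ≤ 1 * (c - a) * C := by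
    have hle : (![-1, a, b] : Fin 3 → ℝ) ≤ ![a, b, c] := by
      simp [Pi.le_def, Fin.forall_fin_succ, ha, hab, hbc]
    refine boxAvg_le hcont hle ?_
    intro t ht
    have hmem := mem_TsetR_of_mem_Icc_cons hT ht
    obtain ⟨ht1, ht2⟩ := ht
    have h10 : -1 ≤ t 0 := ht1 0
    have h11 : a ≤ t 1 := ht1 1
    have h12 : b ≤ t 2 := ht1 2
    have h20 : t 0 ≤ a := ht2 0
    have h21 : t 1 ≤ b := ht2 1
    have h22 : t 2 ≤ c := ht2 2
    exact mul_le_mul (mul_le_mul (by linarith) (by linarith) (by linarith) (by linarith))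
      (hMC _ hmem) (hM0 _ hmem) (mul_nonneg (by linarith) (by linarith))
  rw [avgOp_three]
  have h3 := mul_le_mul_of_nonneg_left h2 (by linarith : 0 ≤ 1 + a)
  linarith

theorem le_boxAvg_boundary_gapMul {M : (Fin 3 → ℝ) → ℝ} (hM : Continuous M)
    (hM0 : ∀ θ ∈ TsetR 3, 0 ≤ M θ) {a b c κ : ℝ} (hκ : 0 ≤ κ) (hT : ![a, b, c] ∈ TsetR 3)
    (h : ∀ s ∈ Set.Icc (1 / 4 : ℝ) (1 / 2), ∀ r ∈ Set.Icc (1 / 4 : ℝ) (1 / 2),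
      κ ≤ M ![a + s * (b - a), b + r * (c - b), 0]) :
    (c - a) * (-b) * κ / 128 ≤
      boxAvg (fun t : Fin 2 → ℝ => gapMul M ![t 0, t 1, 0]) ![a, b] ![b, c] := by
  obtain ⟨ha, hab, hbc, hc⟩ := mem_TsetR_three.1 hT
  have key := mul_pow_le_boxAvg (F := fun t : Fin 2 → ℝ => gapMul M ![t 0, t 1, 0])
    (l := ![a, b]) (u := ![b, c]) (κ := (c - a) / 4 * (-b / 2) * κ)
    ((continuous_gapMul hM).comp (by fun_prop))
    (by simp [Pi.le_def, Fin.forall_fin_two, hab, hbc]) ?_ ?_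
  · linarith
  · rintro t ⟨ht1, ht2⟩
    have h10 : a ≤ t 0 := ht1 0
    have h11 : b ≤ t 1 := ht1 1
    have h20 : t 0 ≤ b := ht2 0
    have h21 : t 1 ≤ c := ht2 1
    exact gapMul_nonneg hM0 _
      (mem_TsetR_three.2 ⟨by linarith, by linarith, by linarith, le_rfl⟩)
  · intro s hs
    obtain ⟨hs0, hs0'⟩ := hs 0
    obtain ⟨hs1, hs1'⟩ := hs 1
    change _ ≤ (b + s 1 * (c - b) - (a + s 0 * (b - a))) * (0 - (b + s 1 * (c - b))) *
      M ![a + s 0 * (b - a), b + s 1 * (c - b), 0]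
    have e1 : (c - a) / 4 ≤ b + s 1 * (c - b) - (a + s 0 * (b - a)) := by nlinarith
    have e2 : -b / 2 ≤ 0 - (b + s 1 * (c - b)) := by nlinarith
    exact mul_le_mul (mul_le_mul e1 e2 (by linarith) (by linarith))
      (h _ (hs 0) _ (hs 1)) hκ (mul_nonneg (by linarith) (by linarith))

theorem le_boxAvg_gapMul {M : (Fin 3 → ℝ) → ℝ} (hM : Continuous M)
    (hM0 : ∀ θ ∈ TsetR 3, 0 ≤ M θ) {a b c κ : ℝ} (hκ : 0 ≤ κ) (hT : ![a, b, c] ∈ TsetR 3)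
    (hb : -1 / 2 ≤ b)
    (h : ∀ τ ∈ Set.Icc (1 / 4 : ℝ) (1 / 2), ∀ s ∈ Set.Icc (1 / 4 : ℝ) (1 / 2),
      ∀ r ∈ Set.Icc (1 / 4 : ℝ) (1 / 2),
      κ ≤ M ![-1 + τ * (a - -1), a + s * (b - a), b + r * (c - b)]) :
    (c - a) * κ / 2048 ≤ boxAvg (gapMul M) ![-1, a, b] ![a, b, c] := by
  obtain ⟨ha, hab, hbc, hc⟩ := mem_TsetR_three.1 hT
  have key := mul_pow_le_boxAvg (F := gapMul M)
    (l := ![-1, a, b]) (u := ![a, b, c]) (κ := 1 / 8 * ((c - a) / 4) * κ)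
    (continuous_gapMul hM) (by simp [Pi.le_def, Fin.forall_fin_succ, ha, hab, hbc])
    (fun t ht => gapMul_nonneg hM0 _ (mem_TsetR_of_mem_Icc_cons hT ht)) ?_
  · linarith
  · intro s hs
    obtain ⟨hs0, hs0'⟩ := hs 0
    obtain ⟨hs1, hs1'⟩ := hs 1
    obtain ⟨hs2, hs2'⟩ := hs 2
    have hval : (![-1, a, b] : Fin 3 → ℝ) + s * (![a, b, c] - ![-1, a, b]) =
        ![-1 + s 0 * (a - -1), a + s 1 * (b - a), b + s 2 * (c - b)] := by
      ext i
      fin_cases i <;> rfl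
    rw [hval]
    change _ ≤ (a + s 1 * (b - a) - (-1 + s 0 * (a - -1))) *
      (b + s 2 * (c - b) - (a + s 1 * (b - a))) * M _
    have e1 : 1 / 8 ≤ a + s 1 * (b - a) - (-1 + s 0 * (a - -1)) := by nlinarith
    have e2 : (c - a) / 4 ≤ b + s 2 * (c - b) - (a + s 1 * (b - a)) := by nlinarith
    exact mul_le_mul (mul_le_mul e1 e2 (by linarith) (by linarith))
      (h _ (hs 0) _ (hs 1) _ (hs 2)) hκ (mul_nonneg (by linarith) (by linarith))

theorem le_avgOp_gapMul {M : (Fin 3 → ℝ) → ℝ} (hM : Continuous M)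
    (hM0 : ∀ θ ∈ TsetR 3, 0 ≤ M θ) {κ : ℝ} (hκ : 0 ≤ κ)
    (hMκ : ∀ x y z : ℝ, ![x, y, z] ∈ TsetR 3 → 1 / 16 ≤ z - x → (-15 / 16 ≤ x ∨ y ≤ -1 / 8) →
      κ ≤ M ![x, y, z])
    {a b c : ℝ} (hT : ![a, b, c] ∈ TsetR 3) :
    κ / 8192 * ((c - a) * (1 + a - b)) ≤ avgOp (gapMul M) ![a, b, c] := by
  obtain ⟨ha, hab, hbc, hc⟩ := mem_TsetR_three.1 hT
  have hca : 0 ≤ (c - a) * κ := mul_nonneg (by linarith) hκ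
  rw [avgOp_three]
  have hB0 : 0 ≤ boxAvg (fun t : Fin 2 → ℝ => gapMul M ![t 0, t 1, 0]) ![a, b] ![b, c] := by
    simpa using le_boxAvg_boundary_gapMul hM hM0 le_rfl hT fun s hs r hr => hM0 _
      (mem_TsetR_three.2 ⟨by nlinarith [hs.1], by nlinarith [hs.2, hr.1], by nlinarith [hr.2],
        le_rfl⟩)
  rcases le_or_gt b (-1 / 2) with hb | hb
  · have hB1 : 0 ≤ boxAvg (gapMul M) ![-1, a, b] ![a, b, c] :=
      boxAvg_nonneg (by simp [Pi.le_def, Fin.forall_fin_succ, ha, hab, hbc])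
        fun t ht => gapMul_nonneg hM0 _ (mem_TsetR_of_mem_Icc_cons hT ht)
    have h1 := le_boxAvg_boundary_gapMul hM hM0 hκ hT fun s hs r hr => by
      obtain ⟨hs, hs'⟩ := hs
      obtain ⟨hr, hr'⟩ := hr
      exact hMκ _ _ _ (mem_TsetR_three.2 ⟨by nlinarith, by nlinarith, by nlinarith, le_rfl⟩)
        (by nlinarith) (Or.inr (by nlinarith))
    have h2 := mul_nonneg (by linarith : 0 ≤ 1 + a) hB1
    nlinarith
  have hB1 : (c - a) * κ / 2048 ≤ boxAvg (gapMul M) ![-1, a, b] ![a, b, c] := by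
    refine le_boxAvg_gapMul hM hM0 hκ hT hb.le fun τ hτ s hs r hr => ?_
    obtain ⟨hτ, hτ'⟩ := hτ
    obtain ⟨hs, hs'⟩ := hs
    obtain ⟨hr, hr'⟩ := hr
    refine hMκ _ _ _
      (mem_TsetR_three.2 ⟨by nlinarith, by nlinarith, by nlinarith, by nlinarith⟩) ?_ ?_
    · nlinarith
    · rcases le_total (-3 / 4) a with ha' | ha'
      · exact Or.inl (by nlinarith)
      · exact Or.inr (by nlinarith)
  have hB1 := mul_le_mul_of_nonneg_left hB1 (by linarith : 0 ≤ 1 + a)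
  rcases le_or_gt a (-3 / 4) with ha' | ha'
  · have h1 := le_boxAvg_boundary_gapMul hM hM0 hκ hT fun s hs r hr => by
      obtain ⟨hs, hs'⟩ := hs
      obtain ⟨hr, hr'⟩ := hr
      exact hMκ _ _ _ (mem_TsetR_three.2 ⟨by nlinarith, by nlinarith, by nlinarith, le_rfl⟩)
        (by nlinarith) (Or.inl (by nlinarith))
    nlinarith [mul_nonneg hca (by linarith : 0 ≤ -b), mul_nonneg hca (by linarith : 0 ≤ 1 + a)]
  · nlinarith

theorem extAop_eq_gapMul (f : (Fin 3 → ℝ) → ℝ) : extAop f = gapMul (avgOp f) := by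
  ext θ
  rw [extAop, Fin.prod_univ_two]
  rfl

theorem exists_bounds_three {f : (Fin 3 → ℝ) → ℝ} (hf : Continuous f)
    (h0 : ∀ θ ∈ TsetR 3, 0 ≤ f θ) {p q r : ℝ} (hp : -1 < p) (hpq : p < q) (hqr : q < r)
    (hr : r < 0) (hpos : 0 < f ![p, q, r]) :
    ∃ C₁ C₂ : ℝ, 0 < C₁ ∧ C₁ ≤ C₂ ∧ ∀ θ ∈ TsetR 3,
      C₁ * umq 3 2 θ ≤ extAop^[5] f θ ∧ extAop^[5] f θ ≤ C₂ * umq 3 2 θ := by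
  let M := avgOp (extAop^[3] f)
  have hM : Continuous M := continuous_avgOp (continuous_iterate_extAop hf 3)
  have hM0 : ∀ θ ∈ TsetR 3, 0 ≤ M θ := fun θ hθ => avgOp_nonneg (iterate_extAop_nonneg h0 3) hθ
  let G := TsetR 3 ∩ {θ | 1 / 16 ≤ θ 2 - θ 0 ∧ (-15 / 16 ≤ θ 0 ∨ θ 1 ≤ -1 / 8)}
  have hG : IsCompact G := by
    refine (isCompact_TsetR 3).inter_right ?_
    have h1 : IsClosed {θ : Fin 3 → ℝ | 1 / 16 ≤ θ 2 - θ 0} :=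
      isClosed_le (by fun_prop) (by fun_prop)
    have h2 : IsClosed {θ : Fin 3 → ℝ | -15 / 16 ≤ θ 0} := isClosed_le (by fun_prop) (by fun_prop)
    have h3 : IsClosed {θ : Fin 3 → ℝ | θ 1 ≤ -1 / 8} := isClosed_le (by fun_prop) (by fun_prop)
    exact h1.inter (h2.union h3)
  have hGne : G.Nonempty :=
    ⟨![-1 / 2, -1 / 2, 0], mem_TsetR_three.2 (by norm_num), by simp; norm_num⟩
  obtain ⟨θ₁, hθ₁, hmin⟩ := hG.exists_isMinOn hGne hM.continuousOn
  obtain ⟨θ₂, hθ₂, hmax⟩ := (isCompact_TsetR 3).exists_isMaxOn (hGne.mono Set.inter_subset_left)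
    hM.continuousOn
  have hκ : 0 < M θ₁ := by
    obtain ⟨a, b, c, rfl⟩ : ∃ a b c, θ₁ = ![a, b, c] :=
      ⟨θ₁ 0, θ₁ 1, θ₁ 2, by ext i; fin_cases i <;> rfl⟩
    obtain ⟨hT, hca, hcorner⟩ := hθ₁
    change 1 / 16 ≤ c - a at hca
    change -15 / 16 ≤ a ∨ b ≤ -1 / 8 at hcorner
    exact avgOp_iterate_three_pos hf h0 hp hpq hqr hr hpos hT (by linarith)
      (hcorner.imp (fun _ => by linarith) fun _ => by linarith)
  refine ⟨M θ₁ / 8192, M θ₂, by positivity, ?_, fun θ hθ => ?_⟩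
  · have := hmax hθ₁.1
    change M θ₁ ≤ M θ₂ at this
    linarith
  · obtain ⟨a, b, c, rfl⟩ : ∃ a b c, θ = ![a, b, c] :=
      ⟨θ 0, θ 1, θ 2, by ext i; fin_cases i <;> rfl⟩
    obtain ⟨ha, hab, hbc, hc⟩ := mem_TsetR_three.1 hθ
    have hnn : 0 ≤ (b - a) * (c - b) := mul_nonneg (by linarith) (by linarith)
    have hlow := le_avgOp_gapMul hM hM0 hκ.le
      (fun x y z hT h1 h2 => hmin (⟨hT, h1, h2⟩ : ![x, y, z] ∈ G)) hθ
    have hup := avgOp_gapMul_le hM hM0 (fun θ hθ => hmax hθ) hθ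
    have hiter : extAop^[5] f = extAop (gapMul M) := by
      rw [Function.iterate_succ_apply', Function.iterate_succ_apply',
        extAop_eq_gapMul (extAop^[3] f)]
    rw [umq_three, hiter, extAop_three]
    have h1 := mul_le_mul_of_nonneg_left hlow hnn
    have h2 := mul_le_mul_of_nonneg_left hup hnn
    constructor <;> linarith

/-- Two-sided bounds that hold after `k₀` steps for every function positive at `x` hold after every
`k ≥ k₀` steps, provided that positivity at `x` is preserved. -/
theorem exists_bounds_iterate_Aop {n k₀ : ℕ} {u : (Fin (n + 1) → ℝ) → ℝ} {x : Fin (n + 1) → ℝ}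
    (hstep : ∀ f : (Fin (n + 1) → ℝ) → ℝ, Continuous f → (∀ θ ∈ TsetR (n + 1), 0 ≤ f θ) →
      0 < f x → 0 < extAop f x)
    (hbounds : ∀ f : (Fin (n + 1) → ℝ) → ℝ, Continuous f → (∀ θ ∈ TsetR (n + 1), 0 ≤ f θ) →
      0 < f x → ∃ C₁ C₂ : ℝ, 0 < C₁ ∧ C₁ ≤ C₂ ∧ ∀ θ ∈ TsetR (n + 1),
        C₁ * u θ ≤ extAop^[k₀] f θ ∧ extAop^[k₀] f θ ≤ C₂ * u θ)
    {φ f : (Fin (n + 1) → ℝ) → ℝ} (hf : Continuous f) (hφf : ∀ θ ∈ TsetR (n + 1), φ θ = f θ)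
    (h0 : ∀ θ ∈ TsetR (n + 1), 0 ≤ f θ) (hx : 0 < f x) {k : ℕ} (hk : k₀ ≤ k) :
    ∃ C₁ C₂ : ℝ, 0 < C₁ ∧ C₁ ≤ C₂ ∧ ∀ θ ∈ TsetR (n + 1),
      C₁ * u θ ≤ (Aop (n + 1))^[k] φ θ ∧ (Aop (n + 1))^[k] φ θ ≤ C₂ * u θ := by
  have hpos : ∀ j, 0 < extAop^[j] f x := by
    intro j
    induction j with
    | zero => exact hx
    | succ j ih =>
      rw [Function.iterate_succ_apply']
      exact hstep _ (continuous_iterate_extAop hf j) (iterate_extAop_nonneg h0 j) ih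
  obtain ⟨j, rfl⟩ := Nat.exists_eq_add_of_le hk
  obtain ⟨C₁, C₂, h1, h2, h3⟩ := hbounds _ (continuous_iterate_extAop hf j)
    (iterate_extAop_nonneg h0 j) (hpos j)
  refine ⟨C₁, C₂, h1, h2, fun θ hθ => ?_⟩
  rw [iterate_Aop_eq_iterate_extAop hφf _ θ hθ, Function.iterate_add_apply]
  exact h3 θ hθ

theorem statement13 (m : ℕ) (hm : m = 2 ∨ m = 3)
    (φ : (Fin m → ℝ) → ℝ) (hcont : ContinuousOn φ (TsetR m))
    (hpos : ∀ θ ∈ TsetR m, 0 ≤ φ θ) (hne : ∃ θ ∈ TsetR m, φ θ ≠ 0) :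
    ∀ k : ℕ, (if m = 2 then 3 else 5) ≤ k →
      ∃ C₁ C₂ : ℝ, 0 < C₁ ∧ C₁ ≤ C₂ ∧
        ∀ θ ∈ TsetR m,
          C₁ * umq m (m - 1) θ ≤ (Aop m)^[k] φ θ ∧
          (Aop m)^[k] φ θ ≤ C₂ * umq m (m - 1) θ := by
  intro k hk
  obtain ⟨θ₀, hθ₀, hne⟩ := hne
  obtain ⟨f, hf, hφf⟩ := exists_continuous_eqOn hcont
  have h0 : ∀ θ ∈ TsetR m, 0 ≤ f θ := fun θ hθ => hφf θ hθ ▸ hpos θ hθ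
  have hfθ₀ : 0 < f θ₀ := hφf θ₀ hθ₀ ▸ lt_of_le_of_ne (hpos θ₀ hθ₀) hne.symm
  rcases hm with rfl | rfl
  · obtain ⟨p, q, hp, hpq, hq, hfx⟩ := exists_interior_pos_two hf hθ₀ hfθ₀
    exact exists_bounds_iterate_Aop
      (fun g hg hg0 hgx => extAop_two_pos_at hg hg0 hp hpq hq hgx)
      (fun g hg hg0 hgx => exists_bounds_two hg hg0 hp hpq hq hgx) hf hφf h0 hfx
      (by simpa using hk)
  · obtain ⟨p, q, r, hp, hpq, hqr, hr, hfx⟩ := exists_interior_pos_three hf hθ₀ hfθ₀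
    exact exists_bounds_iterate_Aop
      (fun g hg hg0 hgx => extAop_three_pos_at hg hg0 hp hpq hqr hr hgx)
      (fun g hg hg0 hgx => exists_bounds_three hg hg0 hp hpq hqr hr hgx) hf hφf h0 hfx
      (by simpa using hk)
end
end
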